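/- Let u₀ ∈ L¹(ℝ) ∩ BV(ℝ), assume f is continuously differentiable, and assume there exists h: ℝ → ℝ of finite total variation such that A(u₀(x)) = A(u₀(0)) + ∫_0^x ( f(u₀(y)) − b ∫_0^y L[u₀](s) ds − h(y) ) dy for every x ∈ ℝ. Let T > 0, let (Δx_j)_{j∈ℕ} be positive numbers with Δx_j → 0, let N_j be positive integers with Δt_j = T/N_j, and assume each pair (Δx_j, Δt_j) satisfies the CFL condition. Let (U_i^{n,j}) be the scheme iterates on the grid (Δx_j, Δt_j) and let û_j: ℝ × [0,T] → ℝ be the bilinear interpolants: for (x,t) ∈ [iΔx_j, (i+1)Δx_j) × [nΔt_j, (n+1)Δt_j), û_j(x,t) = U_i^{n,j} + (U_{i+1}^{n,j} − U_i^{n,j})(x − iΔx_j)/Δx_j + (U_i^{n+1,j} − U_i^{n,j})(t − nΔt_j)/Δt_j + (U_{i+1}^{n+1,j} − U_i^{n+1,j} − U_{i+1}^{n,j} + U_i^{n,j}) ((x − iΔx_j)/Δx_j)((t − nΔt_j)/Δt_j). Then there exist a subsequence of (û_j) and a function u ∈ L¹(Q_T) having bounded variation on Q_T such that the subsequence converges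 to u in L¹(K) for every compact K ⊂ Q_T, and u is a BV entropy solution of u_t + f(u)_x = (a(u)u_x)_x + b L[u] with initial datum u₀. -/

import Mathlib

open MeasureTheory Filter Set

/-- The fractional Laplacian `L[φ](x) = c_λ ∫_{z ≠ 0} (φ(x+z) − φ(x))/|z|^{1+λ} dz`. -/
noncomputable def fracLap (clam lam : ℝ) (φ : ℝ → ℝ) (x : ℝ) : ℝ :=
  clam * ∫ z in ({0}ᶜ : Set ℝ), (φ (x + z) - φ x) / |z| ^ (1 + lam)

/-- Indicator function of the cell `I_j = (jΔx, (j+1)Δx)`. -/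
noncomputable def cellInd (Δx : ℝ) (j : ℤ) : ℝ → ℝ :=
  Set.indicator (Set.Ioo ((j : ℝ) * Δx) (((j : ℝ) + 1) * Δx)) 1

/-- The weights `G^i_j = ∫_{I_i} L[1_{I_j}](x) dx`. -/
noncomputable def Gw (clam lam Δx : ℝ) (i j : ℤ) : ℝ :=
  ∫ x in Set.Ioo ((i : ℝ) * Δx) (((i : ℝ) + 1) * Δx), fracLap clam lam (cellInd Δx j) x

/-- `A(u) = ∫_0^u a(s) ds`. -/
noncomputable def Aint (a : ℝ → ℝ) (u : ℝ) : ℝ := ∫ s in (0:ℝ)..u, a s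

/-- One step of the explicit scheme. -/
noncomputable def schemeStep (clam lam Δx Δt b : ℝ) (fhat : ℝ → ℝ → ℝ) (a : ℝ → ℝ)
    (U : ℤ → ℝ) (i : ℤ) : ℝ :=
  U i - (Δt / Δx) * (fhat (U i) (U (i + 1)) - fhat (U (i - 1)) (U i))
    + (Δt / Δx ^ 2) * (Aint a (U (i + 1)) - 2 * Aint a (U i) + Aint a (U (i - 1)))
    + (b * Δt / Δx) * ∑' j : ℤ, Gw clam lam Δx i j * U j

/-- The scheme iterates: `U^0_i = (1/Δx)∫_{I_i} u₀` and `U^{n+1} = S(U^n)`. -/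
noncomputable def Uiter (clam lam Δx Δt b : ℝ) (fhat : ℝ → ℝ → ℝ) (a : ℝ → ℝ)
    (u₀ : ℝ → ℝ) : ℕ → ℤ → ℝ
  | 0 => fun i => (1 / Δx) * ∫ x in Set.Ioo ((i : ℝ) * Δx) (((i : ℝ) + 1) * Δx), u₀ x
  | n + 1 => schemeStep clam lam Δx Δt b fhat a (Uiter clam lam Δx Δt b fhat a u₀ n)

/-- `d_λ = c_λ ( ∫_{|z|<1} |z|^{−λ} dz + ∫_{|z|>1} |z|^{−1−λ} dz )`. -/
noncomputable def dlam (clam lam : ℝ) : ℝ :=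
  clam * ((∫ z in {z : ℝ | |z| < 1}, |z| ^ (-lam)) + ∫ z in {z : ℝ | 1 < |z|}, |z| ^ (-1 - lam))

/-- The CFL condition: `f̂` is C¹ with bounded partial derivatives and
`(Δt/Δx)(‖∂₁f̂‖_∞ + ‖∂₂f̂‖_∞) + (2Δt/Δx²)‖a‖_∞ + b d_λ Δt/Δx^λ ≤ 1`. -/
def CFL (clam lam Δx Δt b : ℝ) (fhat : ℝ → ℝ → ℝ) (a : ℝ → ℝ) : Prop :=
  ContDiff ℝ 1 (fun p : ℝ × ℝ => fhat p.1 p.2) ∧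
  ∃ M1 M2 Ma : ℝ,
    (∀ u v : ℝ, |deriv (fun s => fhat s v) u| ≤ M1) ∧
    (∀ u v : ℝ, |deriv (fun s => fhat u s) v| ≤ M2) ∧
    (∀ s : ℝ, |a s| ≤ Ma) ∧
    (Δt / Δx) * (M1 + M2) + (2 * Δt / Δx ^ 2) * Ma + b * dlam clam lam * Δt / Δx ^ lam ≤ 1

/-- Standing assumptions on the data `f`, `a` and the numerical flux `f̂`. -/
structure SchemeData (f a : ℝ → ℝ) (fhat : ℝ → ℝ → ℝ) : Prop where
  hfLip : ∃ K : NNReal, LipschitzWith K f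
  hf0 : f 0 = 0
  haLip : ∃ K : NNReal, LipschitzWith K a
  haNonneg : ∀ s : ℝ, 0 ≤ a s
  haBdd : ∃ M : ℝ, ∀ s : ℝ, a s ≤ M
  hfhatLip : ∃ K : NNReal, LipschitzWith K (fun p : ℝ × ℝ => fhat p.1 p.2)
  hconsistent : ∀ u : ℝ, fhat u u = f u
  hmono1 : ∀ v : ℝ, Monotone (fun u => fhat u v)
  hmono2 : ∀ u : ℝ, Antitone (fun v => fhat u v)

/-- `u` has bounded variation on `Q_T = ℝ × (0,T)`: translates in space and time are
`L¹`-Lipschitz. -/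
def BoundedVarQT (T : ℝ) (u : ℝ → ℝ → ℝ) : Prop :=
  ∃ M : ℝ,
    (∀ h : ℝ, ∫ t in Set.Ioo (0 : ℝ) T, ∫ x : ℝ, |u (x + h) t - u x t| ≤ M * |h|) ∧
    (∀ s ∈ Set.Ioo (0 : ℝ) T, ∫ x : ℝ, ∫ t in Set.Ioo (0 : ℝ) (T - s), |u x (t + s) - u x t| ≤ M * s)

/-- `u` is a BV entropy solution on `Q_T = ℝ × (0,T)` of
`u_t + f(u)_x = (a(u)u_x)_x + b L[u]` with initial datum `u₀`. -/
def BVEntropySol (lam clam b T : ℝ) (f a u₀ : ℝ → ℝ) (u : ℝ → ℝ → ℝ) : Prop :=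
  -- u ∈ L¹(Q_T)
  IntegrableOn (fun p : ℝ × ℝ => u p.1 p.2) (Set.univ ×ˢ Set.Ioo (0 : ℝ) T) ∧
  -- u ∈ L^∞(Q_T)
  (∃ M : ℝ, ∀ᵐ p ∂(volume.restrict (Set.univ ×ˢ Set.Ioo (0 : ℝ) T) : Measure (ℝ × ℝ)),
    |u p.1 p.2| ≤ M) ∧
  -- (i) bounded variation on Q_T
  BoundedVarQT T u ∧
  -- (ii) Hölder continuity of A(u)
  (∃ cA : ℝ, ∀ᵐ q ∂((volume.restrict (Set.univ ×ˢ Set.Ioo (0 : ℝ) T)).prod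
      (volume.restrict (Set.univ ×ˢ Set.Ioo (0 : ℝ) T)) : Measure ((ℝ × ℝ) × (ℝ × ℝ))),
    |Aint a (u q.1.1 q.1.2) - Aint a (u q.2.1 q.2.2)| ≤
      cA * (|q.1.1 - q.2.1| + Real.sqrt |q.1.2 - q.2.2|)) ∧
  -- (iii) integrability in space for a.e. time, integrability of L[u], entropy inequalities
  (∀ᵐ t ∂(volume.restrict (Set.Ioo (0 : ℝ) T) : Measure ℝ),
    Integrable (fun x => u x t) ∧ eVariationOn (fun x => u x t) Set.univ ≠ ⊤) ∧
  IntegrableOn (fun p : ℝ × ℝ => fracLap clam lam (fun y => u y p.2) p.1)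
    (Set.univ ×ˢ Set.Ioo (0 : ℝ) T) ∧
  ∀ κ : ℝ, ∀ φ : ℝ → ℝ → ℝ,
    ContDiff ℝ (⊤ : ℕ∞) (fun p : ℝ × ℝ => φ p.1 p.2) →
    HasCompactSupport (fun p : ℝ × ℝ => φ p.1 p.2) →
    (∀ x t : ℝ, 0 ≤ φ x t) →
    (tsupport (fun p : ℝ × ℝ => φ p.1 p.2) ⊆ {p : ℝ × ℝ | p.2 < T}) →
    0 ≤ (∫ p in (Set.univ ×ˢ Set.Ioo (0 : ℝ) T : Set (ℝ × ℝ)),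
          (|u p.1 p.2 - κ| * deriv (fun s => φ p.1 s) p.2 +
           Real.sign (u p.1 p.2 - κ) * (f (u p.1 p.2) - f κ) * deriv (fun y => φ y p.2) p.1 +
           |Aint a (u p.1 p.2) - Aint a κ| * iteratedDeriv 2 (fun y => φ y p.2) p.1 +
           b * Real.sign (u p.1 p.2 - κ) * fracLap clam lam (fun y => u y p.2) p.1 * φ p.1 p.2)) +
      ∫ x : ℝ, |u₀ x - κ| * φ x 0

/-- The space–time bilinear interpolant of the grid values `U^n_i` on the grid of sizes
`Δx, Δt`. -/
noncomputable def interpBL (Δx Δt : ℝ) (U : ℕ → ℤ → ℝ) (x t : ℝ) : ℝ :=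
  let i : ℤ := ⌊x / Δx⌋
  let n : ℕ := (⌊t / Δt⌋).toNat
  let θ : ℝ := x / Δx - (i : ℝ)
  let s : ℝ := t / Δt - (n : ℝ)
  U n i + (U n (i + 1) - U n i) * θ + (U (n + 1) i - U n i) * s +
    (U (n + 1) (i + 1) - U (n + 1) i - U n (i + 1) + U n i) * θ * s

namespace DDG
open MeasureTheory Filter Set
open scoped ENNReal Topology

/-! ### BV basics -/

lemma cells_union {D : ℝ} (hD : 0 < D) :
    (⋃ k : ℤ, Ico ((k:ℝ) * D) (((k:ℝ) + 1) * D)) = univ := by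
  have := iUnion_Ico_zsmul hD
  simpa [zsmul_eq_mul] using this

lemma mem_cell_iff {D : ℝ} (hD : 0 < D) (x : ℝ) (k : ℤ) :
    x ∈ Ico ((k:ℝ) * D) (((k:ℝ) + 1) * D) ↔ ⌊x / D⌋ = k := by
  rw [Int.floor_eq_iff, mem_Ico, le_div_iff₀ hD, div_lt_iff₀ hD]

lemma cells_disj {D : ℝ} (hD : 0 < D) :
    Pairwise (Function.onFun Disjoint (fun k : ℤ => Ico ((k:ℝ) * D) (((k:ℝ) + 1) * D))) := by
  intro i j hij
  rw [Function.onFun, Set.disjoint_left]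
  intro x hx hx'
  rw [mem_cell_iff hD] at hx hx'
  exact hij (hx.symm.trans hx')

lemma lintegral_cells {D : ℝ} (hD : 0 < D) (F : ℝ → ℝ≥0∞) :
    ∫⁻ x, F x = ∑' k : ℤ, ∫⁻ x in Ico ((k:ℝ) * D) (((k:ℝ) + 1) * D), F x := by
  rw [← lintegral_iUnion (fun k => measurableSet_Ico) (cells_disj hD), cells_union hD,
    Measure.restrict_univ]

lemma lintegral_cell_shift (D : ℝ) (F : ℝ → ℝ≥0∞) (k : ℤ) :
    ∫⁻ x in Ico ((k:ℝ) * D) (((k:ℝ) + 1) * D), F x = ∫⁻ x in Ico 0 D, F (x + k * D) := by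
  have hp : MeasurePreserving (fun x : ℝ => x + (k:ℝ) * D) volume volume :=
    measurePreserving_add_right volume _
  have := hp.setLIntegral_comp_preimage_emb
    (MeasurableEquiv.addRight ((k:ℝ) * D)).measurableEmbedding F (Ico ((k:ℝ) * D) (((k:ℝ) + 1) * D))
  rw [← this]
  congr 2
  ext x
  simp only [mem_preimage, mem_Ico]
  constructor <;> rintro ⟨h1, h2⟩ <;> constructor <;> nlinarith

lemma lintegral_floor {D : ℝ} (hD : 0 < D) (F : ℤ → ℝ≥0∞) :
    ∫⁻ x, F ⌊x / D⌋ = ENNReal.ofReal D * ∑' k, F k := by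
  rw [lintegral_cells hD, ← ENNReal.tsum_mul_left]
  congr 1; ext k
  rw [setLIntegral_congr_fun (g := fun _ => F k) measurableSet_Ico
    (fun x hx => by rw [(mem_cell_iff hD x k).1 hx]), setLIntegral_const, Real.volume_Ico]
  rw [mul_comm]; congr 2; ring

lemma tsum_evar_cells {g : ℝ → ℝ} {y : ℤ → ℝ} (hy : Monotone y) :
    ∑' k : ℤ, eVariationOn g (Icc (y k) (y (k + 1))) ≤ eVariationOn g univ := by
  rw [ENNReal.tsum_eq_iSup_sum]
  refine iSup_le fun s => ?_
  obtain ⟨m, hm⟩ : ∃ m : ℕ, ∀ k ∈ s, -(m:ℤ) ≤ k ∧ k < m := by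
    refine ⟨(∑ k ∈ s, k.natAbs) + 1, fun k hk => ?_⟩
    have := Finset.single_le_sum (f := fun k : ℤ => k.natAbs) (fun _ _ => Nat.zero_le _) hk
    omega
  have hI : Monotone (fun i : ℕ => y ((i:ℤ) - m)) := fun i j h => hy (by omega)
  have h1 := eVariationOn.sum' g hI (n := 2 * m)
  calc ∑ k ∈ s, eVariationOn g (Icc (y k) (y (k + 1)))
      ≤ ∑ k ∈ (Finset.range (2*m)).image (fun i : ℕ => (i:ℤ) - m),
          eVariationOn g (Icc (y k) (y (k + 1))) := by
        apply Finset.sum_le_sum_of_subset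
        intro k hk
        have := hm k hk
        simp only [Finset.mem_image, Finset.mem_range]
        exact ⟨(k + m).toNat, by omega, by omega⟩
    _ = ∑ i ∈ Finset.range (2*m), eVariationOn g (Icc (y ((i:ℤ) - m)) (y (((i + 1 : ℕ):ℤ) - m))) := by
        rw [Finset.sum_image (by intro a _ b _ h; simpa using h)]
        refine Finset.sum_congr rfl fun i _ => ?_
        congr 3; push_cast; ring
    _ = _ := h1
    _ ≤ _ := eVariationOn.mono _ (subset_univ _)

lemma tsum_edist_le {g : ℝ → ℝ} {y : ℤ → ℝ} (hy : Monotone y) :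
    ∑' k : ℤ, edist (g (y (k + 1))) (g (y k)) ≤ eVariationOn g univ := by
  refine le_trans (ENNReal.tsum_le_tsum fun k => ?_) (tsum_evar_cells (g := g) hy)
  exact eVariationOn.edist_le _ ⟨hy (by omega), le_rfl⟩ ⟨le_rfl, hy (by omega)⟩

lemma evar_seq_le (V : ℤ → ℝ) :
    eVariationOn V univ ≤ ∑' k : ℤ, edist (V (k + 1)) (V k) := by
  refine iSup_le ?_
  rintro ⟨n, ⟨p, hp, -⟩⟩
  have key : ∀ n : ℕ, ∑ i ∈ Finset.range n, edist (V (p (i + 1))) (V (p i)) ≤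
      ∑ k ∈ Finset.Ico (p 0) (p n), edist (V (k + 1)) (V k) := by
    have one : ∀ (a : ℤ) (m : ℕ), edist (V (a + m)) (V a) ≤
        ∑ k ∈ Finset.Ico a (a + m), edist (V (k + 1)) (V k) := by
      intro a m
      induction m with
      | zero => simp
      | succ m ih =>
        have : Finset.Ico a (a + (m + 1 : ℕ)) = insert (a + m) (Finset.Ico a (a + m)) := by
          ext k; simp only [Finset.mem_Ico, Finset.mem_insert]; omega
        rw [this, Finset.sum_insert (by simp)]
        calc _ ≤ edist (V (a + (m+1:ℕ))) (V (a + m)) + edist (V (a + m)) (V a) := edist_triangle _ _ _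
          _ ≤ _ := by
            gcongr
            apply le_of_eq; congr 2; push_cast; ring
    intro n
    induction n with
    | zero => simp
    | succ n ih =>
      rw [Finset.sum_range_succ]
      have h1 : p 0 ≤ p n := hp (Nat.zero_le _)
      have h2 : p n ≤ p (n+1) := hp (Nat.le_succ _)
      rw [← Finset.Ico_union_Ico_eq_Ico h1 h2, Finset.sum_union (Finset.Ico_disjoint_Ico_consecutive _ _ _)]
      refine add_le_add ih ?_
      have := one (p n) (p (n+1) - p n).toNat
      rwa [show p n + ((p (n+1) - p n).toNat : ℤ) = p (n+1) by omega] at this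
  exact (key n).trans (ENNReal.sum_le_tsum _)

/-- piecewise constant function -/
noncomputable def pc (D : ℝ) (U : ℤ → ℝ) (x : ℝ) : ℝ := U ⌊x / D⌋

lemma evar_pc_le {D : ℝ} (hD : 0 < D) (U : ℤ → ℝ) :
    eVariationOn (pc D U) univ ≤ ∑' k : ℤ, edist (U (k + 1)) (U k) := by
  refine le_trans ?_ (evar_seq_le U)
  have : pc D U = U ∘ (fun x : ℝ => ⌊x / D⌋) := rfl
  rw [this]
  apply eVariationOn.comp_le_of_monotoneOn _ _ _ (mapsTo_univ _ _)
  intro x _ y _ h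
  exact Int.floor_mono (by gcongr)

lemma bv_measurable {g : ℝ → ℝ} (hg : eVariationOn g univ ≠ ⊤) : Measurable g := by
  have h : BoundedVariationOn g univ := hg
  obtain ⟨p, q, hp, hq, rfl⟩ := h.locallyBoundedVariationOn.exists_monotoneOn_sub_monotoneOn
  exact (monotoneOn_univ.1 hp).measurable.sub (monotoneOn_univ.1 hq).measurable

lemma measurable_floor_div (D : ℝ) : Measurable (fun x : ℝ => ⌊x / D⌋) :=
  Int.measurable_floor.comp (measurable_id.div_const D)

lemma pc_measurable (D : ℝ) (U : ℤ → ℝ) : Measurable (pc D U) :=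
  (measurable_of_countable U).comp (measurable_floor_div D)

lemma bv_shift_pos {g : ℝ → ℝ} (hg : eVariationOn g univ ≠ ⊤) {h : ℝ} (hh : 0 < h) :
    ∫⁻ x, ‖g (x + h) - g x‖ₑ ≤ ENNReal.ofReal h * eVariationOn g univ := by
  have hm := bv_measurable hg
  rw [lintegral_cells hh]
  simp_rw [lintegral_cell_shift h]
  rw [← lintegral_tsum]
  · calc _ ≤ ∫⁻ x in Ico 0 h, eVariationOn g univ := by
          apply lintegral_mono
          intro x
          have hy : Monotone (fun k : ℤ => x + (k:ℝ) * h) := by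
            intro a b hab; simp only; gcongr
          refine le_trans (le_of_eq ?_) (tsum_edist_le (g := g) hy)
          refine tsum_congr fun k => ?_
          rw [edist_eq_enorm_sub]; congr 3; push_cast; ring
      _ = _ := by simp [mul_comm]
  · intro k
    exact ((hm.comp (by fun_prop)).sub (hm.comp (by fun_prop))).enorm.aemeasurable

lemma bv_shift {g : ℝ → ℝ} (hg : eVariationOn g univ ≠ ⊤) (h : ℝ) :
    ∫⁻ x, ‖g (x + h) - g x‖ₑ ≤ ENNReal.ofReal |h| * eVariationOn g univ := by
  rcases lt_trichotomy h 0 with h0 | h0 | h0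
  · have h1 := bv_shift_pos hg (h := -h) (by linarith)
    rw [abs_of_neg h0]
    refine le_trans (le_of_eq ?_) h1
    rw [← lintegral_add_right_eq_self (μ := volume) (fun x => ‖g (x + h) - g x‖ₑ) (-h)]
    congr 1; ext x
    rw [← enorm_neg]; congr 1; simp
  · simp [h0]
  · rw [abs_of_pos h0]; exact bv_shift_pos hg h0

lemma bv_ae_continuousAt {g : ℝ → ℝ} (hg : eVariationOn g univ ≠ ⊤) :
    ∀ᵐ x, ContinuousAt g x := by
  have h : BoundedVariationOn g univ := hg
  filter_upwards [h.locallyBoundedVariationOn.ae_differentiableAt] with x hx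
  exact hx.continuousAt

/-- net lemma -/
lemma net_lemma (g₁ g₂ : ℝ → ℝ)
    {e : ℝ} (he : 0 < e) (s : Finset ℤ) :
    ∫⁻ x in ⋃ k ∈ s, Ico ((k:ℝ) * e) (((k:ℝ) + 1) * e), ‖g₁ x - g₂ x‖ₑ ≤
      ENNReal.ofReal e * (eVariationOn g₁ univ + eVariationOn g₂ univ +
        ∑ k ∈ s, ‖g₁ (k * e) - g₂ (k * e)‖ₑ) := by
  rw [lintegral_biUnion_finset (fun i _ j _ hij => cells_disj he hij) (fun k _ => measurableSet_Ico)]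
  have hy : Monotone (fun k : ℤ => (k:ℝ) * e) := by
    intro a b hab; simp only; gcongr
  calc _ ≤ ∑ k ∈ s, ENNReal.ofReal e * (eVariationOn g₁ (Icc ((k:ℝ) * e) (((k+1:ℤ):ℝ) * e)) +
        eVariationOn g₂ (Icc ((k:ℝ) * e) (((k+1:ℤ):ℝ) * e)) + ‖g₁ (k * e) - g₂ (k * e)‖ₑ) := by
        apply Finset.sum_le_sum
        intro k _
        refine le_trans (setLIntegral_mono (g := fun _ => (eVariationOn g₁ (Icc ((k:ℝ) * e) (((k+1:ℤ):ℝ) * e)) +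
        eVariationOn g₂ (Icc ((k:ℝ) * e) (((k+1:ℤ):ℝ) * e)) + ‖g₁ (k * e) - g₂ (k * e)‖ₑ)) measurable_const ?_) ?_
        · intro x hx
          have hx' : x ∈ Icc ((k:ℝ) * e) (((k+1:ℤ):ℝ) * e) := by
            push_cast; exact ⟨hx.1, hx.2.le⟩
          have hk : (k:ℝ) * e ∈ Icc ((k:ℝ) * e) (((k+1:ℤ):ℝ) * e) := ⟨le_rfl, hx'.1.trans hx'.2⟩
          have e1 := eVariationOn.edist_le g₁ hx' hk
          have e2 := eVariationOn.edist_le g₂ hx' hk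
          rw [edist_eq_enorm_sub] at e1 e2
          calc ‖g₁ x - g₂ x‖ₑ = ‖(g₁ x - g₁ (k*e)) + (-(g₂ x - g₂ (k*e))) + (g₁ (k * e) - g₂ (k * e))‖ₑ := by
                congr 1; ring
            _ ≤ ‖(g₁ x - g₁ (k*e)) + (-(g₂ x - g₂ (k*e)))‖ₑ + _ := enorm_add_le _ _
            _ ≤ (‖(g₁ x - g₁ (k*e))‖ₑ + ‖(-(g₂ x - g₂ (k*e)))‖ₑ) + _ := by gcongr; exact enorm_add_le _ _
            _ ≤ _ := by rw [enorm_neg]; gcongr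
        · rw [setLIntegral_const, Real.volume_Ico, mul_comm]
          gcongr
          apply le_of_eq; ring
    _ ≤ _ := by
        rw [← Finset.mul_sum, Finset.sum_add_distrib, Finset.sum_add_distrib]
        gcongr
        · exact (ENNReal.sum_le_tsum _).trans (tsum_evar_cells (g := g₁) hy)
        · exact (ENNReal.sum_le_tsum _).trans (tsum_evar_cells (g := g₂) hy)

end DDG

namespace DDG
open MeasureTheory Filter Set
open scoped ENNReal Topology

/-! ### The fractional Laplacian -/

noncomputable def Kr (l z : ℝ) : ℝ := (|z| ^ (1 + l))⁻¹

lemma Kr_nonneg (l z : ℝ) : 0 ≤ Kr l z := by unfold Kr; positivity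

lemma Kr_measurable (l : ℝ) : Measurable (Kr l) := by unfold Kr; fun_prop

lemma fl_eq (c l : ℝ) (g : ℝ → ℝ) (x : ℝ) :
    fracLap c l g x = c * ∫ z, (g (x + z) - g x) * Kr l z := by
  unfold fracLap Kr
  rw [restrict_compl_singleton]
  simp only [div_eq_mul_inv]

/-- `∫ min(|z|,1) K(z) dz`. -/
noncomputable def HK (l : ℝ) : ℝ≥0∞ :=
  ∫⁻ z, ENNReal.ofReal (min |z| 1) * ENNReal.ofReal (Kr l z)

lemma lintegral_even {F : ℝ → ℝ≥0∞} (hF : ∀ z, F (-z) = F z) :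
    ∫⁻ z, F z = 2 * ∫⁻ z in Ioi 0, F z := by
  have h1 : ∫⁻ z in Iio 0, F z = ∫⁻ z in Ioi 0, F z := by
    have hp : MeasurePreserving (fun x : ℝ => -x) volume volume := Measure.measurePreserving_neg _
    have := hp.setLIntegral_comp_preimage_emb (MeasurableEquiv.neg ℝ).measurableEmbedding F (Iio 0)
    rw [← this]
    simp [hF]
  rw [← lintegral_add_compl F (measurableSet_Ioi (a := (0:ℝ))), compl_Ioi,
    setLIntegral_congr (s := Iic 0) (t := Iio 0) Iio_ae_eq_Iic.symm, h1, two_mul]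

lemma HK_lt_top {l : ℝ} (hl : l ∈ Ioo (0:ℝ) 1) : HK l < ⊤ := by
  unfold HK
  rw [lintegral_even (by intro z; simp [Kr])]
  refine ENNReal.mul_lt_top (by simp) ?_
  rw [← Ioc_union_Ioi_eq_Ioi (zero_le_one (α := ℝ))]
  refine lt_of_le_of_lt (lintegral_union_le _ _ _) (ENNReal.add_lt_top.2 ⟨?_, ?_⟩)
  · have h := (intervalIntegral.intervalIntegrable_rpow' (r := -l) (by linarith [hl.2]) (a := 0) (b := 1))
    rw [intervalIntegrable_iff_integrableOn_Ioc_of_le zero_le_one] at h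
    refine lt_of_le_of_lt ?_ h.2
    apply setLIntegral_mono' measurableSet_Ioc
    intro z hz
    have hz0 : 0 < z := hz.1
    rw [← ENNReal.ofReal_mul (by positivity), Real.enorm_eq_ofReal (by positivity)]
    apply ENNReal.ofReal_le_ofReal
    beta_reduce
    rw [Kr, abs_of_pos hz.1, min_eq_left hz.2, Real.rpow_neg hz.1.le, Real.rpow_add hz.1, Real.rpow_one]
    field_simp; rfl
  · have h := integrableOn_Ioi_rpow_of_lt (a := -1 - l) (by linarith [hl.1]) zero_lt_one
    refine lt_of_le_of_lt ?_ h.2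
    apply setLIntegral_mono' measurableSet_Ioi
    intro z hz
    have hz0 : 0 < z := lt_trans zero_lt_one hz
    rw [← ENNReal.ofReal_mul (by positivity), Real.enorm_eq_ofReal (by positivity)]
    apply ENNReal.ofReal_le_ofReal
    rw [Kr, abs_of_pos hz0, min_eq_right (le_of_lt hz), one_mul, ← Real.rpow_neg hz0.le]
    apply le_of_eq; congr 1; ring

/-- functions with `L¹` translation control. -/
structure Nice (g : ℝ → ℝ) (C : ℝ≥0∞) : Prop where
  meas : Measurable g
  fin : C ≠ ⊤
  l1 : ∫⁻ x, ‖g x‖ₑ ≤ C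
  shift : ∀ z, ∫⁻ x, ‖g (x + z) - g x‖ₑ ≤ C * ENNReal.ofReal (min |z| 1)

lemma nice_of_bv {g : ℝ → ℝ} {C : ℝ≥0∞} (hC : C ≠ ⊤) (h1 : ∫⁻ x, ‖g x‖ₑ ≤ C)
    (h2 : eVariationOn g univ ≤ C) : Nice g (2 * C) := by
  have hv : eVariationOn g univ ≠ ⊤ := ne_top_of_le_ne_top hC h2
  have hm := bv_measurable hv
  refine ⟨hm, ENNReal.mul_ne_top (by simp) hC, h1.trans ?_, fun z => ?_⟩
  · rw [two_mul]; exact le_self_add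
  · rcases le_total |z| 1 with hz | hz
    · rw [min_eq_left hz]
      refine (bv_shift hv z).trans ?_
      rw [mul_comm]
      gcongr
      exact h2.trans (by rw [two_mul]; exact le_self_add)
    · rw [min_eq_right hz, ENNReal.ofReal_one, mul_one]
      calc _ ≤ ∫⁻ x, (‖g (x + z)‖ₑ + ‖g x‖ₑ) := lintegral_mono fun x => enorm_sub_le
        _ = (∫⁻ x, ‖g (x + z)‖ₑ) + ∫⁻ x, ‖g x‖ₑ :=
            lintegral_add_right _ hm.enorm
        _ = (∫⁻ x, ‖g x‖ₑ) + ∫⁻ x, ‖g x‖ₑ := by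
            rw [lintegral_add_right_eq_self (μ := volume) (fun x => ‖g x‖ₑ) z]
        _ ≤ _ := by rw [two_mul]; gcongr

lemma Nice.sub {g h : ℝ → ℝ} {C D : ℝ≥0∞} (hg : Nice g C) (hh : Nice h D) :
    Nice (fun x => g x - h x) (C + D) := by
  refine ⟨hg.meas.sub hh.meas, ENNReal.add_ne_top.2 ⟨hg.fin, hh.fin⟩, ?_, fun z => ?_⟩
  · calc _ ≤ ∫⁻ x, (‖g x‖ₑ + ‖h x‖ₑ) := lintegral_mono fun x => enorm_sub_le
      _ = _ := lintegral_add_right _ hh.meas.enorm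
      _ ≤ _ := add_le_add hg.l1 hh.l1
  · have hm : Measurable fun x => h (x + z) - h x := (hh.meas.comp (by fun_prop)).sub hh.meas
    calc _ ≤ ∫⁻ x, (‖g (x+z) - g x‖ₑ + ‖h (x + z) - h x‖ₑ) := by
          apply lintegral_mono; intro x
          simp only
          rw [show g (x+z) - h (x+z) - (g x - h x) = (g (x+z) - g x) - (h (x+z) - h x) by ring]
          exact enorm_sub_le
      _ = _ := lintegral_add_right _ hm.enorm
      _ ≤ _ := by rw [add_mul]; exact add_le_add (hg.shift z) (hh.shift z)

lemma meas_diffK {g : ℝ → ℝ} (hg : Measurable g) (l : ℝ) :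
    Measurable (fun p : ℝ × ℝ => (g (p.1 + p.2) - g p.1) * Kr l p.2) :=
  ((hg.comp (by fun_prop)).sub (hg.comp (by fun_prop))).mul ((Kr_measurable l).comp measurable_snd)

lemma Nice.dbl {g : ℝ → ℝ} {C : ℝ≥0∞} (hg : Nice g C) (l : ℝ) :
    ∫⁻ x, ∫⁻ z, ‖(g (x + z) - g x) * Kr l z‖ₑ ≤ C * HK l := by
  rw [lintegral_lintegral_swap ((meas_diffK hg.meas l).enorm.aemeasurable)]
  unfold HK
  rw [← lintegral_const_mul' _ _ hg.fin]
  apply lintegral_mono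
  intro z
  simp only [enorm_mul]
  have hm : Measurable fun x => ‖g (x + z) - g x‖ₑ := ((hg.meas.comp (by fun_prop)).sub hg.meas).enorm
  rw [lintegral_mul_const _ hm,
    Real.enorm_eq_ofReal (Kr_nonneg _ _), ← mul_assoc]
  gcongr
  exact hg.shift z

lemma Nice.ae_integrable {g : ℝ → ℝ} {C : ℝ≥0∞} (hg : Nice g C) {l : ℝ} (hl : l ∈ Ioo (0:ℝ) 1) :
    ∀ᵐ x, Integrable (fun z => (g (x + z) - g x) * Kr l z) := by
  have h1 : ∫⁻ x, ∫⁻ z, ‖(g (x + z) - g x) * Kr l z‖ₑ ≠ ⊤ :=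
    ne_top_of_le_ne_top (ENNReal.mul_ne_top hg.fin (HK_lt_top hl).ne) (hg.dbl l)
  have h2 := ae_lt_top (Measurable.lintegral_prod_right' (ν := volume)
    (meas_diffK hg.meas l).enorm) h1
  filter_upwards [h2] with x hx
  exact ⟨((meas_diffK hg.meas l).comp (measurable_const.prodMk measurable_id)).aestronglyMeasurable, hx⟩

lemma fl_measurable {g : ℝ → ℝ} (hg : Measurable g) (c l : ℝ) : Measurable (fracLap c l g) := by
  have : fracLap c l g = fun x => c * ∫ z, (g (x + z) - g x) * Kr l z := funext fun x => fl_eq c l g x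
  rw [this]
  exact ((meas_diffK hg l).stronglyMeasurable.integral_prod_right' (ν := volume)).measurable.const_mul c

lemma fl_measurable2 {u : ℝ → ℝ → ℝ} (hu : Measurable (fun p : ℝ × ℝ => u p.1 p.2)) (c l : ℝ) :
    Measurable (fun p : ℝ × ℝ => fracLap c l (fun y => u y p.2) p.1) := by
  simp_rw [fl_eq]
  have hm : Measurable (fun q : (ℝ × ℝ) × ℝ => (u (q.1.1 + q.2) q.1.2 - u q.1.1 q.1.2) * Kr l q.2) := by
    refine Measurable.mul (Measurable.sub ?_ ?_) ((Kr_measurable l).comp measurable_snd)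
    · exact hu.comp (f := fun q : (ℝ × ℝ) × ℝ => (q.1.1 + q.2, q.1.2)) (by fun_prop)
    · exact hu.comp (f := fun q : (ℝ × ℝ) × ℝ => (q.1.1, q.1.2)) (by fun_prop)
  exact (hm.stronglyMeasurable.integral_prod_right' (ν := volume)).measurable.const_mul c

lemma fl_enorm_le {c : ℝ} (g : ℝ → ℝ) (l x : ℝ) :
    ‖fracLap c l g x‖ₑ ≤ ‖c‖ₑ * ∫⁻ z, ‖(g (x + z) - g x) * Kr l z‖ₑ := by
  rw [fl_eq, enorm_mul]
  gcongr
  exact enorm_integral_le_lintegral_enorm _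

lemma Nice.fl_l1 {g : ℝ → ℝ} {C : ℝ≥0∞} (hg : Nice g C) (c l : ℝ) :
    ∫⁻ x, ‖fracLap c l g x‖ₑ ≤ ‖c‖ₑ * (C * HK l) := by
  calc _ ≤ ∫⁻ x, ‖c‖ₑ * ∫⁻ z, ‖(g (x + z) - g x) * Kr l z‖ₑ :=
        lintegral_mono fun x => fl_enorm_le g l x
    _ = ‖c‖ₑ * ∫⁻ x, ∫⁻ z, ‖(g (x + z) - g x) * Kr l z‖ₑ := lintegral_const_mul' _ _ (by simp)
    _ ≤ _ := by gcongr; exact hg.dbl l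

lemma Nice.fl_integrable {g : ℝ → ℝ} {C : ℝ≥0∞} (hg : Nice g C) (c : ℝ) {l : ℝ}
    (hl : l ∈ Ioo (0:ℝ) 1) : Integrable (fracLap c l g) := by
  refine ⟨(fl_measurable hg.meas c l).aestronglyMeasurable, (hg.fl_l1 c l).trans_lt ?_⟩
  exact ENNReal.mul_lt_top (by simp) (ENNReal.mul_lt_top hg.fin.lt_top (HK_lt_top hl))

lemma Nice.fl_sub {g h : ℝ → ℝ} {C D : ℝ≥0∞} (hg : Nice g C) (hh : Nice h D) (c : ℝ) {l : ℝ}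
    (hl : l ∈ Ioo (0:ℝ) 1) :
    ∀ᵐ x, fracLap c l (fun y => g y - h y) x = fracLap c l g x - fracLap c l h x := by
  filter_upwards [hg.ae_integrable hl, hh.ae_integrable hl] with x h1 h2
  rw [fl_eq, fl_eq, fl_eq, ← mul_sub, ← integral_sub h1 h2]
  congr 2; ext z; ring

/-- the integral of `L[g]` vanishes. -/
lemma Nice.fl_integral_zero {g : ℝ → ℝ} {C : ℝ≥0∞} (hg : Nice g C) (c : ℝ) {l : ℝ}
    (hl : l ∈ Ioo (0:ℝ) 1) : ∫ x, fracLap c l g x = 0 := by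
  have hIntg : Integrable (fun p : ℝ × ℝ => (g (p.1 + p.2) - g p.1) * Kr l p.2)
      (volume.prod volume) := by
    refine ⟨(meas_diffK hg.meas l).aestronglyMeasurable, ?_⟩
    rw [hasFiniteIntegral_def, lintegral_prod _ (meas_diffK hg.meas l).enorm.aemeasurable]
    exact (hg.dbl l).trans_lt (ENNReal.mul_lt_top hg.fin.lt_top (HK_lt_top hl))
  simp_rw [fl_eq]
  rw [integral_const_mul, integral_integral_swap hIntg]
  have hgi : Integrable g := ⟨hg.meas.aestronglyMeasurable, hg.l1.trans_lt hg.fin.lt_top⟩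
  have : ∀ z, ∫ x, (g (x + z) - g x) * Kr l z = 0 := by
    intro z
    rw [integral_mul_const, integral_sub (hgi.comp_add_right z) hgi,
      integral_add_right_eq_self (μ := volume) g z, sub_self, zero_mul]
  simp [this]

lemma fl_shift (c l : ℝ) (g : ℝ → ℝ) (h x : ℝ) :
    fracLap c l (fun y => g (y + h)) x = fracLap c l g (x + h) := by
  rw [fl_eq, fl_eq]
  congr 2; ext z; ring_nf

lemma fl_congr_ae (c l : ℝ) {g h : ℝ → ℝ} (hgh : g =ᵐ[volume] h) {x : ℝ} (hx : g x = h x) :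
    fracLap c l g x = fracLap c l h x := by
  rw [fl_eq, fl_eq]
  congr 1
  apply integral_congr_ae
  have : (fun z => g (x + z)) =ᵐ[volume] fun z => h (x + z) :=
    (measurePreserving_add_left volume x).quasiMeasurePreserving.ae_eq_comp hgh
  filter_upwards [this] with z hz
  have h2 : g (x + z) = h (x + z) := hz
  rw [hx, h2]

end DDG

namespace DDG
open MeasureTheory Filter Set
open scoped ENNReal Topology

/-! ### The weights -/

abbrev cell (D : ℝ) (i : ℤ) : Set ℝ := Ico ((i:ℝ) * D) (((i:ℝ) + 1) * D)

noncomputable def nC (D : ℝ) (V : ℤ → ℝ) : ℝ≥0∞ := 2 * ((ENNReal.ofReal D + 2) * ∑' k, ‖V k‖ₑ)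

lemma summable_enorm {ι : Type*} {V : ι → ℝ} (hV : Summable V) : ∑' k, ‖V k‖ₑ ≠ ⊤ := by
  have := hV.abs
  have h2 : ∀ k, ‖V k‖ₑ = ENNReal.ofReal |V k| := fun k => by
    rw [← Real.enorm_abs, Real.enorm_eq_ofReal (abs_nonneg _)]
  simp_rw [h2]
  rw [← ENNReal.ofReal_tsum_of_nonneg (fun _ => abs_nonneg _) this]
  simp

lemma enorm_summable {ι : Type*} {V : ι → ℝ} (hV : ∑' k, ‖V k‖ₑ ≠ ⊤) : Summable V := by
  have h2 : ∀ k, ‖V k‖ₑ = ENNReal.ofReal |V k| := fun k => by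
    rw [← Real.enorm_abs, Real.enorm_eq_ofReal (abs_nonneg _)]
  have := ENNReal.summable_toReal hV
  refine Summable.of_norm_bounded (this) fun k => ?_
  rw [h2, ENNReal.toReal_ofReal (abs_nonneg _)]; rfl

lemma tsum_shift_int (F : ℤ → ℝ≥0∞) (m : ℤ) : ∑' k, F (k + m) = ∑' k, F k :=
  (Equiv.addRight m).tsum_eq F

lemma lintegral_pc {D : ℝ} (hD : 0 < D) (V : ℤ → ℝ) :
    ∫⁻ x, ‖pc D V x‖ₑ = ENNReal.ofReal D * ∑' k, ‖V k‖ₑ :=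
  lintegral_floor hD (fun k => ‖V k‖ₑ)

lemma tsum_edist_le_two (V : ℤ → ℝ) :
    ∑' k : ℤ, edist (V (k + 1)) (V k) ≤ 2 * ∑' k, ‖V k‖ₑ := by
  calc _ ≤ ∑' k : ℤ, (‖V (k+1)‖ₑ + ‖V k‖ₑ) := ENNReal.tsum_le_tsum fun k => by
        rw [edist_eq_enorm_sub]; exact enorm_sub_le
    _ = _ := by rw [ENNReal.tsum_add, tsum_shift_int (fun k => ‖V k‖ₑ) 1, two_mul]

lemma pc_nice {D : ℝ} (hD : 0 < D) {V : ℤ → ℝ} (hV : Summable V) : Nice (pc D V) (nC D V) := by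
  apply nice_of_bv
  · exact ENNReal.mul_ne_top (by simp) (summable_enorm hV)
  · rw [lintegral_pc hD]; gcongr; exact le_self_add
  · refine (evar_pc_le hD V).trans ((tsum_edist_le_two V).trans ?_)
    gcongr; exact le_add_self

noncomputable def NL (c l D : ℝ) (V : ℤ → ℝ) (i : ℤ) : ℝ :=
  ∫ x in cell D i, fracLap c l (pc D V) x

lemma NL_sub {c l D : ℝ} (hl : l ∈ Ioo (0:ℝ) 1) (hD : 0 < D) {V W : ℤ → ℝ} (hV : Summable V)
    (hW : Summable W) (i : ℤ) :
    NL c l D (fun k => V k - W k) i = NL c l D V i - NL c l D W i := by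
  unfold NL
  rw [← integral_sub ((pc_nice hD hV).fl_integrable c hl).integrableOn
    ((pc_nice hD hW).fl_integrable c hl).integrableOn]
  apply integral_congr_ae
  apply ae_restrict_of_ae
  filter_upwards [(pc_nice hD hV).fl_sub (pc_nice hD hW) c hl] with x hx
  rw [← hx]; rfl

lemma NL_hasSum {c l D : ℝ} (hl : l ∈ Ioo (0:ℝ) 1) (hD : 0 < D) {V : ℤ → ℝ} (hV : Summable V) :
    HasSum (NL c l D V) 0 := by
  have := hasSum_integral_iUnion (μ := volume) (s := cell D) (f := fracLap c l (pc D V))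
    (fun i => measurableSet_Ico) (cells_disj hD)
    ((pc_nice hD hV).fl_integrable c hl).integrableOn
  rw [cells_union hD, setIntegral_univ, (pc_nice hD hV).fl_integral_zero c hl] at this
  exact this

lemma tsum_NL_le {c l D : ℝ} (hD : 0 < D) {V : ℤ → ℝ} :
    ∑' i, ‖NL c l D V i‖ₑ ≤ ∫⁻ x, ‖fracLap c l (pc D V) x‖ₑ := by
  rw [lintegral_cells hD]
  exact ENNReal.tsum_le_tsum fun i => enorm_integral_le_lintegral_enorm _

lemma pc_shift {D : ℝ} (hD : 0 < D) (V : ℤ → ℝ) (m : ℤ) :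
    pc D (fun k => V (k + m)) = fun x => pc D V (x + m * D) := by
  ext x
  unfold pc
  rw [add_div, mul_div_assoc, div_self hD.ne', mul_one, Int.floor_add_intCast]

lemma setIntegral_cell_shift (D : ℝ) (F : ℝ → ℝ) (k m : ℤ) :
    ∫ x in cell D k, F (x + m * D) = ∫ x in cell D (k + m), F x := by
  have hp : MeasurePreserving (fun x : ℝ => x + (m:ℝ) * D) volume volume :=
    measurePreserving_add_right volume _
  have := hp.setIntegral_preimage_emb
    (MeasurableEquiv.addRight ((m:ℝ) * D)).measurableEmbedding F (cell D (k + m))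
  rw [← this]
  congr 2
  ext x; simp only [cell, mem_preimage, mem_Ico]
  push_cast
  constructor <;> rintro ⟨h1, h2⟩ <;> constructor <;> linarith

lemma NL_shift {c l D : ℝ} (hD : 0 < D) (V : ℤ → ℝ) (m i : ℤ) :
    NL c l D (fun k => V (k + m)) i = NL c l D V (i + m) := by
  unfold NL
  rw [pc_shift hD, ← setIntegral_cell_shift]
  simp_rw [fl_shift c l (pc D V)]

/-- unit cell function -/
noncomputable def ej (D : ℝ) (j : ℤ) : ℝ → ℝ := pc D (Pi.single j 1)

lemma ej_eq (D : ℝ) (j : ℤ) (x : ℝ) : ej D j x = if j = ⌊x / D⌋ then 1 else 0 := by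
  unfold ej pc
  rw [Pi.single_apply]; simp [eq_comm]

lemma summable_single (j : ℤ) : Summable (Pi.single j (1:ℝ) : ℤ → ℝ) :=
  (hasSum_pi_single j (1:ℝ)).summable

lemma nC_single (D : ℝ) (j : ℤ) : nC D (Pi.single j 1) = 2 * (ENNReal.ofReal D + 2) := by
  unfold nC
  rw [tsum_eq_single j (by intro k hk; simp [hk])]
  simp

lemma cellInd_ae (D : ℝ) (hD : 0 < D) (j : ℤ) : ∀ᵐ x, cellInd D j x = ej D j x := by
  have : ∀ᵐ x : ℝ, x ≠ (j:ℝ) * D := by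
    simp [ae_iff]
  filter_upwards [this] with x hx
  rw [ej_eq]
  unfold cellInd
  by_cases h : j = ⌊x / D⌋
  · rw [if_pos h]
    have := (mem_cell_iff hD x j).2 h.symm
    rw [Set.indicator_of_mem]; rfl
    exact ⟨lt_of_le_of_ne this.1 (Ne.symm hx), this.2⟩
  · rw [if_neg h, Set.indicator_of_notMem]
    intro h2
    exact h ((mem_cell_iff hD x j).1 ⟨h2.1.le, h2.2⟩).symm

lemma Gw_eq {c l D : ℝ} (hD : 0 < D) (i j : ℤ) : Gw c l D i j = NL c l D (Pi.single j 1) i := by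
  unfold Gw NL
  rw [← integral_Ico_eq_integral_Ioo]
  apply integral_congr_ae
  apply ae_restrict_of_ae
  filter_upwards [cellInd_ae D hD j] with x hx
  exact fl_congr_ae c l (cellInd_ae D hD j) hx

lemma Gw_hasSum {c l D : ℝ} (hl : l ∈ Ioo (0:ℝ) 1) (hD : 0 < D) {V : ℤ → ℝ} (hV : Summable V)
    (i : ℤ) : HasSum (fun j => Gw c l D i j * V j) (NL c l D V i) := by
  set F : ℤ → ℝ × ℝ → ℝ := fun j p => V j * ((ej D j (p.1 + p.2) - ej D j p.1) * Kr l p.2) with hF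
  set μ : Measure (ℝ × ℝ) := (volume.restrict (cell D i)).prod volume
  have hmj : ∀ j, Measurable (fun p : ℝ × ℝ => (ej D j (p.1 + p.2) - ej D j p.1) * Kr l p.2) :=
    fun j => meas_diffK (pc_measurable D _) l
  have hle : ∀ j, ∫⁻ p, ‖(ej D j (p.1 + p.2) - ej D j p.1) * Kr l p.2‖ₑ ∂μ ≤
      2 * (ENNReal.ofReal D + 2) * HK l := by
    intro j
    rw [lintegral_prod _ (hmj j).enorm.aemeasurable]
    refine (setLIntegral_le_lintegral _ _).trans ?_
    rw [← nC_single D j]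
    exact (pc_nice hD (summable_single j)).dbl l
  have hfin : 2 * (ENNReal.ofReal D + 2) * HK l ≠ ⊤ :=
    ENNReal.mul_ne_top (ENNReal.mul_ne_top (by simp) (by simp)) (HK_lt_top hl).ne
  have hIntg0 : ∀ j, Integrable (fun p : ℝ × ℝ => (ej D j (p.1 + p.2) - ej D j p.1) * Kr l p.2) μ :=
    fun j => ⟨(hmj j).aestronglyMeasurable, (hle j).trans_lt hfin.lt_top⟩
  have hIntg : ∀ j, Integrable (F j) μ := fun j => (hIntg0 j).const_mul _
  have hsum : Summable fun j => ∫ a, ‖F j a‖ ∂μ := by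
    refine Summable.of_nonneg_of_le (fun j => integral_nonneg fun _ => norm_nonneg _) (fun j => ?_)
      (hV.abs.mul_right (2 * (ENNReal.ofReal D + 2) * HK l).toReal)
    simp only [hF, norm_mul]
    rw [integral_const_mul]
    refine mul_le_mul_of_nonneg_left ?_ (abs_nonneg _)
    simp_rw [← norm_mul]
    rw [integral_norm_eq_lintegral_enorm (hmj j).aestronglyMeasurable]
    exact ENNReal.toReal_mono hfin (hle j)
  have key := hasSum_integral_of_summable_integral_norm hIntg hsum
  have h1 : ∀ p : ℝ × ℝ, ∑' j, F j p = (pc D V (p.1 + p.2) - pc D V p.1) * Kr l p.2 := by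
    intro p
    have hs : ∀ x, HasSum (fun j => V j * ej D j x) (pc D V x) := by
      intro x
      have := hasSum_single (f := fun j => V j * ej D j x) ⌊x / D⌋
        (fun j hj => by rw [ej_eq, if_neg hj, mul_zero])
      rw [ej_eq, if_pos rfl, mul_one] at this
      exact this
    have := ((hs (p.1 + p.2)).sub (hs p.1)).mul_right (Kr l p.2)
    rw [← this.tsum_eq]
    congr 1; ext j; simp only [hF]; ring
  simp_rw [h1] at key
  have hpcint : Integrable (fun p : ℝ × ℝ => (pc D V (p.1 + p.2) - pc D V p.1) * Kr l p.2) μ := by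
    have hm := meas_diffK (pc_measurable D V) l
    refine ⟨hm.aestronglyMeasurable, ?_⟩
    rw [hasFiniteIntegral_def, lintegral_prod _ hm.enorm.aemeasurable]
    refine ((setLIntegral_le_lintegral _ _).trans ((pc_nice hD hV).dbl l)).trans_lt ?_
    exact ENNReal.mul_lt_top (pc_nice hD hV).fin.lt_top (HK_lt_top hl)
  have key2 := key.mul_left c
  have e1 : (fun j => Gw c l D i j * V j) = fun j => c * ∫ a, F j a ∂μ := by
    funext j
    rw [Gw_eq hD, NL]
    simp_rw [fl_eq]
    simp only [hF]
    rw [integral_const_mul, integral_const_mul, integral_prod _ (hIntg0 j)]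
    unfold ej
    ring
  have e2 : NL c l D V i = c * ∫ a : ℝ × ℝ, (pc D V (a.1 + a.2) - pc D V a.1) * Kr l a.2 ∂μ := by
    rw [NL]
    simp_rw [fl_eq]
    rw [integral_const_mul, integral_prod _ hpcint]
  rw [e1, e2]
  exact key2

lemma dlam_eq {c l : ℝ} (hl : l ∈ Ioo (0:ℝ) 1) : dlam c l = c * (HK l).toReal := by
  unfold dlam
  congr 1
  have m1 : MeasurableSet {z : ℝ | |z| < 1} := measurableSet_lt (by fun_prop) (by fun_prop)
  have m2 : MeasurableSet {z : ℝ | 1 < |z|} := measurableSet_lt (by fun_prop) (by fun_prop)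
  have h0 : HK l = (∫⁻ z in {z : ℝ | |z| < 1}, ENNReal.ofReal (|z| ^ (-l))) +
      ∫⁻ z in {z : ℝ | 1 < |z|}, ENNReal.ofReal (|z| ^ (-1 - l)) := by
    unfold HK
    rw [← lintegral_add_compl _ m1]
    congr 1
    · apply setLIntegral_congr_fun_ae m1
      have : ∀ᵐ x : ℝ, x ≠ 0 := by simp [ae_iff]
      filter_upwards [this] with z hz hz1
      have hz0 : 0 < |z| := abs_pos.2 hz
      rw [← ENNReal.ofReal_mul (by positivity), Kr, min_eq_left (le_of_lt hz1),
        Real.rpow_neg hz0.le, Real.rpow_add hz0, Real.rpow_one]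
      congr 1; field_simp
    · have hc : ∀ᵐ z : ℝ, z ∈ {z : ℝ | |z| < 1}ᶜ ↔ z ∈ {z : ℝ | 1 < |z|} := by
        have : ∀ᵐ x : ℝ, x ≠ 1 ∧ x ≠ -1 := by
          have h1 : ∀ᵐ x : ℝ, x ≠ 1 := by simp [ae_iff]
          have h2 : ∀ᵐ x : ℝ, x ≠ -1 := by simp [ae_iff]
          exact h1.and h2
        filter_upwards [this] with z hz
        simp only [mem_compl_iff, mem_setOf_eq, not_lt]
        refine ⟨fun h => lt_of_le_of_ne h ?_, le_of_lt⟩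
        intro h1
        rcases (abs_eq (zero_le_one)).1 h1.symm with h | h
        exacts [hz.1 h, hz.2 h]
      rw [setLIntegral_congr (eventuallyEq_set.2 hc)]
      apply setLIntegral_congr_fun m2
      intro z hz
      have hz0 : 0 < |z| := lt_trans zero_lt_one hz
      beta_reduce
      rw [← ENNReal.ofReal_mul (by positivity), Kr, min_eq_right (le_of_lt hz), one_mul,
        ← Real.rpow_neg hz0.le]
      congr 2; ring
  have hf : HK l ≠ ⊤ := (HK_lt_top hl).ne
  rw [h0] at hf
  rw [h0, ENNReal.toReal_add (ENNReal.add_ne_top.1 hf).1 (ENNReal.add_ne_top.1 hf).2]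
  congr 1
  · exact integral_eq_lintegral_of_nonneg_ae (ae_of_all _ fun z => by positivity)
      (Measurable.aestronglyMeasurable (by fun_prop))
  · exact integral_eq_lintegral_of_nonneg_ae (ae_of_all _ fun z => by positivity)
      (Measurable.aestronglyMeasurable (by fun_prop))

lemma HK_scale {l D : ℝ} (hD : 0 < D) :
    ∫⁻ z, ENNReal.ofReal (min |z| D) * ENNReal.ofReal (Kr l z) =
      ENNReal.ofReal (D ^ (1 - l)) * HK l := by
  have h := Real.smul_map_volume_mul_left hD.ne'
  have hm : Measurable fun z => ENNReal.ofReal (min |z| D) * ENNReal.ofReal (Kr l z) := by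
    have := Kr_measurable l
    fun_prop
  conv_lhs => rw [← h]
  rw [lintegral_smul_measure, lintegral_map hm (by fun_prop), abs_of_pos hD, HK, smul_eq_mul,
    ← lintegral_const_mul' _ _ ENNReal.ofReal_ne_top, ← lintegral_const_mul' _ _ ENNReal.ofReal_ne_top]
  congr 1; ext z
  have hK := Kr_nonneg l z
  rw [← ENNReal.ofReal_mul (by positivity), ← ENNReal.ofReal_mul (by positivity),
    ← ENNReal.ofReal_mul (by positivity), ← ENNReal.ofReal_mul (by positivity)]
  congr 1
  have h1 : min |D * z| D = D * min |z| 1 := by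
    rw [abs_mul, abs_of_pos hD, mul_min_of_nonneg _ _ hD.le, mul_one]
  rw [h1, Kr, Kr, abs_mul, abs_of_pos hD, Real.mul_rpow hD.le (abs_nonneg _), mul_inv,
    show D ^ (1 - l) = D * D * (D ^ (1 + l))⁻¹ by
      rw [← Real.rpow_neg hD.le]
      conv_rhs => rw [← Real.rpow_one D]
      rw [← Real.rpow_mul hD.le, ← Real.rpow_add hD, ← Real.rpow_add hD]; congr 1; ring]
  ring

lemma Gii_ge {c l D : ℝ} (hc : 0 ≤ c) (hl : l ∈ Ioo (0:ℝ) 1) (hD : 0 < D) (i : ℤ) :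
    -(dlam c l * D ^ (1 - l)) ≤ NL c l D (Pi.single i 1) i := by
  have hm := meas_diffK (pc_measurable D (Pi.single i 1)) l
  have h1 : ‖NL c l D (Pi.single i 1) i‖ₑ ≤ ENNReal.ofReal (dlam c l * D ^ (1 - l)) := by
    calc _ ≤ ∫⁻ x in cell D i, ‖fracLap c l (ej D i) x‖ₑ := enorm_integral_le_lintegral_enorm _
      _ ≤ ∫⁻ x in cell D i, ‖c‖ₑ * ∫⁻ z, ‖(ej D i (x + z) - ej D i x) * Kr l z‖ₑ :=
        lintegral_mono fun x => fl_enorm_le _ l x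
      _ = ‖c‖ₑ * ∫⁻ x in cell D i, ∫⁻ z, ‖(ej D i (x + z) - ej D i x) * Kr l z‖ₑ :=
        lintegral_const_mul' _ _ (by simp)
      _ = ‖c‖ₑ * ∫⁻ z, ∫⁻ x in cell D i, ‖(ej D i (x + z) - ej D i x) * Kr l z‖ₑ := by
        rw [lintegral_lintegral_swap]; exact hm.enorm.aemeasurable
      _ ≤ ‖c‖ₑ * ∫⁻ z, ENNReal.ofReal (min |z| D) * ENNReal.ofReal (Kr l z) := by
        gcongr with z
        simp only [enorm_mul]
        have hm : Measurable fun x => ‖ej D i (x + z) - ej D i x‖ₑ :=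
          (((pc_measurable D _).comp (by fun_prop : Measurable fun x : ℝ => x + z)).sub
            (pc_measurable D _)).enorm
        rw [lintegral_mul_const _ hm, Real.enorm_eq_ofReal (Kr_nonneg _ _)]
        gcongr
        have hx1 : ∀ x ∈ cell D i, ‖ej D i (x + z) - ej D i x‖ₑ =
            ((cell D i)ᶜ.indicator 1 (x + z)) := by
          intro x hx
          rw [ej_eq D i x, if_pos ((mem_cell_iff hD x i).1 hx).symm, ej_eq]
          by_cases hz : x + z ∈ cell D i
          · rw [if_pos ((mem_cell_iff hD _ i).1 hz).symm]; simp [hz]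
          · rw [if_neg (fun h => hz ((mem_cell_iff hD _ i).2 h.symm))]; simp [hz]
        rw [setLIntegral_congr_fun measurableSet_Ico hx1, ENNReal.ofReal_min]
        apply le_min
        · have : ∀ x ∈ cell D i, (cell D i)ᶜ.indicator (1 : ℝ → ℝ≥0∞) (x + z) ≤
              (if 0 ≤ z then Ico (((i:ℝ)+1)*D - z) (((i:ℝ)+1)*D) else Ico ((i:ℝ)*D) ((i:ℝ)*D-z)).indicator 1 x := by
            intro x hx
            by_cases hz : x + z ∈ cell D i
            · simp [hz]
            · rw [indicator_of_mem (by exact hz), indicator_of_mem]; rfl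
              simp only [mem_Ico, not_and, not_lt] at hx hz
              split_ifs with h0
              · have := hz (by linarith)
                exact ⟨by linarith, hx.2⟩
              · refine ⟨hx.1, ?_⟩
                by_contra h3
                have := hz (by linarith)
                push Not at h0 h3
                linarith
          refine (setLIntegral_mono' measurableSet_Ico this).trans ?_
          refine (setLIntegral_le_lintegral _ _).trans ?_
          rw [lintegral_indicator_one]
          · split_ifs with h0
            · rw [Real.volume_Ico, abs_of_nonneg h0]; apply le_of_eq; congr 1; ring
            · rw [Real.volume_Ico, abs_of_neg (not_le.1 h0)]; apply le_of_eq; congr 1; ring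
          · split_ifs <;> exact measurableSet_Ico
        · calc _ ≤ ∫⁻ x in cell D i, 1 := by
                apply lintegral_mono; intro x
                exact indicator_le_self' (by simp) _
            _ = _ := by
                rw [setLIntegral_one, Real.volume_Ico]; congr 1; ring
      _ = _ := by
        rw [HK_scale hD, dlam_eq hl, Real.enorm_eq_ofReal hc, ENNReal.ofReal_mul (by positivity),
          ENNReal.ofReal_mul hc, ENNReal.ofReal_toReal (HK_lt_top hl).ne]
        ring
  rw [← Real.enorm_abs, Real.enorm_eq_ofReal (abs_nonneg _), ENNReal.ofReal_le_ofReal_iff] at h1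
  · exact (abs_le.1 h1).1
  · rw [dlam_eq hl]; positivity

/-- The nonlocal term of a nonnegative sequence. -/
lemma NL_ge {c l D : ℝ} (hc : 0 ≤ c) (hl : l ∈ Ioo (0:ℝ) 1) (hD : 0 < D) {V : ℤ → ℝ}
    (hV : Summable V) (h0 : ∀ k, 0 ≤ V k) (i : ℤ) :
    -(dlam c l * D ^ (1 - l)) * V i ≤ NL c l D V i := by
  have h1 : V i * NL c l D (Pi.single i 1) i ≤ NL c l D V i := by
    unfold NL
    rw [← integral_const_mul]
    have hn1 := pc_nice hD (summable_single i)
    have hn2 := pc_nice hD hV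
    apply integral_mono_ae ((hn1.fl_integrable c hl).integrableOn.const_mul _)
      (hn2.fl_integrable c hl).integrableOn
    have : ∀ᵐ x ∂(volume.restrict (cell D i)), x ∈ cell D i := ae_restrict_mem measurableSet_Ico
    filter_upwards [this, ae_restrict_of_ae (hn1.ae_integrable hl),
      ae_restrict_of_ae (hn2.ae_integrable hl)] with x hx i1 i2
    rw [fl_eq, fl_eq, mul_left_comm]
    apply mul_le_mul_of_nonneg_left _ hc
    rw [← integral_const_mul]
    apply integral_mono (i1.const_mul _) i2
    intro z
    beta_reduce
    rw [← mul_assoc]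
    apply mul_le_mul_of_nonneg_right _ (Kr_nonneg _ _)
    have hxi := (mem_cell_iff hD x i).1 hx
    have e1 := ej_eq D i x
    have e2 := ej_eq D i (x + z)
    unfold ej at e1 e2
    rw [e1, e2, hxi]
    unfold pc
    rw [hxi]
    split_ifs with h3 h4
    · rw [← h3]; simp
    · simp at h4
    · have := h0 ⌊(x + z) / D⌋
      simp; linarith
    · simp at *
  have h2 := mul_le_mul_of_nonneg_left (Gii_ge hc hl hD i) (h0 i)
  linarith

end DDG

namespace DDG
open MeasureTheory Filter Set
open scoped ENNReal Topology

/-! ### The scheme on summable sequences -/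

structure Hyp (c l D τ b : ℝ) (f a : ℝ → ℝ) (fh : ℝ → ℝ → ℝ) : Prop where
  hl : l ∈ Ioo (0:ℝ) 1
  hc : 0 < c
  hb : 0 ≤ b
  hD : 0 < D
  hτ : 0 < τ
  data : SchemeData f a fh
  cfl : CFL c l D τ b fh a

lemma fh_lip {f a : ℝ → ℝ} {fh : ℝ → ℝ → ℝ} (h : SchemeData f a fh) :
    ∃ K : ℝ, 0 ≤ K ∧ ∀ u v u' v', |fh u v - fh u' v'| ≤ K * (|u - u'| + |v - v'|) := by
  obtain ⟨K, hK⟩ := h.hfhatLip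
  refine ⟨K, K.2, fun u v u' v' => ?_⟩
  have := hK.dist_le_mul (u, v) (u', v')
  rw [Real.dist_eq, Prod.dist_eq, Real.dist_eq, Real.dist_eq] at this
  refine this.trans ?_
  gcongr
  exact max_le_add_of_nonneg (abs_nonneg _) (abs_nonneg _)

lemma a_cont {f a : ℝ → ℝ} {fh : ℝ → ℝ → ℝ} (h : SchemeData f a fh) : Continuous a := by
  obtain ⟨K, hK⟩ := h.haLip
  exact hK.continuous

lemma A_sub {f a : ℝ → ℝ} {fh : ℝ → ℝ → ℝ} (h : SchemeData f a fh) (u v : ℝ) :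
    Aint a v - Aint a u = ∫ s in u..v, a s := by
  unfold Aint
  exact intervalIntegral.integral_interval_sub_left ((a_cont h).intervalIntegrable _ _)
    ((a_cont h).intervalIntegrable _ _)

lemma A_mono {f a : ℝ → ℝ} {fh : ℝ → ℝ → ℝ} (h : SchemeData f a fh) : Monotone (Aint a) := by
  intro u v huv
  rw [← sub_nonneg, A_sub h]
  exact intervalIntegral.integral_nonneg huv fun s _ => h.haNonneg s

lemma A_le {f a : ℝ → ℝ} {fh : ℝ → ℝ → ℝ} (h : SchemeData f a fh) {M : ℝ} (hM : ∀ s, |a s| ≤ M)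
    {u v : ℝ} (huv : u ≤ v) : Aint a v - Aint a u ≤ M * (v - u) := by
  rw [A_sub h]
  refine (intervalIntegral.integral_mono_on huv ((a_cont h).intervalIntegrable _ _)
    intervalIntegrable_const fun s _ => (le_abs_self _).trans (hM s)).trans ?_
  simp [mul_comm]

lemma A_zero (a : ℝ → ℝ) : Aint a 0 = 0 := by simp [Aint]

lemma A_lip {f a : ℝ → ℝ} {fh : ℝ → ℝ → ℝ} (h : SchemeData f a fh) {M : ℝ} (hM : ∀ s, |a s| ≤ M)
    (u v : ℝ) : |Aint a v - Aint a u| ≤ M * |v - u| := by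
  rcases le_total u v with huv | huv
  · rw [abs_of_nonneg (sub_nonneg.2 (A_mono h huv)), abs_of_nonneg (sub_nonneg.2 huv)]
    exact A_le h hM huv
  · rw [abs_sub_comm, abs_sub_comm v, abs_of_nonneg (sub_nonneg.2 (A_mono h huv)),
      abs_of_nonneg (sub_nonneg.2 huv)]
    exact A_le h hM huv

lemma a_bdd {f a : ℝ → ℝ} {fh : ℝ → ℝ → ℝ} (h : SchemeData f a fh) :
    ∃ M, 0 ≤ M ∧ ∀ s, |a s| ≤ M := by
  obtain ⟨M, hM⟩ := h.haBdd
  exact ⟨M, (h.haNonneg 0).trans (hM 0), fun s => by rw [abs_of_nonneg (h.haNonneg s)]; exact hM s⟩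

/-- local part -/
noncomputable def Hl (D τ : ℝ) (a : ℝ → ℝ) (fh : ℝ → ℝ → ℝ) (p q r : ℝ) : ℝ :=
  q - (τ / D) * (fh q r - fh p q) + (τ / D ^ 2) * (Aint a r - 2 * Aint a q + Aint a p)

variable {c l D τ b : ℝ} {f a : ℝ → ℝ} {fh : ℝ → ℝ → ℝ}

lemma Hyp.step_eq (H : Hyp c l D τ b f a fh) {U : ℤ → ℝ} (hU : Summable U) (i : ℤ) :
    schemeStep c l D τ b fh a U i =
      Hl D τ a fh (U (i - 1)) (U i) (U (i + 1)) + (b * τ / D) * NL c l D U i := by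
  unfold schemeStep Hl
  rw [(Gw_hasSum H.hl H.hD hU i).tsum_eq]

lemma dlam_nonneg (hc : 0 ≤ c) (hl : l ∈ Ioo (0:ℝ) 1) : 0 ≤ dlam c l := by
  rw [dlam_eq hl]; positivity

lemma HK_pos : HK l ≠ 0 := by
  intro h
  unfold HK at h
  rw [lintegral_eq_zero_iff (by have := Kr_measurable l; fun_prop)] at h
  have h0 : ∀ᵐ x : ℝ, x = 0 := by
    filter_upwards [h] with z hz
    by_contra hne
    have hz0 : 0 < |z| := abs_pos.2 hne
    simp only [Pi.zero_apply, mul_eq_zero, ENNReal.ofReal_eq_zero] at hz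
    rcases hz with hz | hz
    · have : 0 < min |z| 1 := lt_min hz0 one_pos
      linarith
    · unfold Kr at hz
      have : 0 < (|z| ^ (1 + l))⁻¹ := by positivity
      linarith
  rw [ae_iff] at h0
  have h1 : volume (Ioo (0:ℝ) 1) = 0 := measure_mono_null (fun x hx => by
    simp; exact hx.1.ne') h0
  simp at h1

lemma dlam_pos (hc : 0 < c) (hl : l ∈ Ioo (0:ℝ) 1) : 0 < dlam c l := by
  rw [dlam_eq hl]
  exact mul_pos hc (ENNReal.toReal_pos (HK_pos) (HK_lt_top hl).ne)

/-- monotonicity of the local part, quantitative -/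
lemma Hyp.Hl_mono (H : Hyp c l D τ b f a fh) : ∃ θ : ℝ, 0 ≤ θ ∧ b * dlam c l * τ / D ^ l ≤ θ ∧
    ∀ p q r p' q' r', p ≤ p' → q ≤ q' → r ≤ r' →
      θ * (q' - q) ≤ Hl D τ a fh p' q' r' - Hl D τ a fh p q r := by
  obtain ⟨hC, M1, M2, Ma, h1, h2, h3, h4⟩ := H.cfl
  have hD := H.hD
  have hτ := H.hτ
  have hd := dlam_nonneg H.hc.le H.hl
  have hb := H.hb
  have hnn : 0 ≤ b * dlam c l * τ / D ^ l := by positivity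
  refine ⟨1 - (τ / D) * (M1 + M2) - (2 * τ / D ^ 2) * Ma, by linarith, by linarith, ?_⟩
  intro p q r p' q' r' hp hq hr
  have hdiff : Differentiable ℝ (fun p : ℝ × ℝ => fh p.1 p.2) := hC.differentiable (by norm_num)
  have d1 : ∀ v, Differentiable ℝ (fun s => fh s v) := fun v =>
    hdiff.comp (f := fun s : ℝ => (s, v)) (by fun_prop)
  have d2 : ∀ u, Differentiable ℝ (fun s => fh u s) := fun u =>
    hdiff.comp (f := fun s : ℝ => (u, s)) (by fun_prop)
  have l1 : fh q' r - fh q r ≤ M1 * (q' - q) := by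
    have := Convex.norm_image_sub_le_of_norm_deriv_le (f := fun s => fh s r) (s := univ) (C := M1)
      (fun x _ => (d1 r) x) (fun x _ => h1 x r) convex_univ (mem_univ q) (mem_univ q')
    rw [Real.norm_eq_abs, Real.norm_eq_abs, abs_of_nonneg (sub_nonneg.2 hq)] at this
    exact (le_abs_self _).trans this
  have l2 : fh p q - fh p q' ≤ M2 * (q' - q) := by
    have := Convex.norm_image_sub_le_of_norm_deriv_le (f := fun s => fh p s) (s := univ) (C := M2)
      (fun x _ => (d2 p) x) (fun x _ => h2 p x) convex_univ (mem_univ q) (mem_univ q')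
    rw [Real.norm_eq_abs, Real.norm_eq_abs, abs_of_nonneg (sub_nonneg.2 hq)] at this
    exact (neg_le_abs _).trans' (by simp) |>.trans this
  have l3 : fh q' r' ≤ fh q' r := H.data.hmono2 q' hr
  have l4 : fh p q' ≤ fh p' q' := H.data.hmono1 q' hp
  have a1 := A_mono H.data hp
  have a2 := A_mono H.data hr
  have a3 := A_le H.data h3 hq
  have t1 : 0 ≤ τ / D := by positivity
  have t2 : 0 ≤ τ / D ^ 2 := by positivity
  have k1 : (τ / D) * ((fh q' r' - fh p' q') - (fh q r - fh p q)) ≤ (τ / D) * ((M1 + M2) * (q' - q)) :=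
    mul_le_mul_of_nonneg_left (by linarith) t1
  have k2 : (τ / D ^ 2) * (-2 * (Ma * (q' - q))) ≤ (τ / D ^ 2) *
      ((Aint a r' - 2 * Aint a q' + Aint a p') - (Aint a r - 2 * Aint a q + Aint a p)) :=
    mul_le_mul_of_nonneg_left (by linarith) t2
  unfold Hl
  have e : (2 * τ / D ^ 2) * Ma = 2 * ((τ / D ^ 2) * Ma) := by ring
  rw [e]
  nlinarith [k1, k2]

lemma Hyp.step_mono (H : Hyp c l D τ b f a fh) {U V : ℤ → ℝ} (hU : Summable U) (hV : Summable V)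
    (hUV : ∀ i, U i ≤ V i) (i : ℤ) :
    schemeStep c l D τ b fh a U i ≤ schemeStep c l D τ b fh a V i := by
  obtain ⟨θ, h0, h1, h2⟩ := H.Hl_mono
  rw [H.step_eq hU, H.step_eq hV]
  have := h2 _ _ _ _ _ _ (hUV (i-1)) (hUV i) (hUV (i+1))
  have hn := NL_ge H.hc.le H.hl H.hD (hV.sub hU) (fun k => sub_nonneg.2 (hUV k)) i
  rw [NL_sub H.hl H.hD hV hU] at hn
  have hD := H.hD
  have hτ := H.hτ
  have hb := H.hb
  have hn2 := mul_le_mul_of_nonneg_left hn (by positivity : 0 ≤ b * τ / D)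
  have e : b * τ / D * (-(dlam c l * D ^ (1 - l)) * (V i - U i)) =
      - (b * dlam c l * τ / D ^ l) * (V i - U i) := by
    rw [Real.rpow_sub hD, Real.rpow_one]; field_simp
  rw [e] at hn2
  have := mul_le_mul_of_nonneg_right h1 (sub_nonneg.2 (hUV i))
  nlinarith

lemma summable_shift {F : ℤ → ℝ} (hF : Summable F) (m : ℤ) : Summable fun i => F (i + m) :=
  (Equiv.addRight m).summable_iff.2 hF

lemma hasSum_shift {F : ℤ → ℝ} {s : ℝ} (hF : HasSum F s) (m : ℤ) : HasSum (fun i => F (i + m)) s :=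
  (Equiv.addRight m).hasSum_iff.2 hF

lemma Hyp.sum_flux (H : Hyp c l D τ b f a fh) {U : ℤ → ℝ} (hU : Summable U) :
    Summable fun i => fh (U i) (U (i + 1)) := by
  obtain ⟨K, hK0, hK⟩ := fh_lip H.data
  have h0 : fh 0 0 = 0 := by rw [H.data.hconsistent, H.data.hf0]
  refine Summable.of_norm_bounded ((hU.abs.add (summable_shift hU 1).abs).mul_left K) fun i => ?_
  have := hK (U i) (U (i+1)) 0 0
  simpa [h0] using this

lemma Hyp.sum_A (H : Hyp c l D τ b f a fh) {U : ℤ → ℝ} (hU : Summable U) :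
    Summable fun i => Aint a (U i) := by
  obtain ⟨M, hM0, hM⟩ := a_bdd H.data
  refine Summable.of_norm_bounded (hU.abs.mul_left M) fun i => ?_
  have := A_lip H.data hM 0 (U i)
  simpa [A_zero] using this

lemma Hyp.step_hasSum (H : Hyp c l D τ b f a fh) {U : ℤ → ℝ} (hU : Summable U) :
    HasSum (schemeStep c l D τ b fh a U) (∑' i, U i) := by
  have h1 := (H.sum_flux hU).hasSum
  have h2 := hasSum_shift h1 (-1)
  have a1 := (H.sum_A hU).hasSum
  have a2 := hasSum_shift a1 (-1)
  have a3 := hasSum_shift a1 1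
  have n1 := NL_hasSum (c := c) H.hl H.hD hU
  have key := ((hU.hasSum.sub ((h1.sub h2).mul_left (τ / D))).add
    (((a3.sub (a1.mul_left 2)).add a2).mul_left (τ / D ^ 2))).add (n1.mul_left (b * τ / D))
  have e2 : (∑' i, U i) - τ / D * ((∑' i, fh (U i) (U (i + 1))) - ∑' i, fh (U i) (U (i + 1))) +
        τ / D ^ 2 * ((∑' i, Aint a (U i)) - 2 * (∑' i, Aint a (U i)) + ∑' i, Aint a (U i)) +
      b * τ / D * 0 = ∑' i, U i := by ring
  rw [e2] at key
  have e3 : ∀ i, schemeStep c l D τ b fh a U i = U i - τ / D * (fh (U i) (U (i + 1)) -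
      fh (U (i + -1)) (U (i + -1 + 1))) + τ / D ^ 2 * (Aint a (U (i + 1)) - 2 * Aint a (U i) +
      Aint a (U (i + -1))) + b * τ / D * NL c l D U i := fun i => by
    rw [H.step_eq hU]; unfold Hl; simp only [sub_eq_add_neg]; rw [neg_add_cancel_right]
  rw [funext e3]; exact key

lemma Hyp.step_summable (H : Hyp c l D τ b f a fh) {U : ℤ → ℝ} (hU : Summable U) :
    Summable (schemeStep c l D τ b fh a U) := (H.step_hasSum hU).summable

lemma tsum_enorm_eq {F : ℤ → ℝ} (hF : Summable F) : ∑' k, ‖F k‖ₑ = ENNReal.ofReal (∑' k, |F k|) := by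
  rw [ENNReal.ofReal_tsum_of_nonneg (fun _ => abs_nonneg _) hF.abs]
  congr 1; ext k
  rw [← Real.enorm_abs, Real.enorm_eq_ofReal (abs_nonneg _)]

lemma summable_sup {U V : ℤ → ℝ} (hU : Summable U) (hV : Summable V) :
    Summable (fun i => max (U i) (V i)) := by
  refine Summable.of_norm_bounded (hU.abs.add hV.abs) fun i => ?_
  rw [Real.norm_eq_abs]
  exact abs_max_le_max_abs_abs.trans (max_le_add_of_nonneg (abs_nonneg _) (abs_nonneg _))

lemma summable_inf {U V : ℤ → ℝ} (hU : Summable U) (hV : Summable V) :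
    Summable (fun i => min (U i) (V i)) := by
  refine Summable.of_norm_bounded (hU.abs.add hV.abs) fun i => ?_
  rw [Real.norm_eq_abs]
  exact abs_min_le_max_abs_abs.trans (max_le_add_of_nonneg (abs_nonneg _) (abs_nonneg _))

/-- `L¹` contraction -/
lemma Hyp.contr (H : Hyp c l D τ b f a fh) {U V : ℤ → ℝ} (hU : Summable U) (hV : Summable V) :
    ∑' i, ‖schemeStep c l D τ b fh a U i - schemeStep c l D τ b fh a V i‖ₑ ≤
      ∑' i, ‖U i - V i‖ₑ := by
  rw [tsum_enorm_eq ((H.step_summable hU).sub (H.step_summable hV)), tsum_enorm_eq (hU.sub hV)]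
  apply ENNReal.ofReal_le_ofReal
  have hs := summable_sup hU hV
  have hi := summable_inf hU hV
  have h1 := (H.step_hasSum hs).sub (H.step_hasSum hi)
  have h2 : ∑' i, |U i - V i| = (∑' i, max (U i) (V i)) - ∑' i, min (U i) (V i) := by
    rw [← hs.tsum_sub hi]
    congr 1; ext i; rw [max_sub_min_eq_abs']
  rw [h2, ← h1.tsum_eq]
  apply Summable.tsum_le_tsum _ ((H.step_summable hU).sub (H.step_summable hV)).abs h1.summable
  intro i
  have m1 := H.step_mono hU hs (fun i => le_max_left _ _) i
  have m2 := H.step_mono hV hs (fun i => le_max_right _ _) i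
  have m3 := H.step_mono hi hU (fun i => min_le_left _ _) i
  have m4 := H.step_mono hi hV (fun i => min_le_right _ _) i
  rw [abs_le]; constructor <;> linarith

lemma Hyp.step_shift (H : Hyp c l D τ b f a fh) {U : ℤ → ℝ} (hU : Summable U) (i : ℤ) :
    schemeStep c l D τ b fh a (fun k => U (k + 1)) i = schemeStep c l D τ b fh a U (i + 1) := by
  rw [H.step_eq hU, H.step_eq (summable_shift hU 1), NL_shift H.hD]
  congr 2; congr 1; ring

lemma step_zero : schemeStep c l D τ b fh a (fun _ => 0) = fun _ => 0 := by
  funext i; simp [schemeStep, A_zero]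

/-- iterates -/
noncomputable def itr (c l D τ b : ℝ) (fh : ℝ → ℝ → ℝ) (a : ℝ → ℝ) (V0 : ℤ → ℝ) : ℕ → ℤ → ℝ
  | 0 => V0
  | n + 1 => schemeStep c l D τ b fh a (itr c l D τ b fh a V0 n)

lemma Uiter_eq (c l D τ b : ℝ) (fh : ℝ → ℝ → ℝ) (a u₀ : ℝ → ℝ) (n : ℕ) :
    Uiter c l D τ b fh a u₀ n = itr c l D τ b fh a (Uiter c l D τ b fh a u₀ 0) n := by
  induction n with
  | zero => rfl
  | succ n ih => simp only [Uiter, itr]; rw [ih]; rfl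

lemma Hyp.itr_summable (H : Hyp c l D τ b f a fh) {V : ℤ → ℝ} (hV : Summable V) (n : ℕ) :
    Summable (itr c l D τ b fh a V n) := by
  induction n with
  | zero => exact hV
  | succ n ih => exact H.step_summable ih

lemma Hyp.itr_contr (H : Hyp c l D τ b f a fh) {U V : ℤ → ℝ} (hU : Summable U) (hV : Summable V)
    (n : ℕ) : ∑' i, ‖itr c l D τ b fh a U n i - itr c l D τ b fh a V n i‖ₑ ≤
      ∑' i, ‖U i - V i‖ₑ := by
  induction n with
  | zero => exact le_rfl
  | succ n ih => exact (H.contr (H.itr_summable hU n) (H.itr_summable hV n)).trans ih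

lemma Hyp.itr_zero (n : ℕ) : itr c l D τ b fh a (fun _ => 0) n = fun _ => 0 := by
  induction n with
  | zero => rfl
  | succ n ih => simp only [itr]; rw [ih, step_zero]

lemma Hyp.itr_l1 (H : Hyp c l D τ b f a fh) {V : ℤ → ℝ} (hV : Summable V) (n : ℕ) :
    ∑' i, ‖itr c l D τ b fh a V n i‖ₑ ≤ ∑' i, ‖V i‖ₑ := by
  have := H.itr_contr hV (summable_zero : Summable fun _ : ℤ => (0:ℝ)) n
  rw [Hyp.itr_zero] at this
  simpa using this

lemma Hyp.itr_shift (H : Hyp c l D τ b f a fh) {V : ℤ → ℝ} (hV : Summable V) (n : ℕ) :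
    itr c l D τ b fh a (fun k => V (k + 1)) n = fun k => itr c l D τ b fh a V n (k + 1) := by
  induction n with
  | zero => rfl
  | succ n ih =>
    simp only [itr]; rw [ih]; funext i; exact H.step_shift (H.itr_summable hV n) i

lemma Hyp.itr_tv (H : Hyp c l D τ b f a fh) {V : ℤ → ℝ} (hV : Summable V) (n : ℕ) :
    ∑' k, edist (itr c l D τ b fh a V n (k + 1)) (itr c l D τ b fh a V n k) ≤
      ∑' k, edist (V (k + 1)) (V k) := by
  have := H.itr_contr (summable_shift hV 1) hV n
  rw [H.itr_shift hV] at this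
  simpa only [edist_eq_enorm_sub] using this

lemma itr_succ' (V : ℤ → ℝ) (n : ℕ) : itr c l D τ b fh a V (n + 1) =
    itr c l D τ b fh a (schemeStep c l D τ b fh a V) n := by
  induction n with
  | zero => rfl
  | succ n ih => simp only [itr] at *; rw [ih]

lemma Hyp.itr_time (H : Hyp c l D τ b f a fh) {V : ℤ → ℝ} (hV : Summable V) (n : ℕ) :
    ∑' i, ‖itr c l D τ b fh a V (n + 1) i - itr c l D τ b fh a V n i‖ₑ ≤
      ∑' i, ‖schemeStep c l D τ b fh a V i - V i‖ₑ := by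
  rw [itr_succ']
  exact H.itr_contr (H.step_summable hV) hV n

lemma enorm_le_tv {V : ℤ → ℝ} (hV : Summable V) (i : ℤ) :
    ‖V i‖ₑ ≤ ∑' k, edist (V (k + 1)) (V k) := by
  have ht : Tendsto (fun k => edist (V i) (V k)) cofinite (𝓝 (edist (V i) 0)) :=
    tendsto_const_nhds.edist hV.tendsto_cofinite_zero
  rw [edist_zero_right] at ht
  apply le_of_tendsto ht
  exact Eventually.of_forall fun k => (eVariationOn.edist_le V (mem_univ i) (mem_univ k)).trans (evar_seq_le V)

/-- discrete Lipschitz bound for `A` -/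
lemma Hyp.A_lipD (H : Hyp c l D τ b f a fh) {W : ℤ → ℝ} (hW : Summable W) {K B C1 C2 : ℝ}
    (hK0 : 0 ≤ K) (hK : ∀ u v u' v', |fh u v - fh u' v'| ≤ K * (|u - u'| + |v - v'|))
    (hB : ∀ i, |W i| ≤ B) (hC1 : 0 ≤ C1) (hC2 : 0 ≤ C2)
    (h1 : ENNReal.ofReal D * ∑' i, ‖schemeStep c l D τ b fh a W i - W i‖ₑ ≤ ENNReal.ofReal (C1 * τ))
    (h2 : ∑' i, ‖NL c l D W i‖ₑ ≤ ENNReal.ofReal C2) (i : ℤ) :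
    |Aint a (W (i + 1)) - Aint a (W i)| ≤ D * (2 * K * B + C1 + b * C2) := by
  have hD := H.hD
  have hτ := H.hτ
  have hb := H.hb
  set E : ℤ → ℝ := fun i => (τ / D ^ 2) * (Aint a (W (i + 1)) - Aint a (W i)) -
    (τ / D) * fh (W i) (W (i + 1)) with hE
  have hEs : Summable E :=
    (((summable_shift (H.sum_A hW) 1).sub (H.sum_A hW)).mul_left _).sub ((H.sum_flux hW).mul_left _)
  have hle := enorm_le_tv hEs i
  have hstep : ∀ k, edist (E (k + 1)) (E k) ≤
      ‖schemeStep c l D τ b fh a W (k + 1) - W (k + 1)‖ₑ +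
        ENNReal.ofReal (b * τ / D) * ‖NL c l D W (k + 1)‖ₑ := by
    intro k
    rw [edist_eq_enorm_sub]
    have e : E (k + 1) - E k = (schemeStep c l D τ b fh a W (k + 1) - W (k + 1)) -
        (b * τ / D) * NL c l D W (k + 1) := by
      rw [H.step_eq hW, Hl, add_sub_cancel_right]; simp only [hE]; ring
    rw [e]
    refine enorm_sub_le.trans ?_
    rw [enorm_mul, Real.enorm_eq_ofReal (by positivity : 0 ≤ b * τ / D)]
  have hsum : ‖E i‖ₑ ≤ ENNReal.ofReal (C1 * τ / D + b * τ / D * C2) := by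
    refine hle.trans ((ENNReal.tsum_le_tsum hstep).trans ?_)
    rw [ENNReal.tsum_add, ENNReal.tsum_mul_left,
      tsum_shift_int (fun k => ‖schemeStep c l D τ b fh a W k - W k‖ₑ) 1,
      tsum_shift_int (fun k => ‖NL c l D W k‖ₑ) 1,
      ENNReal.ofReal_add (by positivity) (by positivity)]
    refine add_le_add ?_ ?_
    · rw [ENNReal.ofReal_div_of_pos hD, ENNReal.le_div_iff_mul_le (by simp [hD]) (by simp), mul_comm]
      exact h1
    · rw [ENNReal.ofReal_mul (by positivity)]; gcongr
  rw [← Real.enorm_abs, Real.enorm_eq_ofReal (abs_nonneg _),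
    ENNReal.ofReal_le_ofReal_iff (by positivity)] at hsum
  have hF : |fh (W i) (W (i+1))| ≤ K * (B + B) := by
    have h0 : fh 0 0 = 0 := by rw [H.data.hconsistent, H.data.hf0]
    have := hK (W i) (W (i+1)) 0 0
    rw [h0, sub_zero, sub_zero, sub_zero] at this
    refine this.trans ?_
    gcongr <;> exact hB _
  have e : Aint a (W (i + 1)) - Aint a (W i) = (D ^ 2 / τ) * E i + D * fh (W i) (W (i + 1)) := by
    simp only [hE]; field_simp; ring
  rw [e]
  calc _ ≤ |(D ^ 2 / τ) * E i| + |D * fh (W i) (W (i + 1))| := abs_add_le _ _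
    _ = (D ^ 2 / τ) * |E i| + D * |fh (W i) (W (i + 1))| := by
      rw [abs_mul, abs_mul, abs_of_pos hD, abs_of_pos (by positivity : 0 < D ^ 2 / τ)]
    _ ≤ (D ^ 2 / τ) * (C1 * τ / D + b * τ / D * C2) + D * (K * (B + B)) := by gcongr
    _ = _ := by field_simp; ring

noncomputable def Qf (fh : ℝ → ℝ → ℝ) (κ u v : ℝ) : ℝ :=
  fh (max u κ) (max v κ) - fh (min u κ) (min v κ)

lemma A_abs (h : SchemeData f a fh) (u κ : ℝ) :
    Aint a (max u κ) - Aint a (min u κ) = |Aint a u - Aint a κ| := by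
  rcases le_total u κ with hu | hu
  · rw [max_eq_right hu, min_eq_left hu, abs_sub_comm, abs_of_nonneg (sub_nonneg.2 (A_mono h hu))]
  · rw [max_eq_left hu, min_eq_right hu, abs_of_nonneg (sub_nonneg.2 (A_mono h hu))]

lemma abs_eq_sign_mul (x : ℝ) : |x| = Real.sign x * x := by
  rcases lt_trichotomy x 0 with h | h | h
  · rw [Real.sign_of_neg h, abs_of_neg h]; ring
  · simp [h]
  · rw [Real.sign_of_pos h, abs_of_pos h]; ring

lemma abs_sign_le (x : ℝ) : |Real.sign x| ≤ 1 := by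
  rcases lt_trichotomy x 0 with h | h | h
  · rw [Real.sign_of_neg h]; simp
  · simp [h]
  · rw [Real.sign_of_pos h]; simp

/-- discrete entropy inequality -/
lemma Hyp.entropy (H : Hyp c l D τ b f a fh) {W : ℤ → ℝ} (hW : Summable W) (κ : ℝ) (i : ℤ) :
    |schemeStep c l D τ b fh a W i - κ| ≤ |W i - κ|
      - (τ / D) * (Qf fh κ (W i) (W (i + 1)) - Qf fh κ (W (i - 1)) (W i))
      + (τ / D ^ 2) * (|Aint a (W (i + 1)) - Aint a κ| - 2 * |Aint a (W i) - Aint a κ|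
          + |Aint a (W (i - 1)) - Aint a κ|)
      + Real.sign (schemeStep c l D τ b fh a W i - κ) * ((b * τ / D) * NL c l D W i) := by
  obtain ⟨θ, h0, h1, h2⟩ := H.Hl_mono
  set s := schemeStep c l D τ b fh a W i with hs
  set h := Hl D τ a fh (W (i - 1)) (W i) (W (i + 1)) with hh
  have e : s = h + (b * τ / D) * NL c l D W i := H.step_eq hW i
  have hκ : Hl D τ a fh κ κ κ = κ := by unfold Hl; ring
  have mono : ∀ {p q r p' q' r'}, p ≤ p' → q ≤ q' → r ≤ r' →
      Hl D τ a fh p q r ≤ Hl D τ a fh p' q' r' := by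
    intro p q r p' q' r' hp hq hr
    have := h2 p q r p' q' r' hp hq hr
    have := mul_nonneg h0 (sub_nonneg.2 hq)
    linarith
  set hp := Hl D τ a fh (max (W (i - 1)) κ) (max (W i) κ) (max (W (i + 1)) κ) with hhp
  set hm := Hl D τ a fh (min (W (i - 1)) κ) (min (W i) κ) (min (W (i + 1)) κ) with hhm
  have m1 : h ≤ hp := mono (le_max_left _ _) (le_max_left _ _) (le_max_left _ _)
  have m2 : κ ≤ hp := hκ ▸ mono (le_max_right _ _) (le_max_right _ _) (le_max_right _ _)
  have m3 : hm ≤ h := mono (min_le_left _ _) (min_le_left _ _) (min_le_left _ _)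
  have m4 : hm ≤ κ := by
    have := mono (min_le_right (W (i - 1)) κ) (min_le_right (W i) κ) (min_le_right (W (i + 1)) κ)
    rw [hκ] at this; exact this
  have hle : |h - κ| ≤ hp - hm := by rw [abs_le]; constructor <;> linarith
  have hx : hp - hm = |W i - κ|
      - (τ / D) * (Qf fh κ (W i) (W (i + 1)) - Qf fh κ (W (i - 1)) (W i))
      + (τ / D ^ 2) * (|Aint a (W (i + 1)) - Aint a κ| - 2 * |Aint a (W i) - Aint a κ|
          + |Aint a (W (i - 1)) - Aint a κ|) := by
    rw [← A_abs H.data, ← A_abs H.data, ← A_abs H.data, ← max_sub_min_eq_abs']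
    simp only [hhp, hhm, Hl, Qf]; ring
  rw [← hx]
  have hsg : Real.sign (s - κ) * (h - κ) ≤ |h - κ| := by
    refine (le_abs_self _).trans ?_
    rw [abs_mul]
    exact mul_le_of_le_one_left (abs_nonneg _) (abs_sign_le _)
  calc |s - κ| = Real.sign (s - κ) * (s - κ) := abs_eq_sign_mul _
    _ = Real.sign (s - κ) * (h - κ) + Real.sign (s - κ) * ((b * τ / D) * NL c l D W i) := by
      conv_lhs => rw [show s - κ = (h - κ) + (b * τ / D) * NL c l D W i by rw [e]; ring]
      rw [show (h - κ) + (b * τ / D) * NL c l D W i = s - κ by rw [e]; ring]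
      rw [← mul_add]; congr 1; rw [e]; ring
    _ ≤ _ := by linarith

end DDG

namespace DDG
open MeasureTheory Filter Set
open scoped ENNReal Topology

/-! ### Initial data -/

lemma evar_sub_le (g h : ℝ → ℝ) :
    eVariationOn (fun x => g x - h x) univ ≤ eVariationOn g univ + eVariationOn h univ := by
  refine iSup_le ?_
  rintro ⟨n, ⟨p, hp, hps⟩⟩
  refine le_trans ?_ (add_le_add (eVariationOn.sum_le (f := g) (n := n) hp hps) (eVariationOn.sum_le (f := h) (n := n) hp hps))
  rw [← Finset.sum_add_distrib]
  refine Finset.sum_le_sum fun i _ => ?_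
  simp only [edist_eq_enorm_sub]
  rw [show g (p (i+1)) - h (p (i+1)) - (g (p i) - h (p i)) =
    (g (p (i+1)) - g (p i)) - (h (p (i+1)) - h (p i)) by ring]
  exact enorm_sub_le

lemma evar_lip {F : ℝ → ℝ} {K : NNReal} (hF : LipschitzWith K F) (g : ℝ → ℝ) :
    eVariationOn (fun x => F (g x)) univ ≤ K * eVariationOn g univ :=
  (hF.lipschitzOnWith (s := univ)).comp_eVariationOn_le (mapsTo_univ _ _)

lemma evar_prim {g : ℝ → ℝ} (hg : Integrable g) :
    eVariationOn (fun y => ∫ s in (0:ℝ)..y, g s) univ ≤ ∫⁻ x, ‖g x‖ₑ := by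
  refine iSup_le ?_
  rintro ⟨n, ⟨p, hp, hps⟩⟩
  simp only
  have key : ∑ i ∈ Finset.range n, edist (∫ s in (0:ℝ)..(p (i+1)), g s) (∫ s in (0:ℝ)..(p i), g s) ≤
      ∫⁻ x in Ioc (p 0) (p n), ‖g x‖ₑ := by
    induction n with
    | zero => simp
    | succ n ih =>
      rw [Finset.sum_range_succ, ← Ioc_union_Ioc_eq_Ioc (hp (Nat.zero_le n)) (hp (Nat.le_succ n)),
        lintegral_union measurableSet_Ioc (Set.disjoint_left.2 fun x hx hx' => not_lt.2 hx.2 hx'.1)]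
      refine add_le_add ih ?_
      rw [edist_eq_enorm_sub, intervalIntegral.integral_interval_sub_left hg.intervalIntegrable
        hg.intervalIntegrable, intervalIntegral.integral_of_le (hp (Nat.le_succ n))]
      exact enorm_integral_le_lintegral_enorm _
  exact key.trans (setLIntegral_le_lintegral _ _)

lemma bv_bdd {g : ℝ → ℝ} (hg : eVariationOn g univ ≠ ⊤) : ∃ B, ∀ x, |g x| ≤ B := by
  refine ⟨|g 0| + (eVariationOn g univ).toReal, fun x => ?_⟩
  have h := eVariationOn.edist_le g (mem_univ x) (mem_univ 0)
  have h2 := (ENNReal.toReal_le_toReal (edist_ne_top _ _) hg).2 h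
  rw [← dist_edist, Real.dist_eq] at h2
  have := abs_sub_abs_le_abs_sub (g x) (g 0)
  linarith

lemma bv_intervalIntegrable {g : ℝ → ℝ} (hg : eVariationOn g univ ≠ ⊤) (p q : ℝ) :
    IntervalIntegrable g volume p q := by
  obtain ⟨B, hB⟩ := bv_bdd hg
  refine (intervalIntegrable_const (c := B)).mono_fun (bv_measurable hg).aestronglyMeasurable ?_
  refine ae_of_all _ fun x => ?_
  exact (hB x).trans (le_abs_self _)

lemma second_diff {g w : ℝ → ℝ} (hw : eVariationOn w univ ≠ ⊤) (hg : Continuous g)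
    (hgw : ∀ x, g x = g 0 + ∫ y in (0:ℝ)..x, w y) {D : ℝ} (hD : 0 < D) :
    ∑' i : ℤ, ‖(1 / D) * (∫ x in cell D (i + 1), g x) - 2 * ((1 / D) * ∫ x in cell D i, g x) +
      (1 / D) * ∫ x in cell D (i - 1), g x‖ₑ ≤ ENNReal.ofReal D * eVariationOn w univ := by
  have hwm := bv_measurable hw
  have hgi : ∀ (s : ℝ) (i : ℤ), IntegrableOn (fun x => g (x + s)) (cell D i) := fun s i =>
    ((hg.comp (by fun_prop : Continuous fun x : ℝ => x + s)).integrableOn_Icc).mono_set Ico_subset_Icc_self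
  have hii := bv_intervalIntegrable hw
  have hm2 : Measurable (fun p : ℝ × ℝ => ‖w (p.1 + p.2) - w (p.1 + p.2 - D)‖ₑ) :=
    ((hwm.comp (by fun_prop)).sub (hwm.comp (by fun_prop))).enorm
  have h1 : ∀ x, g (x + D) - 2 * g x + g (x + (-D)) =
      ∫ s in Ioc 0 D, (w (x + s) - w (x + s - D)) := by
    intro x
    have e1 : g (x + D) - g x = ∫ y in x..(x+D), w y := by
      rw [hgw (x + D), hgw x, add_sub_add_left_eq_sub]
      exact intervalIntegral.integral_interval_sub_left (hii _ _) (hii _ _)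
    have e2 : g x - g (x + (-D)) = ∫ y in (x+(-D))..x, w y := by
      rw [hgw (x + (-D)), hgw x, add_sub_add_left_eq_sub]
      exact intervalIntegral.integral_interval_sub_left (hii _ _) (hii _ _)
    rw [← intervalIntegral.integral_of_le hD.le, intervalIntegral.integral_sub]
    · rw [intervalIntegral.integral_comp_add_left (fun y => w y) x]
      have e3 : (∫ s in (0:ℝ)..D, w (x + s - D)) = ∫ y in (x+(-D))..x, w y := by
        have := intervalIntegral.integral_comp_add_left (a := 0) (b := D) (fun y => w y) (x - D)
        rw [show x - D + 0 = x + (-D) by ring, show x - D + D = x by ring] at this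
        rw [← this]; congr 1; ext s; congr 1; ring
      rw [e3, ← e2, add_zero, ← e1]; ring
    · exact (hii (x + 0) (x + D)).comp_add_left x |>.congr_ae (by simp) |> fun h => by simpa using h
    · have := (hii (x - D + 0) (x - D + D)).comp_add_left (x - D)
      simp only [add_sub_cancel_left] at this
      refine (by simpa using this : IntervalIntegrable (fun s => w (x - D + s)) volume 0 D).congr ?_
      intro s _
      show w (x - D + s) = w (x + s - D)
      congr 1; ring
  have h2 : ∀ i : ℤ, ‖(1 / D) * (∫ x in cell D (i + 1), g x) - 2 * ((1 / D) * ∫ x in cell D i, g x) +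
      (1 / D) * ∫ x in cell D (i - 1), g x‖ₑ ≤ ENNReal.ofReal (1 / D) *
      ∫⁻ x in cell D i, ∫⁻ s in Ioc 0 D, ‖w (x + s) - w (x + s - D)‖ₑ := by
    intro i
    have e1 := setIntegral_cell_shift D g i 1
    have e2 := setIntegral_cell_shift D g i (-1)
    rw [← sub_eq_add_neg] at e2
    rw [← e1, ← e2]
    have : (1 / D) * (∫ x in cell D i, g (x + ((1:ℤ):ℝ) * D)) - 2 * ((1 / D) * ∫ x in cell D i, g x) +
      (1 / D) * (∫ x in cell D i, g (x + ((-1:ℤ):ℝ) * D)) = (1 / D) * ∫ x in cell D i,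
        (g (x + D) - 2 * g x + g (x + (-D))) := by
      have i0 := hgi 0 i
      simp only [add_zero] at i0
      have i1 : IntegrableOn (fun x => g (x + D) - 2 * g x) (cell D i) :=
        (hgi D i).sub (i0.const_mul 2)
      rw [integral_add i1 (hgi (-D) i),
        integral_sub (hgi D i) (i0.const_mul 2), integral_const_mul]
      push_cast
      simp only [one_mul, neg_mul]
      ring
    rw [this, enorm_mul, Real.enorm_eq_ofReal (by positivity)]
    gcongr
    refine (enorm_integral_le_lintegral_enorm _).trans ?_
    apply lintegral_mono
    intro x
    beta_reduce
    rw [h1]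
    exact enorm_integral_le_lintegral_enorm _
  refine (ENNReal.tsum_le_tsum h2).trans ?_
  rw [ENNReal.tsum_mul_left, ← lintegral_cells hD, lintegral_lintegral_swap hm2.aemeasurable]
  calc _ ≤ ENNReal.ofReal (1 / D) * ∫⁻ s in Ioc 0 D, ENNReal.ofReal D * eVariationOn w univ := by
        gcongr with s
        have := bv_shift hw D
        rw [abs_of_pos hD] at this
        refine le_trans (le_of_eq ?_) this
        rw [← lintegral_add_right_eq_self (μ := volume) (fun x => ‖w (x + D) - w x‖ₑ) (s - D)]
        congr 1; ext x; congr 3 <;> ring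
    _ = _ := by
        rw [setLIntegral_const, Real.volume_Ioc, sub_zero, ← mul_assoc, mul_comm, ← mul_assoc, ← mul_assoc,
          mul_comm (ENNReal.ofReal D) (ENNReal.ofReal (1 / D)), ← ENNReal.ofReal_mul (by positivity)]
        rw [one_div, inv_mul_cancel₀ hD.ne', ENNReal.ofReal_one, one_mul]

structure InitOK (c l D τ b : ℝ) (a : ℝ → ℝ) (fh : ℝ → ℝ → ℝ) (u₀ : ℝ → ℝ) (C : ℝ) (V : ℤ → ℝ) :
    Prop where
  sm : Summable V
  l1 : ENNReal.ofReal D * ∑' i, ‖V i‖ₑ ≤ ENNReal.ofReal C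
  tv : ∑' k, edist (V (k + 1)) (V k) ≤ ENNReal.ofReal C
  tm : ENNReal.ofReal D * ∑' i, ‖schemeStep c l D τ b fh a V i - V i‖ₑ ≤ ENNReal.ofReal (C * τ)
  cl : ∑' i, ‖Uiter c l D τ b fh a u₀ 0 i - V i‖ₑ ≤ ENNReal.ofReal C
  pt : ∀ x, ∃ y, |y - x| ≤ D ∧ pc D V x = u₀ y

lemma NL_bound {c l D : ℝ} (hD : 0 < D) {W : ℤ → ℝ} {C : ℝ≥0∞} (hC : C ≠ ⊤)
    (h1 : ENNReal.ofReal D * ∑' i, ‖W i‖ₑ ≤ C) (h2 : ∑' k, edist (W (k + 1)) (W k) ≤ C) :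
    ∑' i, ‖NL c l D W i‖ₑ ≤ ‖c‖ₑ * (2 * C * HK l) :=
  (tsum_NL_le hD).trans ((nice_of_bv hC ((lintegral_pc hD W).trans_le h1)
    ((evar_pc_le hD W).trans h2)).fl_l1 c l)

lemma init_data {c l b : ℝ} {f a : ℝ → ℝ} {fh : ℝ → ℝ → ℝ} (hl : l ∈ Ioo (0:ℝ) 1)
    (data : SchemeData f a fh) {u₀ : ℝ → ℝ} (hi : Integrable u₀)
    (hbv : eVariationOn u₀ univ ≠ ⊤)
    (hcompat : ∃ h : ℝ → ℝ, eVariationOn h Set.univ ≠ ⊤ ∧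
      ∀ x : ℝ, Aint a (u₀ x) = Aint a (u₀ 0) +
        ∫ y in (0:ℝ)..x,
          (f (u₀ y) - b * (∫ s in (0:ℝ)..y, fracLap c l u₀ s) - h y)) (Dm : ℝ) :
    ∃ C : ℝ, 0 ≤ C ∧ ∀ D τ, D ≤ Dm → Hyp c l D τ b f a fh →
      ∃ V : ℤ → ℝ, InitOK c l D τ b a fh u₀ C V := by
  obtain ⟨h, hh, hcomp⟩ := hcompat
  obtain ⟨Kf, hKf⟩ := data.hfLip
  obtain ⟨K, hK0, hK⟩ := fh_lip data
  set w : ℝ → ℝ := fun y => f (u₀ y) - b * (∫ s in (0:ℝ)..y, fracLap c l u₀ s) - h y with hw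
  set R := eVariationOn u₀ univ with hR
  set E1 := ∫⁻ x, ‖u₀ x‖ₑ with hE1
  have hE1t : E1 ≠ ⊤ := hi.2.ne
  have hnice : Nice u₀ (2 * (E1 + R)) :=
    nice_of_bv (ENNReal.add_ne_top.2 ⟨hE1t, hbv⟩) le_self_add le_add_self
  have hLi : Integrable (fracLap c l u₀) := hnice.fl_integrable c hl
  have hwv : eVariationOn w univ ≠ ⊤ := by
    refine ne_top_of_le_ne_top ?_ (evar_sub_le _ _)
    refine ENNReal.add_ne_top.2 ⟨ne_top_of_le_ne_top ?_ (evar_sub_le _ _), hh⟩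
    refine ENNReal.add_ne_top.2 ⟨ne_top_of_le_ne_top ?_ (evar_lip hKf u₀), ne_top_of_le_ne_top ?_
      (evar_lip (F := fun x => b * x) (K := ‖b‖₊) ?_ _)⟩
    · exact ENNReal.mul_ne_top (by simp) hbv
    · exact ENNReal.mul_ne_top (by simp) (ne_top_of_le_ne_top hLi.2.ne (evar_prim hLi))
    · refine LipschitzWith.of_dist_le_mul fun x y => ?_
      rw [Real.dist_eq, Real.dist_eq, ← mul_sub, abs_mul]; rfl
  set g : ℝ → ℝ := fun x => Aint a (u₀ x) with hg
  have hgw : ∀ x, g x = g 0 + ∫ y in (0:ℝ)..x, w y := hcomp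
  have hgc : Continuous g := by
    rw [show g = fun x => g 0 + ∫ y in (0:ℝ)..x, w y from funext hgw]
    exact continuous_const.add
      (intervalIntegral.continuous_primitive (bv_intervalIntegrable hwv) 0)
  set E2 := E1 + ENNReal.ofReal Dm * R with hE2
  set CE : ℝ≥0∞ := E2 + R + (ENNReal.ofReal K * (R + R) + eVariationOn w univ +
    ENNReal.ofReal b * (‖c‖ₑ * (2 * (E2 + R) * HK l))) with hCE
  have hE2t : E2 + R ≠ ⊤ :=
    ENNReal.add_ne_top.2 ⟨ENNReal.add_ne_top.2 ⟨hE1t, ENNReal.mul_ne_top (by simp) hbv⟩, hbv⟩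
  have hCEt : CE ≠ ⊤ := by
    refine ENNReal.add_ne_top.2 ⟨hE2t, ENNReal.add_ne_top.2 ⟨ENNReal.add_ne_top.2 ⟨?_, hwv⟩, ?_⟩⟩
    · exact ENNReal.mul_ne_top (by simp) (ENNReal.add_ne_top.2 ⟨hbv, hbv⟩)
    · exact ENNReal.mul_ne_top (by simp) (ENNReal.mul_ne_top (by simp) (ENNReal.mul_ne_top
        (ENNReal.mul_ne_top (by simp) hE2t) (HK_lt_top hl).ne))
  refine ⟨CE.toReal, ENNReal.toReal_nonneg, fun D τ hDm H => ?_⟩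
  have hD := H.hD
  have hτ := H.hτ
  have hCEr : ENNReal.ofReal CE.toReal = CE := ENNReal.ofReal_toReal hCEt
  have hlt : ∀ i : ℤ, (i:ℝ) * D < ((i:ℝ) + 1) * D := fun i => by nlinarith
  have hξ : ∀ i : ℤ, ∃ x ∈ Icc ((i:ℝ) * D) (((i:ℝ) + 1) * D), g x = (1 / D) * ∫ x in cell D i, g x := by
    intro i
    obtain ⟨x, hx, hx2⟩ := exists_eq_interval_average (hlt i).ne hgc.continuousOn
    refine ⟨x, ?_, ?_⟩
    · rw [uIoo_of_le (hlt i).le] at hx; exact Ioo_subset_Icc_self hx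
    · rw [hx2, interval_average_eq_div, intervalIntegral.integral_of_le (hlt i).le,
        integral_Ioc_eq_integral_Ioo, ← integral_Ico_eq_integral_Ioo]
      rw [show ((i:ℝ) + 1) * D - i * D = D by ring]; ring
  choose ξ hξ1 hξ2 using hξ
  set V : ℤ → ℝ := fun i => u₀ (ξ i) with hV
  have hξm : Monotone ξ := by
    apply monotone_int_of_le_succ
    intro i
    have := (hξ1 (i+1)).1
    push_cast at this
    exact (hξ1 i).2.trans this
  have htv : ∑' k, edist (V (k + 1)) (V k) ≤ R := tsum_edist_le hξm
  have hU0 : ∀ i, Uiter c l D τ b fh a u₀ 0 i = (1 / D) * ∫ x in cell D i, u₀ x := fun i => by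
    simp only [Uiter]; rw [integral_Ico_eq_integral_Ioo]
  have hvol : ∀ i : ℤ, volume (cell D i) = ENNReal.ofReal D := fun i => by
    rw [Real.volume_Ico]; congr 1; ring
  have hDD : ENNReal.ofReal (1 / D) * ENNReal.ofReal D = 1 := by
    rw [← ENNReal.ofReal_mul (by positivity), one_div, inv_mul_cancel₀ hD.ne', ENNReal.ofReal_one]
  have hcl : ∑' i, ‖Uiter c l D τ b fh a u₀ 0 i - V i‖ₑ ≤ R := by
    refine le_trans (ENNReal.tsum_le_tsum fun i => ?_)
      (tsum_evar_cells (g := u₀) (y := fun k : ℤ => (k:ℝ) * D) ?_)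
    · have e : Uiter c l D τ b fh a u₀ 0 i - V i = (1 / D) * ∫ x in cell D i, (u₀ x - V i) := by
        rw [hU0, integral_sub hi.integrableOn (integrableOn_const (by rw [hvol]; simp)),
          setIntegral_const, Measure.real, hvol, ENNReal.toReal_ofReal hD.le, smul_eq_mul]
        field_simp
      rw [e, enorm_mul, Real.enorm_eq_ofReal (by positivity)]
      calc _ ≤ ENNReal.ofReal (1 / D) * ∫⁻ x in cell D i,
            eVariationOn u₀ (Icc ((i:ℝ) * D) (((i + 1 : ℤ):ℝ) * D)) := by
            gcongr
            refine (enorm_integral_le_lintegral_enorm _).trans ?_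
            apply setLIntegral_mono' measurableSet_Ico
            intro x hx
            rw [← edist_eq_enorm_sub]
            push_cast
            exact eVariationOn.edist_le _ (Ico_subset_Icc_self hx) (hξ1 i)
        _ = _ := by
            rw [setLIntegral_const, hvol, mul_comm, mul_assoc, mul_comm (ENNReal.ofReal D), hDD, mul_one]
    · intro i j hij
      have : (i:ℝ) ≤ j := by exact_mod_cast hij
      exact mul_le_mul_of_nonneg_right this hD.le
  have hU1 : ENNReal.ofReal D * ∑' i, ‖Uiter c l D τ b fh a u₀ 0 i‖ₑ ≤ E1 := by
    rw [hE1, lintegral_cells hD, ← ENNReal.tsum_mul_left]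
    refine ENNReal.tsum_le_tsum fun i => ?_
    rw [hU0, enorm_mul, Real.enorm_eq_ofReal (by positivity), ← mul_assoc, mul_comm (ENNReal.ofReal D),
      hDD, one_mul]
    exact enorm_integral_le_lintegral_enorm _
  have hl1 : ENNReal.ofReal D * ∑' i, ‖V i‖ₑ ≤ E2 := by
    calc _ ≤ ENNReal.ofReal D * ∑' i, (‖Uiter c l D τ b fh a u₀ 0 i‖ₑ +
          ‖Uiter c l D τ b fh a u₀ 0 i - V i‖ₑ) := by
          gcongr with i
          have e : V i = Uiter c l D τ b fh a u₀ 0 i - (Uiter c l D τ b fh a u₀ 0 i - V i) := by ring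
          conv_lhs => rw [e]
          exact enorm_sub_le
      _ = ENNReal.ofReal D * (∑' i, ‖Uiter c l D τ b fh a u₀ 0 i‖ₑ) +
          ENNReal.ofReal D * ∑' i, ‖Uiter c l D τ b fh a u₀ 0 i - V i‖ₑ := by
          rw [ENNReal.tsum_add, mul_add]
      _ ≤ _ := add_le_add hU1 (mul_le_mul' (ENNReal.ofReal_le_ofReal hDm) hcl)
  have hsm : Summable V := by
    apply enorm_summable
    intro htop
    rw [htop, ENNReal.mul_top (by simpa using hD)] at hl1
    exact (ENNReal.add_ne_top.1 hE2t).1 (top_le_iff.1 hl1)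
  have hr1 : E2 ≤ CE := le_self_add.trans le_self_add
  have hr2 : R ≤ CE := le_add_self.trans le_self_add
  refine ⟨V, hsm, ?_, ?_, ?_, ?_, ?_⟩
  · rw [hCEr]; exact hl1.trans hr1
  · rw [hCEr]; exact htv.trans hr2
  · rw [ENNReal.ofReal_mul ENNReal.toReal_nonneg, hCEr]
    have hpt : ∀ i, ENNReal.ofReal D * ‖schemeStep c l D τ b fh a V i - V i‖ₑ ≤
        ENNReal.ofReal τ * (ENNReal.ofReal K * (edist (V (i - 1 + 1)) (V (i - 1)) + edist (V (i + 1)) (V i)) +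
          ENNReal.ofReal (1 / D) * ‖(1 / D) * (∫ x in cell D (i + 1), g x) -
            2 * ((1 / D) * ∫ x in cell D i, g x) + (1 / D) * ∫ x in cell D (i - 1), g x‖ₑ +
          ENNReal.ofReal b * ‖NL c l D V i‖ₑ) := by
      intro i
      rw [H.step_eq hsm, Hl, ← hξ2, ← hξ2, ← hξ2]
      have e : V i - τ / D * (fh (V i) (V (i + 1)) - fh (V (i - 1)) (V i)) +
          τ / D ^ 2 * (Aint a (V (i + 1)) - 2 * Aint a (V i) + Aint a (V (i - 1))) +
          b * τ / D * NL c l D V i - V i = (τ / D) * (-(fh (V i) (V (i + 1)) - fh (V (i - 1)) (V i)) +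
          (1 / D) * (g (ξ (i + 1)) - 2 * g (ξ i) + g (ξ (i - 1))) + b * NL c l D V i) := by
        simp only [hg, hV]; field_simp; ring
      rw [e, enorm_mul, Real.enorm_eq_ofReal (by positivity), ← mul_assoc,
        ← ENNReal.ofReal_mul hD.le, mul_div_cancel₀ _ hD.ne']
      gcongr
      refine (enorm_add_le _ _).trans (add_le_add ((enorm_add_le _ _).trans (add_le_add ?_ ?_)) ?_)
      · rw [enorm_neg, ← Real.enorm_abs, Real.enorm_eq_ofReal (abs_nonneg _), edist_dist, edist_dist,
          ← ENNReal.ofReal_add dist_nonneg dist_nonneg, ← ENNReal.ofReal_mul hK0]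
        apply ENNReal.ofReal_le_ofReal
        rw [sub_add_cancel, Real.dist_eq, Real.dist_eq]
        exact hK _ _ _ _
      · rw [enorm_mul, Real.enorm_eq_ofReal (by positivity)]
      · rw [enorm_mul, Real.enorm_eq_ofReal H.hb]
    rw [← ENNReal.tsum_mul_left]
    refine (ENNReal.tsum_le_tsum hpt).trans ?_
    rw [ENNReal.tsum_mul_left, mul_comm]
    gcongr
    rw [ENNReal.tsum_add, ENNReal.tsum_add, ENNReal.tsum_mul_left, ENNReal.tsum_mul_left,
      ENNReal.tsum_mul_left, ENNReal.tsum_add]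
    refine le_trans ?_ (le_add_self (b := E2 + R))
    gcongr
    · have := tsum_shift_int (fun k => edist (V (k + 1)) (V k)) (-1)
      simp only [← sub_eq_add_neg] at this
      rw [this]; exact htv
    · calc _ ≤ ENNReal.ofReal (1 / D) * (ENNReal.ofReal D * eVariationOn w univ) := by
            gcongr; exact second_diff hwv hgc hgw hD
        _ = _ := by rw [← mul_assoc, hDD, one_mul]
    · exact NL_bound hD hE2t (hl1.trans le_self_add) (htv.trans le_add_self)
  · rw [hCEr]; exact hcl.trans hr2
  · intro x
    refine ⟨ξ ⌊x / D⌋, ?_, rfl⟩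
    have h1 := (mem_cell_iff hD x ⌊x / D⌋).2 rfl
    have h2 := hξ1 ⌊x / D⌋
    rw [abs_le]
    constructor <;> nlinarith [h1.1, h1.2, h2.1, h2.2]

end DDG

namespace DDG
open MeasureTheory Filter Set
open scoped ENNReal Topology

/-- uniform bounds for the approximations -/
structure CompSeq (A : ℝ → ℝ) (C : ℝ) (ε : ℕ → ℝ) (v : ℕ → ℝ → ℝ → ℝ) : Prop where
  C0 : 0 ≤ C
  Ac : Continuous A
  eps : Tendsto ε atTop (𝓝 0)
  eps0 : ∀ j, 0 ≤ ε j
  meas : ∀ j, Measurable fun p : ℝ × ℝ => v j p.1 p.2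
  l1 : ∀ j t, ∫⁻ x, ‖v j x t‖ₑ ≤ ENNReal.ofReal C
  tv : ∀ j t, eVariationOn (fun x => v j x t) univ ≤ ENNReal.ofReal C
  bd : ∀ j x t, |v j x t| ≤ C
  time : ∀ j t s, ∫⁻ x, ‖v j x t - v j x s‖ₑ ≤ ENNReal.ofReal (C * (|t - s| + ε j))
  lip : ∀ j t x y, |A (v j x t) - A (v j y t)| ≤ C * (|x - y| + ε j)

/-- the limit -/
structure CompLim (A : ℝ → ℝ) (C : ℝ) (v : ℕ → ℝ → ℝ → ℝ) (u : ℝ → ℝ → ℝ) : Prop where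
  meas : Measurable fun p : ℝ × ℝ => u p.1 p.2
  l1 : ∀ t, ∫⁻ x, ‖u x t‖ₑ ≤ ENNReal.ofReal C
  tv : ∀ t, eVariationOn (fun x => u x t) univ ≤ ENNReal.ofReal C
  bd : ∀ x t, |u x t| ≤ C
  time : ∀ t s, ∫⁻ x, ‖u x t - u x s‖ₑ ≤ ENNReal.ofReal (C * |t - s|)
  lip : ∀ t x y, |A (u x t) - A (u y t)| ≤ C * |x - y|
  lim : ∀ t R, Tendsto (fun j => ∫⁻ x in Icc (-R) R, ‖v j x t - u x t‖ₑ) atTop (𝓝 0)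

lemma lintegral_le_of_Icc {F : ℝ → ℝ≥0∞} {B : ℝ≥0∞} (h : ∀ R : ℝ, ∫⁻ x in Icc (-R) R, F x ≤ B) :
    ∫⁻ x, F x ≤ B := by
  have hU : (⋃ n : ℕ, Icc (-(n:ℝ)) n) = univ := by
    rw [eq_univ_iff_forall]
    intro x
    obtain ⟨n, hn⟩ := exists_nat_ge |x|
    exact mem_iUnion.2 ⟨n, abs_le.1 hn⟩
  rw [← setLIntegral_univ, ← hU, setLIntegral_iUnion_of_directed]
  · exact iSup_le fun n => h n
  · apply Monotone.directed_le
    intro n m hnm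
    have : (n:ℝ) ≤ m := by exact_mod_cast hnm
    exact Icc_subset_Icc (by linarith) this

lemma net_tendsto {F : Filter ℕ} {w : ℕ → ℝ → ℝ} {g : ℝ → ℝ} {C : ℝ}
    (hw : ∀ j, eVariationOn (w j) univ ≤ ENNReal.ofReal C) (hg : eVariationOn g univ ≤ ENNReal.ofReal C)
    (hlim : ∀ r : ℚ, Tendsto (fun j => w j r) F (𝓝 (g r))) (R : ℝ) :
    Tendsto (fun j => ∫⁻ x in Icc (-R) R, ‖w j x - g x‖ₑ) F (𝓝 0) := by
  rw [ENNReal.tendsto_nhds_zero]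
  intro η hη
  -- choose mesh
  have h1 : Tendsto (fun m : ℕ => ENNReal.ofReal ((((m:ℝ) + 1))⁻¹) * (ENNReal.ofReal C + ENNReal.ofReal C + 1))
      atTop (𝓝 0) := by
    have : Tendsto (fun m : ℕ => ENNReal.ofReal ((((m:ℝ) + 1))⁻¹)) atTop (𝓝 0) := by
      have := ENNReal.tendsto_ofReal (tendsto_one_div_add_atTop_nhds_zero_nat (𝕜 := ℝ))
      simpa using this
    have h := ENNReal.Tendsto.mul_const (b := ENNReal.ofReal C + ENNReal.ofReal C + 1) this
      (Or.inr (by simp))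
    simpa using h
  obtain ⟨m, hm⟩ := ((ENNReal.tendsto_nhds_zero.1 h1) η hη).exists
  set e : ℝ := ((m:ℝ) + 1)⁻¹ with he
  have he0 : 0 < e := by positivity
  set s : Finset ℤ := Finset.Icc ⌊-R / e⌋ ⌊R / e⌋ with hs
  have hsub : Icc (-R) R ⊆ ⋃ k ∈ s, Ico ((k:ℝ) * e) (((k:ℝ) + 1) * e) := by
    intro x hx
    refine mem_iUnion₂.2 ⟨⌊x / e⌋, ?_, ?_⟩
    · rw [hs, Finset.mem_Icc]
      exact ⟨Int.floor_mono (by gcongr; exact hx.1), Int.floor_mono (by gcongr; exact hx.2)⟩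
    · exact (mem_cell_iff he0 x _).2 rfl
  have h2 : Tendsto (fun j => ∑ k ∈ s, ‖w j (k * e) - g (k * e)‖ₑ) F (𝓝 0) := by
    have : Tendsto (fun j => ∑ k ∈ s, ‖w j (k * e) - g (k * e)‖ₑ) F (𝓝 (∑ k ∈ s, 0)) := by
      apply tendsto_finsetSum
      intro k _
      have hk := hlim ((k:ℚ) * ((m:ℚ) + 1)⁻¹)
      push_cast at hk
      rw [← he] at hk
      have := (hk.sub_const (g (k * e))).enorm
      simpa using this
    simpa using this
  filter_upwards [(ENNReal.tendsto_nhds_zero.1 h2) 1 one_pos] with j hj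
  calc _ ≤ ∫⁻ x in ⋃ k ∈ s, Ico ((k:ℝ) * e) (((k:ℝ) + 1) * e), ‖w j x - g x‖ₑ := lintegral_mono_set hsub
    _ ≤ _ := net_lemma _ _ he0 s
    _ ≤ ENNReal.ofReal e * (ENNReal.ofReal C + ENNReal.ofReal C + 1) := by
        gcongr; exact hw j
    _ ≤ η := hm

lemma rightLim_tendsto {g : ℝ → ℝ} (hg : eVariationOn g univ ≠ ⊤) (x : ℝ) :
    Tendsto g (𝓝[>] x) (𝓝 (Function.rightLim g x)) :=
  BoundedVariationOn.tendsto_rightLim hg x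

lemma rightLim_ae {g : ℝ → ℝ} (hg : eVariationOn g univ ≠ ⊤) :
    ∀ᵐ x, Function.rightLim g x = g x := by
  filter_upwards [bv_ae_continuousAt hg] with x hx
  exact tendsto_nhds_unique (rightLim_tendsto hg x) (hx.tendsto.mono_left nhdsWithin_le_nhds)

lemma rightLim_avg {g : ℝ → ℝ} (hg : eVariationOn g univ ≠ ⊤) (x : ℝ) :
    Tendsto (fun k : ℕ => ((k:ℝ) + 1) * ∫ y in Ioc 0 (((k:ℝ) + 1)⁻¹), g (x + y)) atTop
      (𝓝 (Function.rightLim g x)) := by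
  rw [Metric.tendsto_atTop]
  intro η hη
  have h := Metric.tendsto_nhdsWithin_nhds.1 (rightLim_tendsto hg x) (η / 2) (half_pos hη)
  obtain ⟨δ, hδ, h⟩ := h
  obtain ⟨n, hn⟩ := exists_nat_gt δ⁻¹
  refine ⟨n, fun k hk => ?_⟩
  have hk' : (n:ℝ) ≤ k := by exact_mod_cast hk
  have hkp : (0:ℝ) < (k:ℝ) + 1 := by positivity
  have hkd : ((k:ℝ) + 1)⁻¹ < δ := by
    rw [inv_lt_comm₀ hkp hδ]; linarith
  have hm := bv_measurable hg
  obtain ⟨B, hB⟩ := bv_bdd hg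
  have hIntg : IntegrableOn (fun y => g (x + y)) (Ioc 0 (((k:ℝ) + 1)⁻¹)) := by
    refine Measure.integrableOn_of_bounded (M := B) (by simp) (hm.comp (by fun_prop)).aestronglyMeasurable ?_
    exact Eventually.of_forall fun y => hB _
  have e1 : ((k:ℝ) + 1) * (∫ y in Ioc 0 (((k:ℝ) + 1)⁻¹), g (x + y)) - Function.rightLim g x =
      ((k:ℝ) + 1) * ∫ y in Ioc 0 (((k:ℝ) + 1)⁻¹), (g (x + y) - Function.rightLim g x) := by
    rw [integral_sub hIntg (by simp), setIntegral_const]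
    simp only [Measure.real, Real.volume_Ioc, sub_zero, smul_eq_mul]
    rw [ENNReal.toReal_ofReal (by positivity)]
    field_simp
  have e2 : ‖∫ y in Ioc 0 (((k:ℝ) + 1)⁻¹), (g (x + y) - Function.rightLim g x)‖ ≤
      (η / 2) * volume.real (Ioc 0 (((k:ℝ) + 1)⁻¹)) := by
    apply norm_setIntegral_le_of_norm_le_const (by simp)
    intro y hy
    have := h (x := x + y) (by simpa using hy.1) (by
      rw [Real.dist_eq, add_sub_cancel_left, abs_of_pos hy.1]; exact hy.2.trans_lt hkd)
    exact this.le
  rw [Real.dist_eq, e1, abs_mul, abs_of_pos hkp]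
  simp only [Measure.real, Real.volume_Ioc, sub_zero, Real.norm_eq_abs] at e2
  rw [ENNReal.toReal_ofReal (by positivity)] at e2
  calc _ ≤ ((k:ℝ) + 1) * (η / 2 * ((k:ℝ) + 1)⁻¹) := by gcongr
    _ = η / 2 := by field_simp
    _ < η := by linarith


theorem CompSeq.compact {A : ℝ → ℝ} {C : ℝ} {ε : ℕ → ℝ} {v : ℕ → ℝ → ℝ → ℝ} (h : CompSeq A C ε v) :
    ∃ ψ : ℕ → ℕ, StrictMono ψ ∧ ∃ u, CompLim A C (fun j => v (ψ j)) u := by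
  -- subsequence on rationals
  have hK : IsCompact (univ.pi fun _ : ℚ × ℚ => Icc (-C) C) := isCompact_univ_pi fun _ => isCompact_Icc
  obtain ⟨G, -, ψ, hψ, hG⟩ := hK.tendsto_subseq (x := fun j (p : ℚ × ℚ) => v j p.1 p.2)
    (fun j p _ => abs_le.1 (h.bd j _ _))
  rw [tendsto_pi_nhds] at hG
  set w : ℕ → ℝ → ℝ → ℝ := fun j => v (ψ j) with hw
  have hε : Tendsto (fun j => ε (ψ j)) atTop (𝓝 0) := h.eps.comp hψ.tendsto_atTop
  set U : Ultrafilter ℕ := hyperfilter ℕ with hU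
  have hUle : (U : Filter ℕ) ≤ atTop := by
    rw [← Nat.cofinite_eq_atTop]; exact hyperfilter_le_cofinite
  have hex : ∀ x t, ∃ y, Tendsto (fun j => w j x t) U (𝓝 y) := by
    intro x t
    obtain ⟨y, -, hy⟩ := (isCompact_Icc (a := -C) (b := C)).ultrafilter_le_nhds (U.map fun j => w j x t)
      (by
        rw [le_principal_iff]
        exact Eventually.of_forall (f := (U : Filter ℕ)) (p := fun j => w j x t ∈ Icc (-C) C)
          fun j => abs_le.1 (h.bd _ _ _))
    exact ⟨y, hy⟩
  choose g hg using hex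
  have gtv : ∀ t, eVariationOn (fun x => g x t) univ ≤ ENNReal.ofReal C := by
    intro t
    by_contra hc
    rw [not_le] at hc
    have := eVariationOn.lowerSemicontinuous_aux (F := fun j x => w j x t) (p := (U : Filter ℕ))
      (f := fun x => g x t) (s := univ) (fun x _ => hg x t) hc
    obtain ⟨j, hj⟩ := this.exists
    exact absurd (h.tv (ψ j) t) (not_le.2 hj)
  have gtv' : ∀ t, eVariationOn (fun x => g x t) univ ≠ ⊤ := fun t =>
    ne_top_of_le_ne_top ENNReal.ofReal_ne_top (gtv t)
  have gm : ∀ t, Measurable fun x => g x t := fun t => bv_measurable (gtv' t)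
  have wm : ∀ j t, Measurable fun x => w j x t := fun j t =>
    (h.meas (ψ j)).comp (measurable_id.prodMk measurable_const)
  have mwg : ∀ j t, Measurable fun x => ‖w j x t - g x t‖ₑ := fun j t => ((wm j t).sub (gm t)).enorm
  have mww : ∀ j t s, Measurable fun x => ‖w j x t - w j x s‖ₑ := fun j t s => ((wm j t).sub (wm j s)).enorm
  have mgg : ∀ t s, Measurable fun x => ‖g x t - g x s‖ₑ := fun t s => ((gm t).sub (gm s)).enorm
  have glip : ∀ t x y, |A (g x t) - A (g y t)| ≤ C * |x - y| := by
    intro t x y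
    have h1 : Tendsto (fun j => |A (w j x t) - A (w j y t)|) U (𝓝 |A (g x t) - A (g y t)|) :=
      (((h.Ac.tendsto _).comp (hg x t)).sub ((h.Ac.tendsto _).comp (hg y t))).abs
    have h2 : Tendsto (fun j => C * (|x - y| + ε (ψ j))) U (𝓝 (C * (|x - y| + 0))) :=
      ((hε.mono_left hUle).const_add _).const_mul _
    rw [add_zero] at h2
    exact le_of_tendsto_of_tendsto' h1 h2 fun j => h.lip _ _ _ _
  have gbd : ∀ x t, |g x t| ≤ C := fun x t => le_of_tendsto' (hg x t).abs fun j => h.bd _ _ _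
  -- L1loc convergence along U
  have hUlim : ∀ t R, Tendsto (fun j => ∫⁻ x in Icc (-R) R, ‖w j x t - g x t‖ₑ) U (𝓝 0) := fun t R =>
    net_tendsto (F := (U : Filter ℕ)) (w := fun j x => w j x t) (fun j => h.tv _ t) (gtv t) (fun r => hg r t) R
  have hQlim : ∀ (q : ℚ) R, Tendsto (fun j => ∫⁻ x in Icc (-R) R, ‖w j x q - g x q‖ₑ) atTop (𝓝 0) := by
    intro q R
    refine net_tendsto (F := atTop) (w := fun j x => w j x q) (fun j => h.tv _ q) (gtv q) (fun r => ?_) R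
    have h1 : Tendsto (fun j => w j r q) atTop (𝓝 (G (r, q))) := hG (r, q)
    have h2 := tendsto_nhds_unique (h1.mono_left hUle) (hg r q)
    rw [← h2]; exact h1
  have tri : ∀ (R t s : ℝ) (j : ℕ), ∫⁻ x in Icc (-R) R, ‖g x t - g x s‖ₑ ≤
      (∫⁻ x in Icc (-R) R, ‖w j x t - g x t‖ₑ) + ENNReal.ofReal (C * (|t - s| + ε (ψ j))) +
       ∫⁻ x in Icc (-R) R, ‖w j x s - g x s‖ₑ := by
    intro R t s j
    calc _ ≤ ∫⁻ x in Icc (-R) R, (‖w j x t - g x t‖ₑ + ‖w j x t - w j x s‖ₑ + ‖w j x s - g x s‖ₑ) := by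
          apply lintegral_mono
          intro x
          have e : g x t - g x s = (-(w j x t - g x t) + (w j x t - w j x s)) + (w j x s - g x s) := by ring
          simp only
          rw [e]
          refine (enorm_add_le _ _).trans ?_
          gcongr
          refine (enorm_add_le _ _).trans ?_
          rw [enorm_neg]
      _ = (∫⁻ x in Icc (-R) R, ‖w j x t - g x t‖ₑ) + (∫⁻ x in Icc (-R) R, ‖w j x t - w j x s‖ₑ) +
           ∫⁻ x in Icc (-R) R, ‖w j x s - g x s‖ₑ := by
          rw [lintegral_add_right _ (mwg j s),
            lintegral_add_right _ (mww j t s)]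
      _ ≤ _ := by
          gcongr
          exact (setLIntegral_le_lintegral _ _).trans (h.time _ _ _)
  have gtimeR : ∀ R t s, ∫⁻ x in Icc (-R) R, ‖g x t - g x s‖ₑ ≤ ENNReal.ofReal (C * |t - s|) := by
    intro R t s
    have h2 : Tendsto (fun j => C * (|t - s| + ε (ψ j))) U (𝓝 (C * (|t - s| + 0))) :=
      ((hε.mono_left hUle).const_add _).const_mul _
    have h3 := ((hUlim t R).add (ENNReal.tendsto_ofReal h2)).add (hUlim s R)
    rw [add_zero, add_zero, zero_add] at h3
    exact ge_of_tendsto' h3 fun j => tri R t s j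
  have gtime : ∀ t s, ∫⁻ x, ‖g x t - g x s‖ₑ ≤ ENNReal.ofReal (C * |t - s|) := fun t s =>
    lintegral_le_of_Icc fun R => gtimeR R t s
  have hlim : ∀ t R, Tendsto (fun j => ∫⁻ x in Icc (-R) R, ‖w j x t - g x t‖ₑ) atTop (𝓝 0) := by
    intro t R
    rw [ENNReal.tendsto_nhds_zero]
    intro η hη
    by_cases htop : η = ⊤
    · simp [htop]
    -- choose rational q
    have hη' : 0 < η.toReal := ENNReal.toReal_pos hη.ne' htop
    set d := η.toReal / (4 * (C + 1)) with hd
    have hC := h.C0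
    have hd0 : 0 < d := by positivity
    obtain ⟨q, hq1, hq2⟩ := exists_rat_btwn (show t < t + d by linarith)
    have hqd : |t - q| ≤ d := by rw [abs_le]; constructor <;> linarith
    have hCd : C * d ≤ η.toReal / 4 := by
      rw [hd, mul_div_assoc', div_le_div_iff₀ (by positivity) (by positivity)]; nlinarith
    have ev1 := (ENNReal.tendsto_nhds_zero.1 (hQlim q R)) (ENNReal.ofReal (η.toReal / 4)) (by simpa using hη')
    have ev2 : ∀ᶠ j in atTop, C * ε (ψ j) < η.toReal / 4 := by
      have : Tendsto (fun j => C * ε (ψ j)) atTop (𝓝 (C * 0)) := hε.const_mul _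
      rw [mul_zero] at this
      exact this.eventually_lt_const (by linarith)
    filter_upwards [ev1, ev2] with j h1 h2
    calc _ ≤ ∫⁻ x in Icc (-R) R, (‖w j x t - w j x q‖ₑ + ‖w j x q - g x q‖ₑ + ‖g x t - g x q‖ₑ) := by
          apply lintegral_mono
          intro x
          have e : w j x t - g x t = ((w j x t - w j x q) + (w j x q - g x q)) + -(g x t - g x q) := by ring
          simp only
          rw [e]
          refine (enorm_add_le _ _).trans ?_
          rw [enorm_neg]
          gcongr
          exact (enorm_add_le _ _)
      _ = (∫⁻ x in Icc (-R) R, ‖w j x t - w j x q‖ₑ) + (∫⁻ x in Icc (-R) R, ‖w j x q - g x q‖ₑ) +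
           ∫⁻ x in Icc (-R) R, ‖g x t - g x q‖ₑ := by
          rw [lintegral_add_right _ (mgg t q),
            lintegral_add_right _ (mwg j q)]
      _ ≤ ENNReal.ofReal (C * (|t - q| + ε (ψ j))) + ENNReal.ofReal (η.toReal / 4) + ENNReal.ofReal (C * |t - q|) := by
          gcongr
          · exact (setLIntegral_le_lintegral _ _).trans (h.time _ _ _)
          · exact gtimeR R t q
      _ = ENNReal.ofReal (C * (|t - q| + ε (ψ j)) + η.toReal / 4 + C * |t - q|) := by
          have := h.eps0 (ψ j)
          rw [ENNReal.ofReal_add (by positivity) (by positivity), ENNReal.ofReal_add (by positivity) (by positivity)]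
      _ ≤ ENNReal.ofReal η.toReal := by
          apply ENNReal.ofReal_le_ofReal
          have : C * |t - q| ≤ C * d := by gcongr
          linarith
      _ = η := ENNReal.ofReal_toReal htop
  -- the right limit
  set u : ℝ → ℝ → ℝ := fun x t => Function.rightLim (fun y => g y t) x with hu
  have uae : ∀ t, (fun x => u x t) =ᵐ[volume] fun x => g x t := fun t => rightLim_ae (gtv' t)
  have ulim : ∀ t x, Tendsto (fun y => g y t) (𝓝[>] x) (𝓝 (u x t)) := fun t x => rightLim_tendsto (gtv' t) x
  refine ⟨ψ, hψ, u, ?_, ?_, ?_, ?_, ?_, ?_, ?_⟩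
  · -- measurability
    have m1 : ∀ (j k : ℕ), Measurable fun p : ℝ × ℝ =>
        ((k:ℝ) + 1) * ∫ y in Ioc 0 (((k:ℝ) + 1)⁻¹), w j (p.1 + y) p.2 := by
      intro j k
      have hm : Measurable (fun q : (ℝ × ℝ) × ℝ => w j (q.1.1 + q.2) q.1.2) :=
        (h.meas (ψ j)).comp (f := fun q : (ℝ × ℝ) × ℝ => (q.1.1 + q.2, q.1.2)) (by fun_prop)
      exact (hm.stronglyMeasurable.integral_prod_right' (ν := volume.restrict (Ioc 0 (((k:ℝ) + 1)⁻¹)))).measurable.const_mul _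
    have m2 : ∀ k : ℕ, Measurable fun p : ℝ × ℝ =>
        ((k:ℝ) + 1) * ∫ y in Ioc 0 (((k:ℝ) + 1)⁻¹), g (p.1 + y) p.2 := by
      intro k
      refine measurable_of_tendsto_metrizable (fun j => m1 j k) ?_
      rw [tendsto_pi_nhds]
      rintro ⟨x, t⟩
      refine Tendsto.const_mul _ ?_
      simp only
      set I := Ioc (0:ℝ) (((k:ℝ) + 1)⁻¹) with hI
      have kinv : ((k:ℝ) + 1)⁻¹ ≤ 1 := inv_le_one_of_one_le₀ (by linarith [Nat.cast_nonneg (α := ℝ) k])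
      have hsh : ∀ j, ∫⁻ y in I, ‖w j (x + y) t - g (x + y) t‖ₑ ≤
          ∫⁻ y in Icc (-(|x| + 1)) (|x| + 1), ‖w j y t - g y t‖ₑ := by
        intro j
        have := (measurePreserving_add_left volume x).setLIntegral_comp_preimage_emb
          (MeasurableEquiv.addLeft x).measurableEmbedding (fun y => ‖w j y t - g y t‖ₑ) (Icc (-(|x| + 1)) (|x| + 1))
        rw [← this]
        apply lintegral_mono_set
        intro y hy
        have hx1 := neg_abs_le x
        have hx2 := le_abs_self x
        have hy1 := hy.1
        have hy2 := hy.2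
        constructor <;> simp only <;> linarith
      have hz : Tendsto (fun j => ∫⁻ y in I, ‖w j (x + y) t - g (x + y) t‖ₑ) atTop (𝓝 0) :=
        tendsto_of_tendsto_of_tendsto_of_le_of_le tendsto_const_nhds (hlim t (|x| + 1)) (fun _ => zero_le) hsh
      refine tendsto_integral_of_L1 _ ?_ (Eventually.of_forall fun j => ?_) hz
      · have hm : Measurable fun y => g (x + y) t := (gm t).comp (by fun_prop)
        exact hm.aestronglyMeasurable
      · have hm : Measurable fun y => w j (x + y) t := (wm j t).comp (by fun_prop)
        refine (Measure.integrableOn_of_bounded (μ := volume) (M := C) (s := I) (by simp [hI]) hm.aestronglyMeasurable ?_)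
        exact Eventually.of_forall fun y => h.bd _ _ _
    refine measurable_of_tendsto_metrizable m2 ?_
    rw [tendsto_pi_nhds]
    rintro ⟨x, t⟩
    exact rightLim_avg (gtv' t) x
  · intro t
    rw [lintegral_congr_ae ((uae t).mono fun x hx => congrArg enorm hx)]
    refine lintegral_le_of_Icc fun R => ?_
    have h3 := (hlim t R).add_const (ENNReal.ofReal C)
    rw [zero_add] at h3
    refine ge_of_tendsto' h3 fun j => ?_
    calc _ ≤ ∫⁻ x in Icc (-R) R, (‖w j x t - g x t‖ₑ + ‖w j x t‖ₑ) := by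
          apply lintegral_mono
          intro x
          have e : g x t = -(w j x t - g x t) + w j x t := by ring
          simp only
          conv_lhs => rw [e]
          refine (enorm_add_le _ _).trans ?_
          rw [enorm_neg]
      _ = (∫⁻ x in Icc (-R) R, ‖w j x t - g x t‖ₑ) + (∫⁻ x in Icc (-R) R, ‖w j x t‖ₑ) := by
          rw [lintegral_add_right _ (wm j t).enorm]
      _ ≤ _ := by
          gcongr
          exact (setLIntegral_le_lintegral _ _).trans (h.l1 _ _)
  · intro t
    exact (eVariationOn.eVariationOn_rightLim_le isOpen_univ).trans (gtv t)
  · intro x t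
    exact le_of_tendsto' (ulim t x).abs fun y => gbd y t
  · intro t s
    refine le_trans (le_of_eq ?_) (gtime t s)
    exact lintegral_congr_ae (((uae t).sub (uae s)).mono fun x hx => congrArg enorm hx)
  · intro t x y
    have h1 : Tendsto (fun z => A (g (x + z) t)) (𝓝[>] 0) (𝓝 (A (u x t))) := by
      refine ((h.Ac.tendsto _).comp (ulim t x)).comp ?_
      refine tendsto_nhdsWithin_iff.2 ⟨?_, ?_⟩
      · have : Tendsto (fun z => x + z) (𝓝 0) (𝓝 (x + 0)) := tendsto_id.const_add x
        rw [add_zero] at this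
        exact this.mono_left nhdsWithin_le_nhds
      · filter_upwards [self_mem_nhdsWithin] with z hz
        simpa using hz
    have h2 : Tendsto (fun z => A (g (y + z) t)) (𝓝[>] 0) (𝓝 (A (u y t))) := by
      refine ((h.Ac.tendsto _).comp (ulim t y)).comp ?_
      refine tendsto_nhdsWithin_iff.2 ⟨?_, ?_⟩
      · have : Tendsto (fun z => y + z) (𝓝 0) (𝓝 (y + 0)) := tendsto_id.const_add y
        rw [add_zero] at this
        exact this.mono_left nhdsWithin_le_nhds
      · filter_upwards [self_mem_nhdsWithin] with z hz
        simpa using hz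
    refine le_of_tendsto' (h1.sub h2).abs fun z => ?_
    have := glip t (x + z) (y + z)
    rwa [add_sub_add_right_eq_sub] at this
  · intro t R
    refine (hlim t R).congr fun j => ?_
    refine lintegral_congr_ae (ae_restrict_of_ae ?_)
    filter_upwards [uae t] with x hx
    have : u x t = g x t := hx
    rw [this]

end DDG

namespace DDG
open MeasureTheory Filter Set
open scoped ENNReal Topology

lemma lintegral_QT {F : ℝ × ℝ → ℝ≥0∞} (hF : Measurable F) (S : Set ℝ) :
    ∫⁻ p in (univ ×ˢ S : Set (ℝ × ℝ)), F p = ∫⁻ t in S, ∫⁻ x, F (x, t) := by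
  rw [Measure.volume_eq_prod, ← Measure.prod_restrict, lintegral_prod_symm _ hF.aemeasurable,
    Measure.restrict_univ]

lemma intOn_QT {F : ℝ × ℝ → ℝ} (hF : Measurable F) {B : ℝ≥0∞} (hB : B ≠ ⊤)
    (h : ∀ t, ∫⁻ x, ‖F (x, t)‖ₑ ≤ B) (T : ℝ) : IntegrableOn F (univ ×ˢ Ioo (0:ℝ) T) := by
  refine ⟨hF.aestronglyMeasurable, ?_⟩
  rw [hasFiniteIntegral_def, lintegral_QT hF.enorm]
  calc _ ≤ ∫⁻ t in Ioo (0:ℝ) T, B := lintegral_mono fun t => h t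
    _ = B * volume (Ioo (0:ℝ) T) := by rw [setLIntegral_const]
    _ < ⊤ := ENNReal.mul_lt_top hB.lt_top (by simp)

lemma le_of_enorm_le {I M : ℝ} (hM : 0 ≤ M) (h : ‖I‖ₑ ≤ ENNReal.ofReal M) : I ≤ M := by
  rw [← ofReal_norm, ENNReal.ofReal_le_ofReal_iff hM] at h
  exact (le_abs_self I).trans h

variable {A : ℝ → ℝ} {C : ℝ} {v : ℕ → ℝ → ℝ → ℝ} {u : ℝ → ℝ → ℝ}

lemma CompLim.int (hu : CompLim A C v u) (T : ℝ) :
    IntegrableOn (fun p : ℝ × ℝ => u p.1 p.2) (univ ×ˢ Ioo (0:ℝ) T) :=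
  intOn_QT hu.meas ENNReal.ofReal_ne_top (fun t => hu.l1 t) T

lemma CompLim.measx (hu : CompLim A C v u) (t : ℝ) : Measurable fun x => u x t :=
  hu.meas.comp (measurable_id.prodMk measurable_const)

lemma CompLim.tv' (hu : CompLim A C v u) (t : ℝ) : eVariationOn (fun x => u x t) univ ≠ ⊤ :=
  ne_top_of_le_ne_top ENNReal.ofReal_ne_top (hu.tv t)

lemma CompLim.nice (hu : CompLim A C v u) (t : ℝ) : Nice (fun x => u x t) (2 * ENNReal.ofReal C) :=
  nice_of_bv ENNReal.ofReal_ne_top (hu.l1 t) (hu.tv t)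

lemma CompLim.intx (hu : CompLim A C v u) (t : ℝ) : Integrable fun x => u x t :=
  ⟨(hu.measx t).aestronglyMeasurable, (hu.l1 t).trans_lt ENNReal.ofReal_lt_top⟩

lemma CompLim.fl_int (hu : CompLim A C v u) (c : ℝ) {l : ℝ} (hl : l ∈ Ioo (0:ℝ) 1) (T : ℝ) :
    IntegrableOn (fun p : ℝ × ℝ => fracLap c l (fun y => u y p.2) p.1) (univ ×ˢ Ioo (0:ℝ) T) :=
  intOn_QT (fl_measurable2 hu.meas c l)
    (B := ‖c‖ₑ * (2 * ENNReal.ofReal C * HK l))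
    (ENNReal.mul_ne_top (by simp) (ENNReal.mul_ne_top (ENNReal.mul_ne_top (by simp) (by simp)) (HK_lt_top hl).ne))
    (fun t => (hu.nice t).fl_l1 c l) T

lemma CompLim.bvQT (hC : 0 ≤ C) (hu : CompLim A C v u) {T : ℝ} (hT : 0 < T) : BoundedVarQT T u := by
  refine ⟨C * T, fun h => ?_, fun s hs => ?_⟩
  · apply le_of_enorm_le (by positivity)
    calc _ ≤ ∫⁻ t in Ioo 0 T, ‖∫ x : ℝ, |u (x + h) t - u x t|‖ₑ := enorm_integral_le_lintegral_enorm _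
      _ ≤ ∫⁻ t in Ioo 0 T, ENNReal.ofReal (|h| * C) := by
          apply lintegral_mono
          intro t
          refine (enorm_integral_le_lintegral_enorm _).trans ?_
          simp only [Real.enorm_abs]
          rw [ENNReal.ofReal_mul (abs_nonneg _)]
          refine (bv_shift (hu.tv' t) h).trans ?_
          gcongr; exact hu.tv t
      _ = ENNReal.ofReal (C * T * |h|) := by
          rw [setLIntegral_const, Real.volume_Ioo, ← ENNReal.ofReal_mul (by positivity)]
          congr 1; ring
  · have hs0 := hs.1
    apply le_of_enorm_le (by positivity)
    have hm : Measurable fun p : ℝ × ℝ => ‖u p.1 (p.2 + s) - u p.1 p.2‖ₑ :=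
      ((hu.meas.comp (f := fun p : ℝ × ℝ => (p.1, p.2 + s)) (by fun_prop)).sub hu.meas).enorm
    calc _ ≤ ∫⁻ x : ℝ, ‖∫ t in Ioo (0:ℝ) (T - s), |u x (t + s) - u x t|‖ₑ := enorm_integral_le_lintegral_enorm _
      _ ≤ ∫⁻ x : ℝ, ∫⁻ t in Ioo (0:ℝ) (T - s), ‖u x (t + s) - u x t‖ₑ := by
          apply lintegral_mono
          intro x
          refine (enorm_integral_le_lintegral_enorm _).trans ?_
          simp only [Real.enorm_abs]; exact le_rfl
      _ = ∫⁻ t in Ioo (0:ℝ) (T - s), ∫⁻ x : ℝ, ‖u x (t + s) - u x t‖ₑ :=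
          lintegral_lintegral_swap hm.aemeasurable
      _ ≤ ∫⁻ t in Ioo (0:ℝ) (T - s), ENNReal.ofReal (C * s) := by
          apply lintegral_mono
          intro t
          refine (hu.time (t + s) t).trans ?_
          rw [add_sub_cancel_left, abs_of_pos hs0]
      _ = ENNReal.ofReal (C * s * (T - s)) := by
          rw [setLIntegral_const, Real.volume_Ioo, ← ENNReal.ofReal_mul (by positivity), sub_zero]
      _ ≤ _ := by
          apply ENNReal.ofReal_le_ofReal
          have : C * s * (T - s) ≤ C * s * T := by gcongr; linarith
          linarith

lemma CompLim.holder (hC : 0 ≤ C) (hu : CompLim A C v u) {Ma : ℝ} (hMa : 0 ≤ Ma)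
    (hA : ∀ x y, |A x - A y| ≤ Ma * |x - y|) :
    ∃ cA : ℝ, ∀ x t y s, |A (u x t) - A (u y s)| ≤ cA * (|x - y| + Real.sqrt |t - s|) := by
  set L := 2 * C + 1 with hL
  have hL0 : 0 < L := by positivity
  have key : ∀ y t s, |A (u y t) - A (u y s)| ≤ Real.sqrt (4 * L * (Ma * C)) * Real.sqrt |t - s| := by
    intro y t s
    set D := |A (u y t) - A (u y s)| with hD
    have hD0 : 0 ≤ D := abs_nonneg _
    rw [← Real.sqrt_mul (by positivity)]
    apply Real.le_sqrt_of_sq_le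
    set I := Icc y (y + D / (2 * L)) with hI
    have h1 : ENNReal.ofReal (D / 2) * volume I ≤ ∫⁻ z in I, ‖A (u z t) - A (u z s)‖ₑ := by
      rw [← setLIntegral_const]
      apply setLIntegral_mono' measurableSet_Icc
      intro z hz
      rw [← ofReal_norm]
      apply ENNReal.ofReal_le_ofReal
      have a1 := hu.lip t y z
      have a2 := hu.lip s y z
      have hyz : |y - z| ≤ D / (2 * L) := by
        rw [abs_le]; constructor <;> linarith [hz.1, hz.2]
      have a3 : D ≤ |A (u y t) - A (u z t)| + |A (u z t) - A (u z s)| + |A (u y s) - A (u z s)| := by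
        rw [hD, abs_sub_comm (A (u y s))]
        have e : A (u y t) - A (u y s) = (A (u y t) - A (u z t)) + (A (u z t) - A (u z s)) + (A (u z s) - A (u y s)) := by ring
        rw [e]
        exact (abs_add_le _ _).trans (add_le_add_left (abs_add_le _ _) _)
      have a4 : 2 * C * |y - z| ≤ D / 2 := by
        calc 2 * C * |y - z| ≤ L * (D / (2 * L)) := by
              apply mul_le_mul _ hyz (abs_nonneg _) hL0.le
              rw [hL]; linarith
          _ = D / 2 := by field_simp
      rw [Real.norm_eq_abs]
      linarith
    have h2 : ∫⁻ z in I, ‖A (u z t) - A (u z s)‖ₑ ≤ ENNReal.ofReal (Ma * (C * |t - s|)) := by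
      calc _ ≤ ∫⁻ z, ‖A (u z t) - A (u z s)‖ₑ := setLIntegral_le_lintegral _ _
        _ ≤ ∫⁻ z, ENNReal.ofReal Ma * ‖u z t - u z s‖ₑ := by
            apply lintegral_mono
            intro z
            simp only
            rw [← ofReal_norm, ← ofReal_norm, ← ENNReal.ofReal_mul hMa]
            exact ENNReal.ofReal_le_ofReal (hA _ _)
        _ = ENNReal.ofReal Ma * ∫⁻ z, ‖u z t - u z s‖ₑ := lintegral_const_mul' _ _ (by simp)
        _ ≤ _ := by
            rw [ENNReal.ofReal_mul hMa]; gcongr; exact hu.time t s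
    have h3 := h1.trans h2
    rw [hI, Real.volume_Icc, ← ENNReal.ofReal_mul (by positivity), ENNReal.ofReal_le_ofReal_iff (by positivity)] at h3
    have e : D / 2 * (y + D / (2 * L) - y) = D ^ 2 / (4 * L) := by field_simp; ring
    rw [e, div_le_iff₀ (by positivity)] at h3
    calc D ^ 2 ≤ _ := h3
      _ = _ := by ring
  refine ⟨C + Real.sqrt (4 * L * (Ma * C)), fun x t y s => ?_⟩
  have h1 := hu.lip t x y
  have h2 := key y t s
  have h3 := abs_sub_le (A (u x t)) (A (u y t)) (A (u y s))
  have p1 : 0 ≤ C * Real.sqrt |t - s| := by positivity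
  have p2 : 0 ≤ Real.sqrt (4 * L * (Ma * C)) * |x - y| := by positivity
  nlinarith

end DDG

namespace DDG
open MeasureTheory Filter Set
open scoped ENNReal Topology

noncomputable def vW (D τ : ℝ) (W : ℕ → ℤ → ℝ) (x t : ℝ) : ℝ := W (⌊t / τ⌋.toNat) ⌊x / D⌋

lemma vW_meas (D τ : ℝ) (W : ℕ → ℤ → ℝ) : Measurable fun p : ℝ × ℝ => vW D τ W p.1 p.2 := by
  have h1 : Measurable fun q : ℤ × ℤ => W q.2.toNat q.1 := Measurable.of_discrete
  exact h1.comp (((measurable_floor_div D).comp measurable_fst).prodMk ((measurable_floor_div τ).comp measurable_snd))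

lemma toNat_floor_le {τ : ℝ} (hτ : 0 < τ) (t s : ℝ) :
    |((⌊t / τ⌋.toNat : ℕ) : ℝ) - (⌊s / τ⌋.toNat : ℕ)| * τ ≤ |t - s| + τ := by
  wlog hts : s ≤ t generalizing t s
  · have := this s t (le_of_not_ge hts)
    rwa [abs_sub_comm, abs_sub_comm t s]
  have hm : ⌊s / τ⌋ ≤ ⌊t / τ⌋ := Int.floor_mono (by gcongr)
  have h1 : (⌊t / τ⌋.toNat : ℤ) - (⌊s / τ⌋.toNat : ℤ) ≤ ⌊t / τ⌋ - ⌊s / τ⌋ := by omega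
  have h2 : (0:ℤ) ≤ (⌊t / τ⌋.toNat : ℤ) - (⌊s / τ⌋.toNat : ℤ) := by omega
  have h1' : ((⌊t / τ⌋.toNat : ℕ) : ℝ) - (⌊s / τ⌋.toNat : ℕ) ≤ (⌊t / τ⌋ : ℝ) - ⌊s / τ⌋ := by exact_mod_cast h1
  have h2' : (0:ℝ) ≤ ((⌊t / τ⌋.toNat : ℕ) : ℝ) - (⌊s / τ⌋.toNat : ℕ) := by exact_mod_cast h2
  rw [abs_of_nonneg h2', abs_of_nonneg (sub_nonneg.2 hts)]
  have f1 := Int.floor_le (t / τ)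
  have f2 := Int.lt_floor_add_one (s / τ)
  have e1 : t / τ * τ = t := div_mul_cancel₀ _ hτ.ne'
  have e2 : s / τ * τ = s := div_mul_cancel₀ _ hτ.ne'
  calc _ ≤ (t / τ - s / τ + 1) * τ := by
        apply mul_le_mul_of_nonneg_right _ hτ.le
        linarith
    _ = t - s + τ := by rw [add_mul, sub_mul, e1, e2, one_mul]

lemma floor_diff_le {τ : ℝ} (hτ : 0 < τ) (t s : ℝ) :
    |((⌊t / τ⌋ : ℤ) : ℝ) - (⌊s / τ⌋ : ℤ)| * τ ≤ |t - s| + τ := by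
  wlog hts : s ≤ t generalizing t s
  · have := this s t (le_of_not_ge hts)
    rwa [abs_sub_comm, abs_sub_comm t s]
  have hm : ⌊s / τ⌋ ≤ ⌊t / τ⌋ := Int.floor_mono (by gcongr)
  have h2' : (0:ℝ) ≤ ((⌊t / τ⌋ : ℤ) : ℝ) - (⌊s / τ⌋ : ℤ) := by
    have : ((⌊s / τ⌋ : ℤ) : ℝ) ≤ ⌊t / τ⌋ := by exact_mod_cast hm
    linarith
  rw [abs_of_nonneg h2', abs_of_nonneg (sub_nonneg.2 hts)]
  have f1 := Int.floor_le (t / τ)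
  have f2 := Int.lt_floor_add_one (s / τ)
  have e1 : t / τ * τ = t := div_mul_cancel₀ _ hτ.ne'
  have e2 : s / τ * τ = s := div_mul_cancel₀ _ hτ.ne'
  calc _ ≤ (t / τ - s / τ + 1) * τ := by
        apply mul_le_mul_of_nonneg_right _ hτ.le
        linarith
    _ = t - s + τ := by rw [add_mul, sub_mul, e1, e2, one_mul]

lemma chain_nat {E : ℝ} {g : ℕ → ℝ} (h : ∀ n, |g (n + 1) - g n| ≤ E) (n k : ℕ) :
    |g (n + k) - g n| ≤ k * E := by
  induction k with
  | zero => simp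
  | succ k ih =>
    have := h (n + k)
    have h3 := abs_sub_le (g (n + (k + 1))) (g (n + k)) (g n)
    rw [← add_assoc] at h3 ⊢
    push_cast
    linarith

lemma chain_int {E : ℝ} {g : ℤ → ℝ} (h : ∀ n, |g (n + 1) - g n| ≤ E) (i k : ℤ) :
    |g i - g k| ≤ |(i:ℝ) - k| * E := by
  wlog hik : k ≤ i generalizing i k
  · have := this k i (le_of_not_ge hik)
    rwa [abs_sub_comm, abs_sub_comm (i:ℝ)]
  obtain ⟨m, rfl⟩ := Int.le.dest hik
  have := chain_nat (g := fun n : ℕ => g (k + n)) (E := E) (fun n => by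
    have := h (k + n); simpa [add_assoc] using this) 0 m
  simpa using this

lemma chain_enorm {W : ℕ → ℤ → ℝ} {E : ℝ≥0∞} (h : ∀ n, ∑' i, ‖W (n + 1) i - W n i‖ₑ ≤ E) (n k : ℕ) :
    ∑' i, ‖W (n + k) i - W n i‖ₑ ≤ k * E := by
  induction k with
  | zero => simp
  | succ k ih =>
    calc _ ≤ ∑' i, (‖W (n + k + 1) i - W (n + k) i‖ₑ + ‖W (n + k) i - W n i‖ₑ) := by
          refine ENNReal.tsum_le_tsum fun i => ?_
          have e : W (n + (k + 1)) i - W n i = (W (n + k + 1) i - W (n + k) i) + (W (n + k) i - W n i) := by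
            rw [← add_assoc]; ring
          rw [e]; exact enorm_add_le _ _
      _ ≤ E + k * E := by rw [ENNReal.tsum_add]; exact add_le_add (h _) ih
      _ = _ := by push_cast; ring

lemma chain_enorm' {W : ℕ → ℤ → ℝ} {E : ℝ≥0∞} (h : ∀ n, ∑' i, ‖W (n + 1) i - W n i‖ₑ ≤ E) (n m : ℕ) :
    ∑' i, ‖W n i - W m i‖ₑ ≤ ENNReal.ofReal |(n:ℝ) - m| * E := by
  rcases le_total m n with hnm | hnm
  · obtain ⟨k, rfl⟩ := Nat.exists_eq_add_of_le hnm
    have := chain_enorm h m k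
    simpa using this
  · obtain ⟨k, rfl⟩ := Nat.exists_eq_add_of_le hnm
    have := chain_enorm h n k
    simp_rw [enorm_sub_rev (W n _)]
    rw [abs_sub_comm]
    simpa using this

structure DB (A : ℝ → ℝ) (C e : ℝ) (v : ℝ → ℝ → ℝ) : Prop where
  meas : Measurable fun p : ℝ × ℝ => v p.1 p.2
  l1 : ∀ t, ∫⁻ x, ‖v x t‖ₑ ≤ ENNReal.ofReal C
  tv : ∀ t, eVariationOn (fun x => v x t) univ ≤ ENNReal.ofReal C
  bd : ∀ x t, |v x t| ≤ C
  time : ∀ t s, ∫⁻ x, ‖v x t - v x s‖ₑ ≤ ENNReal.ofReal (C * (|t - s| + e))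
  lip : ∀ t x y, |A (v x t) - A (v y t)| ≤ C * (|x - y| + e)

lemma disc_bounds {c l b : ℝ} {f a : ℝ → ℝ} {fh : ℝ → ℝ → ℝ} {u₀ : ℝ → ℝ} (hl : l ∈ Ioo (0:ℝ) 1)
    (data : SchemeData f a fh) {C : ℝ} (hC : 0 ≤ C) :
    ∃ C', C ≤ C' ∧ ∀ D τ V, Hyp c l D τ b f a fh → InitOK c l D τ b a fh u₀ C V →
      DB (Aint a) C' (D + τ) (vW D τ (itr c l D τ b fh a V)) := by
  obtain ⟨K, hK0, hK⟩ := fh_lip data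
  set C3 := (‖c‖ₑ * (2 * ENNReal.ofReal C * HK l)).toReal with hC3
  have hC3t : ‖c‖ₑ * (2 * ENNReal.ofReal C * HK l) ≠ ⊤ :=
    ENNReal.mul_ne_top (by simp) (ENNReal.mul_ne_top (ENNReal.mul_ne_top (by simp) (by simp)) (HK_lt_top hl).ne)
  have hC30 : 0 ≤ C3 := ENNReal.toReal_nonneg
  refine ⟨max C (2 * K * C + C + b * C3), le_max_left _ _, fun D τ V H I => ?_⟩
  have hD := H.hD
  have hτ := H.hτ
  have hb := H.hb
  set C' := max C (2 * K * C + C + b * C3) with hC'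
  have hCC : ENNReal.ofReal C ≤ ENNReal.ofReal C' := ENNReal.ofReal_le_ofReal (le_max_left _ _)
  have hC'0 : 0 ≤ C' := hC.trans (le_max_left _ _)
  set W := itr c l D τ b fh a V with hW
  have hsm : ∀ n, Summable (W n) := fun n => H.itr_summable I.sm n
  have hl1 : ∀ n, ENNReal.ofReal D * ∑' i, ‖W n i‖ₑ ≤ ENNReal.ofReal C := fun n =>
    le_trans (mul_le_mul_right (H.itr_l1 I.sm n) _) I.l1
  have htv : ∀ n, ∑' k, edist (W n (k + 1)) (W n k) ≤ ENNReal.ofReal C := fun n =>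
    (H.itr_tv I.sm n).trans I.tv
  have hbd : ∀ n i, |W n i| ≤ C := by
    intro n i
    have := (enorm_le_tv (hsm n) i).trans (htv n)
    rwa [← ofReal_norm, ENNReal.ofReal_le_ofReal_iff hC] at this
  have htm : ∀ n, ∑' i, ‖W (n + 1) i - W n i‖ₑ ≤ ∑' i, ‖schemeStep c l D τ b fh a V i - V i‖ₑ :=
    fun n => H.itr_time I.sm n
  have hNL : ∀ n, ∑' i, ‖NL c l D (W n) i‖ₑ ≤ ENNReal.ofReal C3 := by
    intro n
    rw [hC3, ENNReal.ofReal_toReal hC3t]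
    exact NL_bound hD (by simp) (hl1 n) (htv n)
  have hlip : ∀ n i, |Aint a (W n (i + 1)) - Aint a (W n i)| ≤ D * C' := by
    intro n i
    have h1 : ENNReal.ofReal D * ∑' i, ‖schemeStep c l D τ b fh a (W n) i - W n i‖ₑ ≤ ENNReal.ofReal (C * τ) :=
      le_trans (mul_le_mul_right (htm n) _) I.tm
    refine (H.A_lipD (hsm n) hK0 hK (hbd n) hC hC30 h1 (hNL n) i).trans ?_
    gcongr
    exact le_max_right _ _
  refine ⟨vW_meas _ _ _, fun t => ?_, fun t => ?_, fun x t => (hbd _ _).trans (le_max_left _ _), fun t s => ?_, fun t x y => ?_⟩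
  · exact (lintegral_pc hD (W _)).trans_le ((hl1 _).trans hCC)
  · exact (evar_pc_le hD (W _)).trans ((htv _).trans hCC)
  · have e := lintegral_pc hD (fun i => W ⌊t / τ⌋.toNat i - W ⌊s / τ⌋.toNat i)
    refine le_trans (le_of_eq e) ?_
    have h1 := chain_enorm' htm ⌊t / τ⌋.toNat ⌊s / τ⌋.toNat
    have h2 := toNat_floor_le hτ t s
    set q := |((⌊t / τ⌋.toNat : ℕ) : ℝ) - (⌊s / τ⌋.toNat : ℕ)| with hq
    calc _ ≤ ENNReal.ofReal D * (ENNReal.ofReal q * ∑' i, ‖schemeStep c l D τ b fh a V i - V i‖ₑ) := by gcongr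
      _ = ENNReal.ofReal q * (ENNReal.ofReal D * ∑' i, ‖schemeStep c l D τ b fh a V i - V i‖ₑ) := by ring
      _ ≤ ENNReal.ofReal q * ENNReal.ofReal (C * τ) := by gcongr; exact I.tm
      _ = ENNReal.ofReal (q * (C * τ)) := by rw [ENNReal.ofReal_mul (abs_nonneg _)]
      _ ≤ _ := by
          apply ENNReal.ofReal_le_ofReal
          calc q * (C * τ) = C * (q * τ) := by ring
            _ ≤ C' * (|t - s| + (D + τ)) := by
              apply mul_le_mul (le_max_left _ _) _ (by positivity) hC'0
              linarith
  · have h1 := chain_int (g := fun i => Aint a (W ⌊t / τ⌋.toNat i)) (hlip _) ⌊x / D⌋ ⌊y / D⌋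
    have h2 := floor_diff_le hD x y
    refine h1.trans ?_
    calc _ = C' * (|((⌊x / D⌋ : ℤ) : ℝ) - (⌊y / D⌋ : ℤ)| * D) := by ring
      _ ≤ _ := by gcongr; linarith

end DDG

namespace DDG
open MeasureTheory Filter Set
open scoped ENNReal Topology

def Bx (R : ℝ) : Set (ℝ × ℝ) := Icc (-R) R ×ˢ Icc (-R) R

lemma Bx_meas (R : ℝ) : MeasurableSet (Bx R) := measurableSet_Icc.prod measurableSet_Icc

lemma Bx_vol (R : ℝ) : volume (Bx R) < ⊤ := by
  unfold Bx
  rw [Measure.volume_eq_prod, Measure.prod_prod]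
  exact ENNReal.mul_lt_top (by simp) (by simp)

/-- bounded measurable function with support in a box -/
structure BS (G : ℝ × ℝ → ℝ) (K R : ℝ) : Prop where
  meas : Measurable G
  bd : ∀ p, |G p| ≤ K
  supp : ∀ p, p ∉ Bx R → G p = 0

lemma BS.K0 {G : ℝ × ℝ → ℝ} {K R : ℝ} (h : BS G K R) : 0 ≤ K := (abs_nonneg _).trans (h.bd 0)

lemma BS.int {G F : ℝ × ℝ → ℝ} {K R K' : ℝ} (h : BS G K R) (hF : Measurable F) (hFb : ∀ p, |F p| ≤ K') :
    Integrable (fun p => G p * F p) := by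
  have h1 : IntegrableOn (fun p => G p * F p) (Bx R) := by
    refine Measure.integrableOn_of_bounded (M := K * K') (Bx_vol R).ne (h.meas.mul hF).aestronglyMeasurable ?_
    refine Eventually.of_forall fun p => ?_
    rw [norm_mul]
    exact mul_le_mul (h.bd p) (hFb p) (abs_nonneg _) h.K0
  rwa [integrableOn_iff_integrable_of_support_subset] at h1
  intro p hp
  by_contra hc
  exact hp (by simp [h.supp p hc])

lemma BS.shift {G : ℝ × ℝ → ℝ} {K R : ℝ} (h : BS G K R) (e : ℝ × ℝ) (he1 : |e.1| ≤ 1) (he2 : |e.2| ≤ 1) :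
    BS (fun p => G (p - e)) K (R + 1) := by
  refine ⟨h.meas.comp (by fun_prop), fun p => h.bd _, fun p hp => h.supp _ fun hc => hp ?_⟩
  have h1 := hc.1
  have h2 := hc.2
  rw [abs_le] at he1 he2
  simp only [Prod.fst_sub, Prod.snd_sub, mem_Icc] at h1 h2
  exact ⟨⟨by linarith [h1.1], by linarith [h1.2]⟩, ⟨by linarith [h2.1], by linarith [h2.2]⟩⟩

lemma integral_shift2 (G F : ℝ × ℝ → ℝ) (e : ℝ × ℝ) :
    ∫ p, G p * F (p + e) = ∫ p, G (p - e) * F p := by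
  rw [← integral_add_right_eq_self (fun p => G (p - e) * F p) e]
  simp

lemma BS.mul {G F : ℝ × ℝ → ℝ} {K R : ℝ} (h : BS G K R) (hF : Measurable F) (hFb : ∀ p, |F p| ≤ 1) :
    BS (fun p => G p * F p) K R := by
  refine ⟨h.meas.mul hF, fun p => ?_, fun p hp => by simp [h.supp p hp]⟩
  rw [abs_mul, ← mul_one K]
  exact mul_le_mul (h.bd p) (hFb p) (abs_nonneg _) h.K0

lemma BS.int1 {G F : ℝ × ℝ → ℝ} {K R : ℝ} (h : BS G K R) (hF : Measurable F) {B : ℝ≥0∞} (hB : B ≠ ⊤)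
    (hFb : ∀ t, ∫⁻ x, ‖F (x, t)‖ₑ ≤ B) : Integrable (fun p => G p * F p) := by
  have h0 : IntegrableOn F (univ ×ˢ Icc (-R) R) := by
    refine ⟨hF.aestronglyMeasurable, ?_⟩
    rw [hasFiniteIntegral_def, lintegral_QT hF.enorm]
    calc _ ≤ ∫⁻ t in Icc (-R) R, B := lintegral_mono fun t => hFb t
      _ = B * volume (Icc (-R) R) := by rw [setLIntegral_const]
      _ < ⊤ := ENNReal.mul_lt_top hB.lt_top (by simp)
  have h1 : IntegrableOn (fun p => G p * F p) (univ ×ˢ Icc (-R) R) :=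
    h0.bdd_mul (c := K) h.meas.aestronglyMeasurable (Eventually.of_forall fun p => h.bd p)
  rwa [integrableOn_iff_integrable_of_support_subset] at h1
  intro p hp
  by_contra hc
  exact hp (by simp [h.supp p fun hb => hc ⟨mem_univ _, hb.2⟩])

lemma cell_avg {D : ℝ} (hD : 0 < D) {k : ℤ → ℝ} {w : ℝ → ℝ}
    (h1 : Integrable fun x => k ⌊x / D⌋ * w x)
    (h2 : Integrable fun x => k ⌊x / D⌋ * ((∫ y in cell D ⌊x / D⌋, w y) / D)) :
    ∫ x, k ⌊x / D⌋ * ((∫ y in cell D ⌊x / D⌋, w y) / D) = ∫ x, k ⌊x / D⌋ * w x := by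
  have s1 := hasSum_integral_iUnion (μ := volume) (s := cell D) (fun i => measurableSet_Ico) (cells_disj hD)
    h1.integrableOn
  have s2 := hasSum_integral_iUnion (μ := volume) (s := cell D) (fun i => measurableSet_Ico) (cells_disj hD)
    h2.integrableOn
  rw [cells_union hD, setIntegral_univ] at s1 s2
  refine s2.unique ?_
  have : (fun i => ∫ x in cell D i, k ⌊x / D⌋ * w x) =
      fun i => ∫ x in cell D i, k ⌊x / D⌋ * ((∫ y in cell D ⌊x / D⌋, w y) / D) := by
    funext i
    have e1 : ∫ x in cell D i, k ⌊x / D⌋ * w x = ∫ x in cell D i, k i * w x :=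
      setIntegral_congr_fun measurableSet_Ico (fun x hx => by rw [(mem_cell_iff hD x i).1 hx])
    have e2 : ∫ x in cell D i, k ⌊x / D⌋ * ((∫ y in cell D ⌊x / D⌋, w y) / D) =
        ∫ x in cell D i, k i * ((∫ y in cell D i, w y) / D) :=
      setIntegral_congr_fun measurableSet_Ico (fun x hx => by rw [(mem_cell_iff hD x i).1 hx])
    rw [e1, e2, integral_const_mul, setIntegral_const]
    have : volume.real (Ico ((i:ℝ) * D) (((i:ℝ) + 1) * D)) = D := by
      rw [Measure.real, Real.volume_Ico, ENNReal.toReal_ofReal]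
      · ring
      · nlinarith
    rw [this, smul_eq_mul]
    field_simp
  rw [← this]
  exact s1

lemma vW_shiftx {D : ℝ} (hD : 0 < D) (τ : ℝ) (F : ℕ → ℤ → ℝ) (x t : ℝ) :
    vW D τ F (x + D) t = vW D τ (fun n i => F n (i + 1)) x t := by
  unfold vW
  rw [add_div, div_self hD.ne', Int.floor_add_one]

lemma vW_shiftx' {D : ℝ} (hD : 0 < D) (τ : ℝ) (F : ℕ → ℤ → ℝ) (x t : ℝ) :
    vW D τ F (x + -D) t = vW D τ (fun n i => F n (i - 1)) x t := by
  unfold vW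
  rw [add_div, neg_div, div_self hD.ne', ← sub_eq_add_neg, Int.floor_sub_one]

lemma vW_shiftt {τ : ℝ} (hτ : 0 < τ) (D : ℝ) (F : ℕ → ℤ → ℝ) (x : ℝ) {t : ℝ} (ht : 0 ≤ t) :
    vW D τ F x (t + τ) = vW D τ (fun n i => F (n + 1) i) x t := by
  unfold vW
  rw [add_div, div_self hτ.ne', Int.floor_add_one, Int.toNat_add (Int.floor_nonneg.2 (by positivity)) (by norm_num)]
  rfl

lemma Qf_bd {fh : ℝ → ℝ → ℝ} {K : ℝ}
    (hK : ∀ u v u' v', |fh u v - fh u' v'| ≤ K * (|u - u'| + |v - v'|)) (κ u v : ℝ) :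
    |Qf fh κ u v| ≤ K * (|u - κ| + |v - κ|) := by
  refine (hK _ _ _ _).trans (le_of_eq ?_)
  rw [abs_of_nonneg (sub_nonneg.2 min_le_max), abs_of_nonneg (sub_nonneg.2 min_le_max),
    max_sub_min_eq_abs', max_sub_min_eq_abs']

lemma comb_sub {f1 f2 : ℝ × ℝ → ℝ} (h1 : Integrable f1) (h2 : Integrable f2) (τ : ℝ) :
    ∫ p, (f1 p - f2 p) / τ = ((∫ p, f1 p) - ∫ p, f2 p) / τ := by
  rw [integral_div, integral_sub h1 h2]

lemma comb_three {f1 f2 f3 : ℝ × ℝ → ℝ} (h1 : Integrable f1) (h2 : Integrable f2) (h3 : Integrable f3) (τ : ℝ) :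
    ∫ p, (f1 p - 2 * f2 p + f3 p) / τ = ((∫ p, f1 p) - 2 * (∫ p, f2 p) + ∫ p, f3 p) / τ := by
  have e : Integrable fun p => 2 * f2 p := h2.const_mul 2
  have e' : Integrable fun p => f1 p - 2 * f2 p := h1.sub e
  rw [integral_div, integral_add e' h3, integral_sub h1 e, integral_const_mul]

lemma comb_add4 {f1 f2 f3 f4 : ℝ × ℝ → ℝ} (h1 : Integrable f1) (h2 : Integrable f2) (h3 : Integrable f3)
    (h4 : Integrable f4) :
    ∫ p, (f1 p + f2 p + f3 p + f4 p) = (∫ p, f1 p) + (∫ p, f2 p) + (∫ p, f3 p) + ∫ p, f4 p := by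
  have e : Integrable fun p => f1 p + f2 p := h1.add h2
  have e' : Integrable fun p => f1 p + f2 p + f3 p := e.add h3
  rw [integral_add e' h4, integral_add e h3, integral_add h1 h2]

lemma comb_all {f1 f2 f3 f4 f5 f6 f7 f8 : ℝ × ℝ → ℝ} (h1 : Integrable f1) (h2 : Integrable f2)
    (h3 : Integrable f3) (h4 : Integrable f4) (h5 : Integrable f5) (h6 : Integrable f6) (h7 : Integrable f7)
    (h8 : Integrable f8) {τ D D' b : ℝ} :
    ∫ p, ((f1 p - f2 p) / τ + (f3 p - f4 p) / D + (f5 p - 2 * f6 p + f7 p) / D' + b * f8 p) =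
      ((∫ p, f1 p) - ∫ p, f2 p) / τ + ((∫ p, f3 p) - ∫ p, f4 p) / D +
      ((∫ p, f5 p) - 2 * (∫ p, f6 p) + ∫ p, f7 p) / D' + b * ∫ p, f8 p := by
  have e1 : Integrable fun p => (f1 p - f2 p) / τ := (h1.sub h2).div_const τ
  have e2 : Integrable fun p => (f3 p - f4 p) / D := (h3.sub h4).div_const D
  have e3 : Integrable fun p => (f5 p - 2 * f6 p + f7 p) / D' := ((h5.sub (h6.const_mul 2)).add h7).div_const D'
  rw [comb_add4 e1 e2 e3 (h8.const_mul b), comb_sub h1 h2, comb_sub h3 h4, comb_three h5 h6 h7,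
    integral_const_mul]

/-- discrete entropy inequality in integrated form -/
lemma disc_entropy {c l D τ b : ℝ} {f a : ℝ → ℝ} {fh : ℝ → ℝ → ℝ} (H : Hyp c l D τ b f a fh)
    {W : ℕ → ℤ → ℝ} (hsm : ∀ n, Summable (W n)) (hstep : ∀ n, W (n + 1) = schemeStep c l D τ b fh a (W n))
    {C e : ℝ} (db : DB (Aint a) C e (vW D τ W)) (hD1 : D ≤ 1) (hτ1 : τ ≤ 1) (κ : ℝ)
    {G : ℝ × ℝ → ℝ} {K R : ℝ} (hG : BS G K R) (hG0 : ∀ p, 0 ≤ G p) (hGt : ∀ p : ℝ × ℝ, p.2 < 0 → G p = 0)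
    {k : ℤ → ℝ → ℝ} (hGk : ∀ p, G p = k ⌊p.1 / D⌋ p.2) :
    0 ≤ (∫ p : ℝ × ℝ, (G p - G (p - (0, τ))) / τ * |vW D τ W p.1 p.2 - κ|)
      + (∫ p : ℝ × ℝ, (G (p + (D, 0)) - G p) / D * Qf fh κ (vW D τ W p.1 p.2) (vW D τ W (p.1 + D) p.2))
      + (∫ p : ℝ × ℝ, (G (p + (D, 0)) - 2 * G p + G (p - (D, 0))) / D ^ 2 *
          |Aint a (vW D τ W p.1 p.2) - Aint a κ|)
      + b * ∫ p : ℝ × ℝ, G p * Real.sign (vW D τ W p.1 (p.2 + τ) - κ) *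
          fracLap c l (fun y => vW D τ W y p.2) p.1 := by
  have hD := H.hD
  have hτ := H.hτ
  obtain ⟨K1, hK10, hK1⟩ := fh_lip H.data
  obtain ⟨Ma, hMa0, hMa⟩ := a_bdd H.data
  have hC : 0 ≤ C := (abs_nonneg _).trans (db.bd 0 0)
  have hbd : ∀ x t, |vW D τ W x t - κ| ≤ C + |κ| := fun x t =>
    (abs_sub _ _).trans (add_le_add_left (db.bd x t) _)
  set E1 : ℕ → ℤ → ℝ := fun n i => |W n i - κ| with hE1
  set Q : ℕ → ℤ → ℝ := fun n i => Qf fh κ (W n i) (W n (i + 1)) with hQ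
  set B : ℕ → ℤ → ℝ := fun n i => |Aint a (W n i) - Aint a κ| with hB
  set S : ℕ → ℤ → ℝ := fun n i => Real.sign (W n i - κ) with hS
  set N : ℕ → ℤ → ℝ := fun n i => NL c l D (W n) i / D with hN
  have mV : ∀ F : ℕ → ℤ → ℝ, Measurable fun p : ℝ × ℝ => vW D τ F p.1 p.2 := fun F => vW_meas D τ F
  have mVe : ∀ (F : ℕ → ℤ → ℝ) (e : ℝ × ℝ), Measurable fun p : ℝ × ℝ => vW D τ F (p + e).1 (p + e).2 :=
    fun F e => (vW_meas D τ F).comp (f := fun p : ℝ × ℝ => p + e) (by fun_prop)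
  have bE : ∀ x t, |vW D τ E1 x t| ≤ C + |κ| := fun x t => by
    have := hbd x t; simpa [vW, hE1, abs_abs] using this
  have bQ : ∀ x t, |vW D τ Q x t| ≤ K1 * ((C + |κ|) + (C + |κ|)) := fun x t => by
    have h1 := hbd x t
    have h2 := hbd (x + D) t
    rw [vW_shiftx hD] at h2
    refine (Qf_bd hK1 κ _ _).trans ?_
    gcongr
    · exact h1
    · exact h2
  have bB : ∀ x t, |vW D τ B x t| ≤ Ma * (C + |κ|) := fun x t => by
    have h1 := hbd x t
    have e : |vW D τ B x t| = |Aint a (vW D τ W x t) - Aint a κ| := by simp [vW, hB]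
    rw [e]
    refine (A_lip H.data hMa _ _).trans ?_
    gcongr
  have bS : ∀ x t, |vW D τ S x t| ≤ 1 := fun x t => abs_sign_le _
  have hnice : ∀ t, Nice (fun x => vW D τ W x t) (2 * ENNReal.ofReal C) := fun t =>
    nice_of_bv ENNReal.ofReal_ne_top (db.l1 t) (db.tv t)
  set C3 := (‖c‖ₑ * (2 * ENNReal.ofReal C * HK l)).toReal with hC3
  have hC3t : ‖c‖ₑ * (2 * ENNReal.ofReal C * HK l) ≠ ⊤ :=
    ENNReal.mul_ne_top (by simp) (ENNReal.mul_ne_top (ENNReal.mul_ne_top (by simp) (by simp)) (HK_lt_top H.hl).ne)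
  have hC30 : 0 ≤ C3 := ENNReal.toReal_nonneg
  have bN : ∀ x t, |vW D τ N x t| ≤ C3 / D := fun x t => by
    have h1 : ‖NL c l D (W ⌊t / τ⌋.toNat) ⌊x / D⌋‖ₑ ≤ ENNReal.ofReal C3 := by
      rw [hC3, ENNReal.ofReal_toReal hC3t]
      refine (ENNReal.le_tsum (f := fun i => ‖NL c l D (W ⌊t / τ⌋.toNat) i‖ₑ) ⌊x / D⌋).trans ((tsum_NL_le hD).trans ((hnice t).fl_l1 c l))
    rw [← ofReal_norm, ENNReal.ofReal_le_ofReal_iff hC30] at h1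
    have e : |vW D τ N x t| = ‖NL c l D (W ⌊t / τ⌋.toNat) ⌊x / D⌋‖ / D := by
      simp only [vW, hN]; rw [abs_div, abs_of_pos hD, Real.norm_eq_abs]
    rw [e]; gcongr
  -- pointwise inequality
  have pw : ∀ p : ℝ × ℝ, 0 ≤ (G p * vW D τ E1 p.1 p.2 - G p * vW D τ E1 (p + (0, τ)).1 (p + (0, τ)).2) / τ
      + (G p * vW D τ Q (p + (-D, 0)).1 (p + (-D, 0)).2 - G p * vW D τ Q p.1 p.2) / D
      + (G p * vW D τ B (p + (D, 0)).1 (p + (D, 0)).2 - 2 * (G p * vW D τ B p.1 p.2)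
          + G p * vW D τ B (p + (-D, 0)).1 (p + (-D, 0)).2) / D ^ 2
      + b * (G p * vW D τ S (p + (0, τ)).1 (p + (0, τ)).2 * vW D τ N p.1 p.2) := by
    rintro ⟨x, t⟩
    by_cases ht : t < 0
    · simp [hGt (x, t) ht]
    rw [not_lt] at ht
    simp only [Prod.mk_add_mk, add_zero]
    rw [vW_shiftt hτ D E1 x ht, vW_shiftt hτ D S x ht, vW_shiftx hD, vW_shiftx' hD, vW_shiftx' hD]
    unfold vW
    set n := ⌊t / τ⌋.toNat
    set i := ⌊x / D⌋
    have h := H.entropy (hsm n) κ i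
    simp only [hE1, hQ, hB, hS, hN, hstep]
    rw [show i - 1 + 1 = i by ring]
    set s := schemeStep c l D τ b fh a (W n) i
    have h' : 0 ≤ (G (x, t) / τ) * (|W n i - κ|
      - (τ / D) * (Qf fh κ (W n i) (W n (i + 1)) - Qf fh κ (W n (i - 1)) (W n i))
      + (τ / D ^ 2) * (|Aint a (W n (i + 1)) - Aint a κ| - 2 * |Aint a (W n i) - Aint a κ|
          + |Aint a (W n (i - 1)) - Aint a κ|)
      + Real.sign (s - κ) * ((b * τ / D) * NL c l D (W n) i) - |s - κ|) :=
      mul_nonneg (div_nonneg (hG0 _) hτ.le) (by linarith)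
    refine h'.trans (le_of_eq ?_)
    field_simp
    ring
  have i1 := hG.int (mV E1) (fun p => bE _ _)
  have i2 := hG.int (mVe E1 (0, τ)) (fun p => bE _ _)
  have i3 := hG.int (mVe Q (-D, 0)) (fun p => bQ _ _)
  have i4 := hG.int (mV Q) (fun p => bQ _ _)
  have i5 := hG.int (mVe B (D, 0)) (fun p => bB _ _)
  have i6 := hG.int (mV B) (fun p => bB _ _)
  have i7 := hG.int (mVe B (-D, 0)) (fun p => bB _ _)
  have i8 : Integrable (fun p : ℝ × ℝ => G p * vW D τ S (p + (0, τ)).1 (p + (0, τ)).2 * vW D τ N p.1 p.2) := by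
    have := hG.int ((mVe S (0, τ)).mul (mV N)) (K' := 1 * (C3 / D)) (fun p => by
      rw [Pi.mul_apply, abs_mul]
      exact mul_le_mul (bS _ _) (bN _ _) (abs_nonneg _) zero_le_one)
    refine this.congr (Eventually.of_forall fun p => ?_)
    simp [mul_assoc]
  have tot : (0:ℝ) ≤ ∫ p : ℝ × ℝ, ((G p * vW D τ E1 p.1 p.2 - G p * vW D τ E1 (p + (0, τ)).1 (p + (0, τ)).2) / τ
      + (G p * vW D τ Q (p + (-D, 0)).1 (p + (-D, 0)).2 - G p * vW D τ Q p.1 p.2) / D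
      + (G p * vW D τ B (p + (D, 0)).1 (p + (D, 0)).2 - 2 * (G p * vW D τ B p.1 p.2)
          + G p * vW D τ B (p + (-D, 0)).1 (p + (-D, 0)).2) / D ^ 2
      + b * (G p * vW D τ S (p + (0, τ)).1 (p + (0, τ)).2 * vW D τ N p.1 p.2)) :=
    integral_nonneg fun p => pw p
  rw [comb_all i1 i2 i3 i4 i5 i6 i7 i8] at tot
  have sD : |D| ≤ 1 := by rw [abs_of_pos hD]; exact hD1
  have sτ : |τ| ≤ 1 := by rw [abs_of_pos hτ]; exact hτ1
  have g1 := hG.shift (0, τ) (by simp) (by simpa using sτ)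
  have g2 := hG.shift (-D, 0) (by simpa using sD) (by simp)
  have g3 := hG.shift (D, 0) (by simpa using sD) (by simp)
  have j2 := g1.int (mV E1) (fun p => bE _ _)
  have j3 := g2.int (mV Q) (fun p => bQ _ _)
  have j5 := g3.int (mV B) (fun p => bB _ _)
  have j7 := g2.int (mV B) (fun p => bB _ _)
  have hm : ∀ p : ℝ × ℝ, p + (D, 0) = p - (-D, 0) := fun p => by ext <;> simp
  have t1 : ∫ p : ℝ × ℝ, (G p - G (p - (0, τ))) / τ * |vW D τ W p.1 p.2 - κ| =
      ((∫ p, G p * vW D τ E1 p.1 p.2) - ∫ p : ℝ × ℝ, G p * vW D τ E1 (p + (0, τ)).1 (p + (0, τ)).2) / τ := by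
    rw [integral_shift2 G (fun p => vW D τ E1 p.1 p.2) (0, τ), ← comb_sub i1 j2]
    refine integral_congr_ae (Eventually.of_forall fun p => ?_)
    show _ = (G p * |vW D τ W p.1 p.2 - κ| - G (p - (0, τ)) * |vW D τ W p.1 p.2 - κ|) / τ
    simp only; ring
  have t2 : ∫ p : ℝ × ℝ, (G (p + (D, 0)) - G p) / D * Qf fh κ (vW D τ W p.1 p.2) (vW D τ W (p.1 + D) p.2) =
      ((∫ p : ℝ × ℝ, G p * vW D τ Q (p + (-D, 0)).1 (p + (-D, 0)).2) - ∫ p, G p * vW D τ Q p.1 p.2) / D := by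
    rw [integral_shift2 G (fun p => vW D τ Q p.1 p.2) (-D, 0), ← comb_sub j3 i4]
    refine integral_congr_ae (Eventually.of_forall fun p => ?_)
    have e : Qf fh κ (vW D τ W p.1 p.2) (vW D τ W (p.1 + D) p.2) = vW D τ Q p.1 p.2 := by
      rw [vW_shiftx hD]; rfl
    simp only
    rw [e, hm]; ring
  have t3 : ∫ p : ℝ × ℝ, (G (p + (D, 0)) - 2 * G p + G (p - (D, 0))) / D ^ 2 *
          |Aint a (vW D τ W p.1 p.2) - Aint a κ| =
      ((∫ p : ℝ × ℝ, G p * vW D τ B (p + (D, 0)).1 (p + (D, 0)).2) - 2 * (∫ p, G p * vW D τ B p.1 p.2)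
        + ∫ p : ℝ × ℝ, G p * vW D τ B (p + (-D, 0)).1 (p + (-D, 0)).2) / D ^ 2 := by
    rw [integral_shift2 G (fun p => vW D τ B p.1 p.2) (-D, 0),
      integral_shift2 G (fun p => vW D τ B p.1 p.2) (D, 0), ← comb_three j5 i6 j7]
    refine integral_congr_ae (Eventually.of_forall fun p => ?_)
    have e : |Aint a (vW D τ W p.1 p.2) - Aint a κ| = vW D τ B p.1 p.2 := rfl
    simp only
    rw [e, hm]; ring
  have t4 : ∫ p : ℝ × ℝ, G p * Real.sign (vW D τ W p.1 (p.2 + τ) - κ) *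
          fracLap c l (fun y => vW D τ W y p.2) p.1 =
      ∫ p : ℝ × ℝ, G p * vW D τ S (p + (0, τ)).1 (p + (0, τ)).2 * vW D τ N p.1 p.2 := by
    have gs : BS (fun p => G p * vW D τ S (p + (0, τ)).1 (p + (0, τ)).2) K R :=
      hG.mul (mVe S (0, τ)) (fun p => bS _ _)
    have i9 := gs.int1 (fl_measurable2 (vW_meas D τ W) c l) hC3t (fun t => (hnice t).fl_l1 c l)
    have e9 : (fun p : ℝ × ℝ => G p * Real.sign (vW D τ W p.1 (p.2 + τ) - κ) *
          fracLap c l (fun y => vW D τ W y p.2) p.1) = fun p => G p * vW D τ S (p + (0, τ)).1 (p + (0, τ)).2 *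
          fracLap c l (fun y => vW D τ W y p.2) p.1 := by
      funext p
      simp [vW, hS]
    rw [e9]
    rw [Measure.volume_eq_prod] at i8 i9 ⊢
    rw [integral_prod_symm _ i9, integral_prod_symm _ i8]
    refine integral_congr_ae ?_
    filter_upwards [i9.prod_left_ae, i8.prod_left_ae] with t h9 h8
    have key := cell_avg hD (k := fun i => k i t * S ⌊(t + τ) / τ⌋.toNat i)
      (w := fracLap c l (pc D (W ⌊t / τ⌋.toNat)))
      (h9.congr (Eventually.of_forall fun x => by
        simp only [hGk]; simp [vW]; exact Or.inl rfl))
      (h8.congr (Eventually.of_forall fun x => by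
        simp only [hGk]; simp [vW, hN, NL]))
    rw [eq_comm] at key
    refine Eq.trans ?_ (key.trans ?_)
    · refine integral_congr_ae (Eventually.of_forall fun x => ?_)
      simp only [hGk]; simp [vW]; exact Or.inl rfl
    · refine integral_congr_ae (Eventually.of_forall fun x => ?_)
      simp only [hGk]; simp [vW, hN, NL]
  rw [t1, t2, t3, t4]
  linarith [tot]

end DDG

namespace DDG
open MeasureTheory Filter Set
open scoped ENNReal Topology

variable {A : ℝ → ℝ} {C : ℝ} {ε : ℕ → ℝ} {v : ℕ → ℝ → ℝ → ℝ} {u : ℝ → ℝ → ℝ}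

lemma lintegral_Bx {F : ℝ × ℝ → ℝ≥0∞} (hF : Measurable F) (R : ℝ) :
    ∫⁻ p in Bx R, F p = ∫⁻ t in Icc (-R) R, ∫⁻ x in Icc (-R) R, F (x, t) := by
  unfold Bx
  rw [Measure.volume_eq_prod, ← Measure.prod_restrict, lintegral_prod_symm _ hF.aemeasurable]

/-- dominated convergence in time for box integrals -/
lemma box_tendsto {F : ℕ → ℝ × ℝ → ℝ≥0∞} (hF : ∀ j, Measurable (F j)) {R : ℝ} {B : ℝ≥0∞} (hB : B ≠ ⊤)
    (hb : ∀ j t, ∫⁻ x in Icc (-R) R, F j (x, t) ≤ B)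
    (hl : ∀ t, Tendsto (fun j => ∫⁻ x in Icc (-R) R, F j (x, t)) atTop (𝓝 0)) :
    Tendsto (fun j => ∫⁻ p in Bx R, F j p) atTop (𝓝 0) := by
  simp_rw [lintegral_Bx (hF _)]
  have := tendsto_lintegral_of_dominated_convergence (μ := volume.restrict (Icc (-R) R))
    (F := fun j t => ∫⁻ x in Icc (-R) R, F j (x, t)) (f := fun _ => 0) (fun _ => B)
    (fun j => Measurable.lintegral_prod_left' (μ := volume.restrict (Icc (-R) R)) (hF j))
    (fun j => Eventually.of_forall fun t => hb j t)
    (by rw [setLIntegral_const]; exact ENNReal.mul_ne_top hB (by simp))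
    (Eventually.of_forall fun t => hl t)
  simpa using this

lemma box_v (hs : CompSeq A C ε v) (hu : CompLim A C v u) (R : ℝ) :
    Tendsto (fun j => ∫⁻ p in Bx R, ‖v j p.1 p.2 - u p.1 p.2‖ₑ) atTop (𝓝 0) := by
  refine box_tendsto (fun j => ((hs.meas j).sub hu.meas).enorm) (B := ENNReal.ofReal C + ENNReal.ofReal C)
    (by simp) (fun j t => ?_) (fun t => hu.lim t R)
  have hm : Measurable fun x => ‖u x t‖ₑ := (hu.measx t).enorm
  calc _ ≤ ∫⁻ x, ‖v j x t - u x t‖ₑ := setLIntegral_le_lintegral _ _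
    _ ≤ ∫⁻ x, (‖v j x t‖ₑ + ‖u x t‖ₑ) := lintegral_mono fun x => enorm_sub_le
    _ = _ := lintegral_add_right _ hm
    _ ≤ _ := add_le_add (hs.l1 j t) (hu.l1 t)

lemma box_const (hs : CompSeq A C ε v) (hu : CompLim A C v u) {R : ℝ} {w : ℕ → ℝ × ℝ → ℝ} (hw : ∀ j, Measurable (w j))
    {δ : ℕ → ℝ} (hδ : Tendsto δ atTop (𝓝 0))
    (h : ∀ j t, ∫⁻ x, ‖w j (x, t) - v j x t‖ₑ ≤ ENNReal.ofReal (δ j)) :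
    Tendsto (fun j => ∫⁻ p in Bx R, ‖w j p - u p.1 p.2‖ₑ) atTop (𝓝 0) := by
  have h1 : Tendsto (fun j => ENNReal.ofReal (δ j) * volume (Icc (-R) R)
      + ∫⁻ p in Bx R, ‖v j p.1 p.2 - u p.1 p.2‖ₑ) atTop (𝓝 0) := by
    have := ENNReal.Tendsto.mul_const (ENNReal.tendsto_ofReal hδ) (b := volume (Icc (-R) R)) (by simp)
    simpa using this.add (box_v hs hu R)
  refine tendsto_of_tendsto_of_tendsto_of_le_of_le tendsto_const_nhds h1 (fun j => zero_le) (fun j => ?_)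
  have hm : Measurable fun p : ℝ × ℝ => ‖v j p.1 p.2 - u p.1 p.2‖ₑ := ((hs.meas j).sub hu.meas).enorm
  have hm2 : Measurable fun p : ℝ × ℝ => ‖w j p - v j p.1 p.2‖ₑ := ((hw j).sub (hs.meas j)).enorm
  calc _ ≤ ∫⁻ p in Bx R, (‖w j p - v j p.1 p.2‖ₑ + ‖v j p.1 p.2 - u p.1 p.2‖ₑ) := by
        refine lintegral_mono fun p => ?_
        simp only [← edist_eq_enorm_sub]
        exact edist_triangle _ _ _
    _ = (∫⁻ p in Bx R, ‖w j p - v j p.1 p.2‖ₑ) + ∫⁻ p in Bx R, ‖v j p.1 p.2 - u p.1 p.2‖ₑ :=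
        lintegral_add_right _ hm
    _ ≤ _ := by
        refine add_le_add ?_ le_rfl
        rw [lintegral_Bx hm2, ← setLIntegral_const]
        exact lintegral_mono fun t => (setLIntegral_le_lintegral _ _).trans (h j t)

lemma box_vx (hs : CompSeq A C ε v) (hu : CompLim A C v u) (R : ℝ) {D : ℕ → ℝ} (hD : Tendsto D atTop (𝓝 0)) :
    Tendsto (fun j => ∫⁻ p in Bx R, ‖v j (p.1 + D j) p.2 - u p.1 p.2‖ₑ) atTop (𝓝 0) := by
  refine box_const hs hu (w := fun j p => v j (p.1 + D j) p.2)
    (fun j => (hs.meas j).comp (f := fun p : ℝ × ℝ => (p.1 + D j, p.2)) (by fun_prop))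
    (δ := fun j => |D j| * C) (by simpa using hD.abs.mul_const C) (fun j t => ?_)
  rw [ENNReal.ofReal_mul (abs_nonneg _)]
  refine (bv_shift (ne_top_of_le_ne_top ENNReal.ofReal_ne_top (hs.tv j t)) _).trans ?_
  gcongr
  exact hs.tv j t

lemma box_vt (hs : CompSeq A C ε v) (hu : CompLim A C v u) (R : ℝ) {D : ℕ → ℝ} (hD : Tendsto D atTop (𝓝 0)) :
    Tendsto (fun j => ∫⁻ p in Bx R, ‖v j p.1 (p.2 + D j) - u p.1 p.2‖ₑ) atTop (𝓝 0) := by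
  refine box_const hs hu (w := fun j p => v j p.1 (p.2 + D j))
    (fun j => (hs.meas j).comp (f := fun p : ℝ × ℝ => (p.1, p.2 + D j)) (by fun_prop))
    (δ := fun j => C * (|D j| + ε j)) (by simpa using (hD.abs.add hs.eps).const_mul C) (fun j t => ?_)
  have := hs.time j (t + D j) t
  simpa using this

/-- local `L¹` convergence of the nonlocal operator -/
lemma fl_loc {c l : ℝ} (hl : l ∈ Ioo (0:ℝ) 1) {g : ℕ → ℝ → ℝ} {B : ℝ≥0∞} (hg : ∀ j, Nice (g j) B)
    (hB : B ≠ ⊤) (hlim : ∀ R, Tendsto (fun j => ∫⁻ x in Icc (-R) R, ‖g j x‖ₑ) atTop (𝓝 0)) (R : ℝ) :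
    Tendsto (fun j => ∫⁻ x in Icc (-R) R, ‖fracLap c l (g j) x‖ₑ) atTop (𝓝 0) := by
  have h1 : Tendsto (fun j => ‖c‖ₑ * ∫⁻ z, ∫⁻ x in Icc (-R) R, ‖(g j (x + z) - g j x) * Kr l z‖ₑ) atTop (𝓝 0) := by
    have h2 : Tendsto (fun j => ∫⁻ z, ∫⁻ x in Icc (-R) R, ‖(g j (x + z) - g j x) * Kr l z‖ₑ) atTop (𝓝 0) := by
      have := tendsto_lintegral_of_dominated_convergence (μ := (volume : Measure ℝ))
        (F := fun j z => ∫⁻ x in Icc (-R) R, ‖(g j (x + z) - g j x) * Kr l z‖ₑ) (f := fun _ => 0)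
        (fun z => B * (ENNReal.ofReal (min |z| 1) * ENNReal.ofReal (Kr l z)))
        (fun j => Measurable.lintegral_prod_left' (μ := volume.restrict (Icc (-R) R)) (meas_diffK (hg j).meas l).enorm)
        (fun j => Eventually.of_forall fun z => ?_)
        ?_
        (Eventually.of_forall fun z => ?_)
      · simpa using this
      · simp only [enorm_mul]
        rw [lintegral_mul_const' _ _ (by simp), ← mul_assoc, ← ofReal_norm (Kr l z), Real.norm_of_nonneg (Kr_nonneg l z)]
        gcongr
        exact (setLIntegral_le_lintegral _ _).trans ((hg j).shift z)
      · rw [lintegral_const_mul' _ _ hB]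
        exact ENNReal.mul_ne_top hB (HK_lt_top hl).ne
      · have h3 : Tendsto (fun j => ((∫⁻ x in Icc (-(R + |z|)) (R + |z|), ‖g j x‖ₑ)
            + ∫⁻ x in Icc (-R) R, ‖g j x‖ₑ) * ‖Kr l z‖ₑ) atTop (𝓝 0) := by
          simpa using ENNReal.Tendsto.mul_const ((hlim (R + |z|)).add (hlim R)) (b := ‖Kr l z‖ₑ) (by simp)
        refine tendsto_of_tendsto_of_tendsto_of_le_of_le tendsto_const_nhds h3 (fun j => zero_le) (fun j => ?_)
        simp only [enorm_mul]
        rw [lintegral_mul_const' _ _ (by simp)]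
        refine mul_le_mul_left ?_ _
        have hm : Measurable fun x => ‖g j x‖ₑ := (hg j).meas.enorm
        calc _ ≤ ∫⁻ x in Icc (-R) R, (‖g j (x + z)‖ₑ + ‖g j x‖ₑ) := lintegral_mono fun x => enorm_sub_le
          _ = (∫⁻ x in Icc (-R) R, ‖g j (x + z)‖ₑ) + ∫⁻ x in Icc (-R) R, ‖g j x‖ₑ := lintegral_add_right _ hm
          _ ≤ _ := by
            refine add_le_add ?_ le_rfl
            rw [← lintegral_indicator measurableSet_Icc, ← lintegral_indicator measurableSet_Icc,
              ← lintegral_add_right_eq_self (fun x => (Icc (-(R + |z|)) (R + |z|)).indicator (fun x => ‖g j x‖ₑ) x) z]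
            refine lintegral_mono fun x => ?_
            by_cases hx : x ∈ Icc (-R) R
            · rw [indicator_of_mem hx, indicator_of_mem]
              have := abs_le.1 (le_refl |z|)
              exact ⟨by linarith [hx.1], by linarith [hx.2]⟩
            · rw [indicator_of_notMem hx]; exact zero_le
    simpa using ENNReal.Tendsto.const_mul h2 (a := ‖c‖ₑ) (by simp)
  refine tendsto_of_tendsto_of_tendsto_of_le_of_le tendsto_const_nhds h1 (fun j => zero_le) (fun j => ?_)
  calc _ ≤ ∫⁻ x in Icc (-R) R, ‖c‖ₑ * ∫⁻ z, ‖(g j (x + z) - g j x) * Kr l z‖ₑ :=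
        lintegral_mono fun x => fl_enorm_le _ _ _
    _ = ‖c‖ₑ * ∫⁻ x in Icc (-R) R, ∫⁻ z, ‖(g j (x + z) - g j x) * Kr l z‖ₑ := lintegral_const_mul' _ _ (by simp)
    _ = _ := by rw [lintegral_lintegral_swap ((meas_diffK (hg j).meas l).enorm.aemeasurable)]

lemma box_fl (hs : CompSeq A C ε v) (hu : CompLim A C v u) (R c : ℝ) {l : ℝ} (hl : l ∈ Ioo (0:ℝ) 1) :
    Tendsto (fun j => ∫⁻ p in Bx R, ‖fracLap c l (fun y => v j y p.2) p.1 - fracLap c l (fun y => u y p.2) p.1‖ₑ)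
      atTop (𝓝 0) := by
  have hn : ∀ j t, Nice (fun x => v j x t) (2 * ENNReal.ofReal C) := fun j t =>
    nice_of_bv ENNReal.ofReal_ne_top (hs.l1 j t) (hs.tv j t)
  have hd := fun j t => (hn j t).sub (hu.nice t)
  have e : ∀ j t, ∫⁻ x in Icc (-R) R, ‖fracLap c l (fun y => v j y t) x - fracLap c l (fun y => u y t) x‖ₑ =
      ∫⁻ x in Icc (-R) R, ‖fracLap c l (fun y => v j y t - u y t) x‖ₑ := by
    intro j t
    apply lintegral_congr_ae
    filter_upwards [ae_restrict_of_ae ((hn j t).fl_sub (hu.nice t) c hl)] with x hx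
    rw [hx]
  refine box_tendsto (fun j => ((fl_measurable2 (hs.meas j) c l).sub (fl_measurable2 hu.meas c l)).enorm)
    (B := ‖c‖ₑ * ((2 * ENNReal.ofReal C + 2 * ENNReal.ofReal C) * HK l))
    (ENNReal.mul_ne_top (by simp) (ENNReal.mul_ne_top (hd 0 0).fin (HK_lt_top hl).ne))
    (fun j t => ?_) (fun t => ?_)
  · refine (e j t).le.trans ((setLIntegral_le_lintegral _ _).trans ((hd j t).fl_l1 c l))
  · refine Tendsto.congr (fun j => (e j t).symm) ?_
    exact fl_loc hl (fun j => hd j t) (hd 0 0).fin (fun R => hu.lim t R) R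

/-- a.e. convergent subsequence on a box -/
lemma ae_sub {R : ℝ} {w : ℕ → ℝ × ℝ → ℝ} {g : ℝ × ℝ → ℝ} (hw : ∀ j, Measurable (w j)) (hg : Measurable g)
    (h : Tendsto (fun j => ∫⁻ p in Bx R, ‖w j p - g p‖ₑ) atTop (𝓝 0)) :
    ∃ θ : ℕ → ℕ, StrictMono θ ∧ ∀ᵐ p ∂(volume.restrict (Bx R)), Tendsto (fun j => w (θ j) p) atTop (𝓝 (g p)) := by
  refine TendstoInMeasure.exists_seq_tendsto_ae (tendstoInMeasure_of_tendsto_eLpNorm (p := 1) one_ne_zero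
    (fun j => (hw j).aestronglyMeasurable) hg.aestronglyMeasurable ?_)
  simpa [eLpNorm_one_eq_lintegral_enorm] using h

end DDG

namespace DDG
open MeasureTheory Filter Set
open scoped ENNReal Topology

lemma dct_box {α : ℕ → ℝ × ℝ → ℝ} {α0 : ℝ × ℝ → ℝ} {F : ℕ → ℝ × ℝ → ℝ} {F0 g : ℝ × ℝ → ℝ} {K R : ℝ}
    (hα : ∀ j, BS (α j) K R) (hαl : ∀ p, Tendsto (fun j => α j p) atTop (𝓝 (α0 p)))
    (hF : ∀ j, Measurable (F j)) (hg : IntegrableOn g (Bx R)) (hb : ∀ j p, |F j p| ≤ g p)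
    (hl : ∀ᵐ p ∂(volume.restrict (Bx R)), Tendsto (fun j => F j p) atTop (𝓝 (F0 p))) :
    Tendsto (fun j => ∫ p, α j p * F j p) atTop (𝓝 (∫ p, α0 p * F0 p)) := by
  have h0 : ∀ p, p ∉ Bx R → α0 p = 0 := fun p hp =>
    tendsto_nhds_unique (hαl p) (by simp [(hα _).supp p hp])
  rw [← setIntegral_eq_integral_of_forall_compl_eq_zero (s := Bx R) (f := fun p => α0 p * F0 p)
    (fun p hp => by simp [h0 p hp])]
  have e : ∀ j, ∫ p, α j p * F j p = ∫ p in Bx R, α j p * F j p := fun j =>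
    (setIntegral_eq_integral_of_forall_compl_eq_zero (fun p hp => by simp [(hα j).supp p hp])).symm
  simp_rw [e]
  refine tendsto_integral_of_dominated_convergence (fun p => K * g p)
    (fun j => ((hα j).meas.mul (hF j)).aestronglyMeasurable) (hg.const_mul K)
    (fun j => Eventually.of_forall fun p => ?_) ?_
  · rw [norm_mul]
    exact mul_le_mul ((hα j).bd p) (hb j p) (abs_nonneg _) (hα j).K0
  · filter_upwards [hl] with p hp
    exact (hαl p).mul hp

lemma dct_boxc {α : ℕ → ℝ × ℝ → ℝ} {α0 : ℝ × ℝ → ℝ} {F : ℕ → ℝ × ℝ → ℝ} {F0 : ℝ × ℝ → ℝ} {K R M : ℝ}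
    (hα : ∀ j, BS (α j) K R) (hαl : ∀ p, Tendsto (fun j => α j p) atTop (𝓝 (α0 p)))
    (hF : ∀ j, Measurable (F j)) (hb : ∀ j p, |F j p| ≤ M)
    (hl : ∀ᵐ p ∂(volume.restrict (Bx R)), Tendsto (fun j => F j p) atTop (𝓝 (F0 p))) :
    Tendsto (fun j => ∫ p, α j p * F j p) atTop (𝓝 (∫ p, α0 p * F0 p)) :=
  dct_box (g := fun _ => M) hα hαl hF (integrableOn_const (Bx_vol R).ne) hb hl

lemma sign_tendsto {w : ℕ → ℝ} {x : ℝ} (hx : x ≠ 0) (h : Tendsto w atTop (𝓝 x)) :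
    Tendsto (fun j => Real.sign (w j)) atTop (𝓝 (Real.sign x)) := by
  rcases lt_or_gt_of_ne hx with h0 | h0
  · rw [Real.sign_of_neg h0]
    refine tendsto_const_nhds.congr' ?_
    filter_upwards [h.eventually_lt_const h0] with j hj
    rw [Real.sign_of_neg hj]
  · rw [Real.sign_of_pos h0]
    refine tendsto_const_nhds.congr' ?_
    filter_upwards [h.eventually_const_lt h0] with j hj
    rw [Real.sign_of_pos hj]

lemma sign_measurable : Measurable Real.sign := by
  unfold Real.sign
  exact Measurable.ite measurableSet_Iio measurable_const
    (Measurable.ite measurableSet_Ioi measurable_const measurable_const)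

lemma Qf_cont {fh : ℝ → ℝ → ℝ} (hfh : Continuous fun p : ℝ × ℝ => fh p.1 p.2) :
    Continuous fun p : ℝ × ℝ × ℝ => Qf fh p.1 p.2.1 p.2.2 := by
  unfold Qf
  exact (hfh.comp (f := fun p : ℝ × ℝ × ℝ => (max p.2.1 p.1, max p.2.2 p.1)) (by fun_prop)).sub
    (hfh.comp (f := fun p : ℝ × ℝ × ℝ => (min p.2.1 p.1, min p.2.2 p.1)) (by fun_prop))

variable {A : ℝ → ℝ} {C : ℝ} {ε : ℕ → ℝ} {v : ℕ → ℝ → ℝ → ℝ} {u : ℝ → ℝ → ℝ}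

/-- the coefficients -/
structure Coef (α : ℕ → ℝ × ℝ → ℝ) (α0 : ℝ × ℝ → ℝ) (K R : ℝ) : Prop where
  bs : ∀ j, BS (α j) K R
  lim : ∀ p, Tendsto (fun j => α j p) atTop (𝓝 (α0 p))

lemma Coef.sub {α : ℕ → ℝ × ℝ → ℝ} {α0 : ℝ × ℝ → ℝ} {K R : ℝ} (h : Coef α α0 K R) {θ : ℕ → ℕ} (hθ : StrictMono θ) :
    Coef (fun j => α (θ j)) α0 K R :=
  ⟨fun j => h.bs _, fun p => (h.lim p).comp hθ.tendsto_atTop⟩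

lemma Coef.bs0 {α : ℕ → ℝ × ℝ → ℝ} {α0 : ℝ × ℝ → ℝ} {K R : ℝ} (h : Coef α α0 K R) : BS α0 K R :=
  ⟨measurable_of_tendsto_metrizable (fun j => (h.bs j).meas) (tendsto_pi_nhds.2 h.lim),
   fun p => le_of_tendsto (h.lim p).abs (Eventually.of_forall fun j => (h.bs j).bd p),
   fun p hp => tendsto_nhds_unique (h.lim p) (by simp [(h.bs _).supp p hp])⟩

lemma fl_box_int (hu : CompLim A C v u) (c : ℝ) {l : ℝ} (hl : l ∈ Ioo (0:ℝ) 1) (R : ℝ) :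
    IntegrableOn (fun p : ℝ × ℝ => fracLap c l (fun y => u y p.2) p.1) (Bx R) := by
  have h : BS ((Bx R).indicator fun _ => 1) 1 R :=
    ⟨measurable_const.indicator (Bx_meas R), fun p => by
      by_cases hp : p ∈ Bx R <;> simp [hp], fun p hp => by simp [hp]⟩
  have := h.int1 (fl_measurable2 hu.meas c l) (B := ‖c‖ₑ * (2 * ENNReal.ofReal C * HK l))
    (ENNReal.mul_ne_top (by simp) (ENNReal.mul_ne_top (ENNReal.mul_ne_top (by simp) (by simp)) (HK_lt_top hl).ne))
    (fun t => (hu.nice t).fl_l1 c l)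
  refine this.integrableOn.congr_fun (fun p hp => ?_) (Bx_meas R)
  simp [hp]

lemma int_enorm_le {α F G : ℝ × ℝ → ℝ} {K R : ℝ} (hα : BS α K R)
    (hi1 : Integrable fun p => α p * F p) (hi2 : Integrable fun p => α p * G p) :
    ‖(∫ p, α p * F p) - ∫ p, α p * G p‖ₑ ≤ ENNReal.ofReal K * ∫⁻ p in Bx R, ‖F p - G p‖ₑ := by
  rw [← integral_sub hi1 hi2]
  rw [← setIntegral_eq_integral_of_forall_compl_eq_zero (s := Bx R) (fun p hp => by simp [hα.supp p hp]),
    ← lintegral_const_mul' _ _ (by simp)]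
  refine (enorm_integral_le_lintegral_enorm _).trans (lintegral_mono fun p => ?_)
  rw [← mul_sub, enorm_mul]
  refine mul_le_mul_left ?_ _
  rw [← ofReal_norm]
  exact ENNReal.ofReal_le_ofReal (hα.bd p)

/-- passage to the limit for good values of `κ` -/
lemma ent_limit {c l b : ℝ} {fh : ℝ → ℝ → ℝ} (hl : l ∈ Ioo (0:ℝ) 1)
    (hfh : Continuous fun p : ℝ × ℝ => fh p.1 p.2)
    {K1 : ℝ} (hK10 : 0 ≤ K1) (hK1 : ∀ u v u' v', |fh u v - fh u' v'| ≤ K1 * (|u - u'| + |v - v'|))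
    {Ma : ℝ} (hMa : 0 ≤ Ma) (hA : ∀ x y, |A x - A y| ≤ Ma * |x - y|)
    (hs : CompSeq A C ε v) (hu : CompLim A C v u) {D τ : ℕ → ℝ} (hD : Tendsto D atTop (𝓝 0))
    (hτ : Tendsto τ atTop (𝓝 0)) {K R : ℝ} {α1 α2 α3 α4 : ℕ → ℝ × ℝ → ℝ} {β1 β2 β3 β4 : ℝ × ℝ → ℝ}
    (h1 : Coef α1 β1 K R) (h2 : Coef α2 β2 K R) (h3 : Coef α3 β3 K R) (h4 : Coef α4 β4 K R)
    {γ : ℕ → ℝ} {γ0 : ℝ} (hγ : Tendsto γ atTop (𝓝 γ0)) {κ : ℝ}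
    (hκ : ∀ᵐ p ∂(volume.restrict (Bx R)), u p.1 p.2 ≠ κ)
    (hE : ∀ j, 0 ≤ (∫ p : ℝ × ℝ, α1 j p * |v j p.1 p.2 - κ|) + γ j
      + (∫ p : ℝ × ℝ, α2 j p * Qf fh κ (v j p.1 p.2) (v j (p.1 + D j) p.2))
      + (∫ p : ℝ × ℝ, α3 j p * |A (v j p.1 p.2) - A κ|)
      + b * ∫ p : ℝ × ℝ, α4 j p * Real.sign (v j p.1 (p.2 + τ j) - κ) *
          fracLap c l (fun y => v j y p.2) p.1) :
    0 ≤ (∫ p : ℝ × ℝ, β1 p * |u p.1 p.2 - κ|) + γ0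
      + (∫ p : ℝ × ℝ, β2 p * Qf fh κ (u p.1 p.2) (u p.1 p.2))
      + (∫ p : ℝ × ℝ, β3 p * |A (u p.1 p.2) - A κ|)
      + b * ∫ p : ℝ × ℝ, β4 p * (Real.sign (u p.1 p.2 - κ) *
          fracLap c l (fun y => u y p.2) p.1) := by
  have mx : ∀ j, Measurable fun p : ℝ × ℝ => v j (p.1 + D j) p.2 := fun j =>
    (hs.meas j).comp (f := fun p : ℝ × ℝ => (p.1 + D j, p.2)) (by fun_prop)
  have mt : ∀ j, Measurable fun p : ℝ × ℝ => v j p.1 (p.2 + τ j) := fun j =>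
    (hs.meas j).comp (f := fun p : ℝ × ℝ => (p.1, p.2 + τ j)) (by fun_prop)
  obtain ⟨θ1, m1, c1⟩ := ae_sub hs.meas hu.meas (box_v hs hu R)
  obtain ⟨θ2, m2, c2⟩ := ae_sub (fun j => mx (θ1 j)) hu.meas ((box_vx hs hu R hD).comp m1.tendsto_atTop)
  obtain ⟨θ3, m3, c3⟩ := ae_sub (fun j => mt (θ1 (θ2 j))) hu.meas
    ((box_vt hs hu R hτ).comp (m1.comp m2).tendsto_atTop)
  set θ : ℕ → ℕ := fun j => θ1 (θ2 (θ3 j)) with hθ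
  have mθ : StrictMono θ := m1.comp (m2.comp m3)
  have d1 : ∀ᵐ p ∂(volume.restrict (Bx R)), Tendsto (fun j => v (θ j) p.1 p.2) atTop (𝓝 (u p.1 p.2)) := by
    filter_upwards [c1] with p hp using hp.comp (m2.comp m3).tendsto_atTop
  have d2 : ∀ᵐ p ∂(volume.restrict (Bx R)), Tendsto (fun j => v (θ j) (p.1 + D (θ j)) p.2) atTop (𝓝 (u p.1 p.2)) := by
    filter_upwards [c2] with p hp using hp.comp m3.tendsto_atTop
  have d3 : ∀ᵐ p ∂(volume.restrict (Bx R)), Tendsto (fun j => v (θ j) p.1 (p.2 + τ (θ j))) atTop (𝓝 (u p.1 p.2)) := c3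
  have bκ : ∀ j x t, |v j x t - κ| ≤ C + |κ| := fun j x t =>
    (abs_sub _ _).trans (add_le_add_left (hs.bd j x t) _)
  have L1 := dct_boxc (h1.sub mθ).bs (h1.sub mθ).lim (F := fun j p => |v (θ j) p.1 p.2 - κ|)
    (F0 := fun p => |u p.1 p.2 - κ|) (fun j => ((hs.meas _).sub_const κ).abs) (M := C + |κ|)
    (fun j p => by rw [abs_abs]; exact bκ _ _ _)
    (by filter_upwards [d1] with p hp using (hp.sub_const κ).abs)
  have L2 := dct_boxc (h2.sub mθ).bs (h2.sub mθ).lim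
    (F := fun j p => Qf fh κ (v (θ j) p.1 p.2) (v (θ j) (p.1 + D (θ j)) p.2))
    (F0 := fun p => Qf fh κ (u p.1 p.2) (u p.1 p.2))
    (fun j => (Qf_cont hfh).measurable.comp (measurable_const.prodMk ((hs.meas _).prodMk (mx _))))
    (M := K1 * ((C + |κ|) + (C + |κ|)))
    (fun j p => (Qf_bd hK1 _ _ _).trans (by gcongr <;> exact bκ _ _ _))
    (by filter_upwards [d1, d2] with p hp hp2 using
          ((Qf_cont hfh).tendsto (κ, u p.1 p.2, u p.1 p.2)).comp
            (tendsto_const_nhds.prodMk_nhds (hp.prodMk_nhds hp2)))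
  have L3 := dct_boxc (h3.sub mθ).bs (h3.sub mθ).lim (F := fun j p => |A (v (θ j) p.1 p.2) - A κ|)
    (F0 := fun p => |A (u p.1 p.2) - A κ|) (fun j => ((hs.Ac.measurable.comp (hs.meas _)).sub_const (A κ)).abs)
    (M := Ma * (C + |κ|))
    (fun j p => by
      rw [abs_abs]; exact (hA _ _).trans (mul_le_mul_of_nonneg_left (bκ _ _ _) hMa))
    (by filter_upwards [d1] with p hp using (((hs.Ac.tendsto _).comp hp).sub_const (A κ)).abs)
  have ms : ∀ j, Measurable fun p : ℝ × ℝ => Real.sign (v (θ j) p.1 (p.2 + τ (θ j)) - κ) := fun j =>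
    sign_measurable.comp ((mt _).sub_const κ)
  have L4 := dct_box (h4.sub mθ).bs (h4.sub mθ).lim
    (F := fun j p => Real.sign (v (θ j) p.1 (p.2 + τ (θ j)) - κ) * fracLap c l (fun y => u y p.2) p.1)
    (F0 := fun p => Real.sign (u p.1 p.2 - κ) * fracLap c l (fun y => u y p.2) p.1)
    (g := fun p => |fracLap c l (fun y => u y p.2) p.1|)
    (fun j => (ms j).mul (fl_measurable2 hu.meas c l)) (fl_box_int hu c hl R).abs
    (fun j p => by
      rw [abs_mul]
      exact mul_le_of_le_one_left (abs_nonneg _) (abs_sign_le _))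
    (by filter_upwards [d3, hκ] with p hp hp2 using
          (sign_tendsto (sub_ne_zero.2 hp2) (hp.sub_const κ)).mul_const _)
  have hn : ∀ j t, Nice (fun x => v j x t) (2 * ENNReal.ofReal C) := fun j t =>
    nice_of_bv ENNReal.ofReal_ne_top (hs.l1 j t) (hs.tv j t)
  have hBt : ‖c‖ₑ * (2 * ENNReal.ofReal C * HK l) ≠ ⊤ :=
    ENNReal.mul_ne_top (by simp) (ENNReal.mul_ne_top (ENNReal.mul_ne_top (by simp) (by simp)) (HK_lt_top hl).ne)
  have L5 : Tendsto (fun j => (∫ p : ℝ × ℝ, α4 (θ j) p * Real.sign (v (θ j) p.1 (p.2 + τ (θ j)) - κ) *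
          fracLap c l (fun y => v (θ j) y p.2) p.1) -
        ∫ p : ℝ × ℝ, α4 (θ j) p * (Real.sign (v (θ j) p.1 (p.2 + τ (θ j)) - κ) *
          fracLap c l (fun y => u y p.2) p.1)) atTop (𝓝 0) := by
    rw [tendsto_iff_edist_tendsto_0]
    have h0 : Tendsto (fun j => ENNReal.ofReal K * ∫⁻ p in Bx R, ‖fracLap c l (fun y => v (θ j) y p.2) p.1
        - fracLap c l (fun y => u y p.2) p.1‖ₑ) atTop (𝓝 0) := by
      simpa using ENNReal.Tendsto.const_mul ((box_fl hs hu R c hl).comp mθ.tendsto_atTop)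
        (a := ENNReal.ofReal K) (by simp)
    refine tendsto_of_tendsto_of_tendsto_of_le_of_le tendsto_const_nhds h0 (fun j => zero_le) (fun j => ?_)
    rw [edist_zero_right]
    have gs : BS (fun p => α4 (θ j) p * Real.sign (v (θ j) p.1 (p.2 + τ (θ j)) - κ)) K R :=
      (h4.bs (θ j)).mul (ms j) (fun p => abs_sign_le _)
    simp_rw [← mul_assoc]
    exact int_enorm_le gs (gs.int1 (fl_measurable2 (hs.meas _) c l) hBt (fun t => (hn _ t).fl_l1 c l))
      (gs.int1 (fl_measurable2 hu.meas c l) hBt (fun t => (hu.nice t).fl_l1 c l))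
  have L6 := L5.add L4
  simp only [sub_add_cancel, zero_add] at L6
  exact ge_of_tendsto' ((((L1.add (hγ.comp mθ.tendsto_atTop)).add L2).add L3).add (L6.const_mul b))
    (fun j => hE (θ j))

end DDG

namespace DDG
open MeasureTheory Filter Set
open scoped ENNReal Topology

variable {A : ℝ → ℝ} {C : ℝ} {v : ℕ → ℝ → ℝ → ℝ} {u : ℝ → ℝ → ℝ}

lemma good_seq (hu : CompLim A C v u) (R κ : ℝ) : ∃ δ : ℕ → ℝ, (∀ n, 0 < δ n) ∧ (∀ n, δ n ≤ 1) ∧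
    Tendsto δ atTop (𝓝 0) ∧ (∀ n, ∀ᵐ p ∂(volume.restrict (Bx R)), u p.1 p.2 ≠ κ + δ n) ∧
    (∀ n, ∀ᵐ p ∂(volume.restrict (Bx R)), u p.1 p.2 ≠ κ - δ n) := by
  have hc := Measure.countable_meas_level_set_pos (μ := volume.restrict (Bx R)) hu.meas
  set Bad := {t : ℝ | 0 < volume.restrict (Bx R) {p : ℝ × ℝ | u p.1 p.2 = t}} with hBad
  have c1 : ((fun d => κ + d) ⁻¹' Bad).Countable := hc.preimage (add_right_injective κ)
  have c2 : ((fun d => κ - d) ⁻¹' Bad).Countable := hc.preimage sub_right_injective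
  have hd := (c1.union c2).dense_compl ℝ
  have hg : ∀ t, t ∉ Bad → ∀ᵐ p ∂(volume.restrict (Bx R)), u p.1 p.2 ≠ t := by
    intro t ht
    rw [ae_iff]
    simp only [hBad, mem_ofPred_eq, not_lt, nonpos_iff_eq_zero] at ht
    simpa using ht
  have : ∀ n : ℕ, ∃ d, d ∈ ((fun d => κ + d) ⁻¹' Bad ∪ (fun d => κ - d) ⁻¹' Bad)ᶜ ∧ 0 < d ∧ d < 1 / ((n:ℝ) + 1) := by
    intro n
    obtain ⟨d, hd1, hd2⟩ := hd.exists_between (show (0:ℝ) < 1 / ((n:ℝ) + 1) by positivity)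
    exact ⟨d, hd1, hd2⟩
  choose δ hδ h0 h1 using this
  refine ⟨δ, h0, fun n => (h1 n).le.trans ?_, ?_, fun n => hg _ fun h => hδ n (Or.inl h),
    fun n => hg _ fun h => hδ n (Or.inr h)⟩
  · rw [div_le_one (by positivity)]; linarith [n.cast_nonneg (α := ℝ)]
  · exact squeeze_zero (fun n => (h0 n).le) (fun n => (h1 n).le) tendsto_one_div_add_atTop_nhds_zero_nat

lemma sign_avg (x : ℝ) {δ : ℕ → ℝ} (h0 : ∀ n, 0 < δ n) (hδ : Tendsto δ atTop (𝓝 0)) :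
    Tendsto (fun n => Real.sign (x - δ n) + Real.sign (x + δ n)) atTop (𝓝 (2 * Real.sign x)) := by
  by_cases hx : x = 0
  · subst hx
    refine tendsto_const_nhds.congr fun n => ?_
    rw [Real.sign_of_neg (show 0 - δ n < 0 by linarith [h0 n]), Real.sign_of_pos (show 0 < 0 + δ n by linarith [h0 n])]
    simp
  · rw [two_mul]
    exact (sign_tendsto hx (by simpa using hδ.const_sub x)).add (sign_tendsto hx (by simpa using hδ.const_add x))

lemma Coef.const {β : ℝ × ℝ → ℝ} {K R : ℝ} (h : BS β K R) : Coef (fun _ => β) β K R :=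
  ⟨fun _ => h, fun _ => tendsto_const_nhds⟩

/-- from good `κ` to all `κ` -/
lemma ent_all {c l b : ℝ} {fh : ℝ → ℝ → ℝ} (hl : l ∈ Ioo (0:ℝ) 1)
    (hfh : Continuous fun p : ℝ × ℝ => fh p.1 p.2)
    {K1 : ℝ} (hK10 : 0 ≤ K1) (hK1 : ∀ u v u' v', |fh u v - fh u' v'| ≤ K1 * (|u - u'| + |v - v'|))
    {Ma : ℝ} (hMa : 0 ≤ Ma) (hA : ∀ x y, |A x - A y| ≤ Ma * |x - y|) (hAc : Continuous A)
    (hu : CompLim A C v u) {K R : ℝ} {β1 β2 β3 β4 : ℝ × ℝ → ℝ}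
    (h1 : BS β1 K R) (h2 : BS β2 K R) (h3 : BS β3 K R) (h4 : BS β4 K R)
    {γ : ℝ → ℝ} (hγ : Continuous γ)
    (hE : ∀ κ : ℝ, (∀ᵐ p ∂(volume.restrict (Bx R)), u p.1 p.2 ≠ κ) →
    0 ≤ (∫ p : ℝ × ℝ, β1 p * |u p.1 p.2 - κ|) + γ κ
      + (∫ p : ℝ × ℝ, β2 p * Qf fh κ (u p.1 p.2) (u p.1 p.2))
      + (∫ p : ℝ × ℝ, β3 p * |A (u p.1 p.2) - A κ|)
      + b * ∫ p : ℝ × ℝ, β4 p * (Real.sign (u p.1 p.2 - κ) *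
          fracLap c l (fun y => u y p.2) p.1)) (κ : ℝ) :
    0 ≤ (∫ p : ℝ × ℝ, β1 p * |u p.1 p.2 - κ|) + γ κ
      + (∫ p : ℝ × ℝ, β2 p * Qf fh κ (u p.1 p.2) (u p.1 p.2))
      + (∫ p : ℝ × ℝ, β3 p * |A (u p.1 p.2) - A κ|)
      + b * ∫ p : ℝ × ℝ, β4 p * (Real.sign (u p.1 p.2 - κ) *
          fracLap c l (fun y => u y p.2) p.1) := by
  obtain ⟨δ, d0, d1, dl, g1, g2⟩ := good_seq hu R κ
  set e : ℝ → ℝ := fun κ => (∫ p : ℝ × ℝ, β1 p * |u p.1 p.2 - κ|) + γ κ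
      + (∫ p : ℝ × ℝ, β2 p * Qf fh κ (u p.1 p.2) (u p.1 p.2))
      + (∫ p : ℝ × ℝ, β3 p * |A (u p.1 p.2) - A κ|) with he
  set s : ℝ → ℝ := fun κ => ∫ p : ℝ × ℝ, β4 p * (Real.sign (u p.1 p.2 - κ) *
          fracLap c l (fun y => u y p.2) p.1) with hs
  have key : ∀ k : ℕ → ℝ, (∀ n, |k n| ≤ |κ| + 1) → Tendsto k atTop (𝓝 κ) → Tendsto (fun n => e (k n)) atTop (𝓝 (e κ)) := by
    intro k hk hkl
    have bκ : ∀ n x t, |u x t - k n| ≤ C + (|κ| + 1) := fun n x t =>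
      (abs_sub _ _).trans (add_le_add (hu.bd x t) (hk n))
    refine ((Tendsto.add ?_ ((hγ.tendsto κ).comp hkl)).add ?_).add ?_
    · exact dct_boxc (Coef.const h1).bs (Coef.const h1).lim (F := fun j p => |u p.1 p.2 - k j|)
        (F0 := fun p => |u p.1 p.2 - κ|) (fun j => (hu.meas.sub_const _).abs) (M := C + (|κ| + 1))
        (fun j p => by rw [abs_abs]; exact bκ _ _ _)
        (Eventually.of_forall fun p => (hkl.const_sub _).abs)
    · exact dct_boxc (Coef.const h2).bs (Coef.const h2).lim
        (F := fun j p => Qf fh (k j) (u p.1 p.2) (u p.1 p.2))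
        (F0 := fun p => Qf fh κ (u p.1 p.2) (u p.1 p.2))
        (fun j => (Qf_cont hfh).measurable.comp (measurable_const.prodMk (hu.meas.prodMk hu.meas)))
        (M := K1 * ((C + (|κ| + 1)) + (C + (|κ| + 1))))
        (fun j p => (Qf_bd hK1 _ _ _).trans (by gcongr <;> exact bκ _ _ _))
        (Eventually.of_forall fun p =>
          ((Qf_cont hfh).tendsto (κ, u p.1 p.2, u p.1 p.2)).comp
            (hkl.prodMk_nhds (tendsto_const_nhds.prodMk_nhds tendsto_const_nhds)))
    · exact dct_boxc (Coef.const h3).bs (Coef.const h3).lim (F := fun j p => |A (u p.1 p.2) - A (k j)|)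
        (F0 := fun p => |A (u p.1 p.2) - A κ|) (fun j => ((hAc.measurable.comp hu.meas).sub_const _).abs)
        (M := Ma * (C + (|κ| + 1)))
        (fun j p => by
          rw [abs_abs]; exact (hA _ _).trans (mul_le_mul_of_nonneg_left (bκ _ _ _) hMa))
        (Eventually.of_forall fun p => (((hAc.tendsto _).comp hkl).const_sub _).abs)
  have hκd : ∀ n, |κ + δ n| ≤ |κ| + 1 := fun n =>
    (abs_add_le _ _).trans (by rw [abs_of_pos (d0 n)]; linarith [d1 n])
  have hκd' : ∀ n, |κ - δ n| ≤ |κ| + 1 := fun n =>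
    (abs_sub _ _).trans (by rw [abs_of_pos (d0 n)]; linarith [d1 n])
  have k1 := key (fun n => κ + δ n) hκd (by simpa using dl.const_add κ)
  have k2 := key (fun n => κ - δ n) hκd' (by simpa using dl.const_sub κ)
  have mL := fl_measurable2 hu.meas c l
  have ms : ∀ k, Measurable fun p : ℝ × ℝ => Real.sign (u p.1 p.2 - k) := fun k =>
    sign_measurable.comp (hu.meas.sub_const k)
  have iL := fl_box_int hu c hl R
  have L4 := dct_box (Coef.const h4).bs (Coef.const h4).lim
    (F := fun n p => (Real.sign (u p.1 p.2 - (κ + δ n)) + Real.sign (u p.1 p.2 - (κ - δ n)))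
      * fracLap c l (fun y => u y p.2) p.1)
    (F0 := fun p => 2 * Real.sign (u p.1 p.2 - κ) * fracLap c l (fun y => u y p.2) p.1)
    (g := fun p => 2 * |fracLap c l (fun y => u y p.2) p.1|)
    (fun j => ((ms _).add (ms _)).mul mL) (iL.abs.const_mul 2)
    (fun j p => by
      rw [abs_mul]
      refine mul_le_mul_of_nonneg_right ?_ (abs_nonneg _)
      exact (abs_add_le _ _).trans (by linarith [abs_sign_le (u p.1 p.2 - (κ + δ j)), abs_sign_le (u p.1 p.2 - (κ - δ j))]))
    (Eventually.of_forall fun p => by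
      refine Tendsto.mul_const _ ?_
      refine (sign_avg (u p.1 p.2 - κ) d0 dl).congr fun n => ?_
      congr 2 <;> ring)
  have hBt : ‖c‖ₑ * (2 * ENNReal.ofReal C * HK l) ≠ ⊤ :=
    ENNReal.mul_ne_top (by simp) (ENNReal.mul_ne_top (ENNReal.mul_ne_top (by simp) (by simp)) (HK_lt_top hl).ne)
  have is : ∀ k, Integrable fun p : ℝ × ℝ => β4 p * (Real.sign (u p.1 p.2 - k) *
          fracLap c l (fun y => u y p.2) p.1) := fun k => by
    have := (h4.mul (ms k) (fun p => abs_sign_le _)).int1 mL hBt (fun t => (hu.nice t).fl_l1 c l)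
    simpa only [mul_assoc] using this
  have e1 : ∀ n, ∫ p : ℝ × ℝ, β4 p * ((Real.sign (u p.1 p.2 - (κ + δ n)) + Real.sign (u p.1 p.2 - (κ - δ n)))
      * fracLap c l (fun y => u y p.2) p.1) = s (κ + δ n) + s (κ - δ n) := fun n => by
    rw [hs]
    simp only
    rw [← integral_add (is _) (is _)]
    congr 1; ext p; ring
  have e2 : ∫ p : ℝ × ℝ, β4 p * (2 * Real.sign (u p.1 p.2 - κ) * fracLap c l (fun y => u y p.2) p.1) = 2 * s κ := by
    rw [hs]
    simp only
    rw [← integral_const_mul]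
    congr 1; ext p; ring
  simp_rw [e1] at L4
  rw [e2] at L4
  have := ge_of_tendsto' ((k1.add k2).add (L4.const_mul b)) (b := 0) (fun n => by
    have q1 := hE _ (g1 n)
    have q2 := hE _ (g2 n)
    have : e (κ + δ n) + e (κ - δ n) + b * (s (κ + δ n) + s (κ - δ n)) =
      (e (κ + δ n) + b * s (κ + δ n)) + (e (κ - δ n) + b * s (κ - δ n)) := by ring
    rw [this]
    exact add_nonneg q1 q2)
  change 0 ≤ e κ + b * s κ
  linarith

end DDG

namespace DDG
open MeasureTheory Filter Set
open scoped ENNReal Topology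

structure TF (φ φt φx φxx : ℝ × ℝ → ℝ) (K R T : ℝ) : Prop where
  c0 : Continuous φ
  ct : Continuous φt
  cx : Continuous φx
  cxx : Continuous φxx
  b0 : ∀ p, |φ p| ≤ K
  bt : ∀ p, |φt p| ≤ K
  bx : ∀ p, |φx p| ≤ K
  bxx : ∀ p, |φxx p| ≤ K
  s : ∀ p, p ∉ Bx R ∨ T ≤ p.2 → φ p = 0 ∧ φt p = 0 ∧ φx p = 0 ∧ φxx p = 0
  dt : ∀ x t, HasDerivAt (fun s => φ (x, s)) (φt (x, t)) t
  dx : ∀ x t, HasDerivAt (fun y => φ (y, t)) (φx (x, t)) x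
  dxx : ∀ x t, HasDerivAt (fun y => φx (y, t)) (φxx (x, t)) x

lemma TF.ext {φ : ℝ × ℝ → ℝ} (h : ContDiff ℝ (⊤ : ℕ∞) φ) (hc : HasCompactSupport φ) {T : ℝ}
    (hT : tsupport φ ⊆ {p | p.2 < T}) : ∃ φt φx φxx K R, TF φ φt φx φxx K R T := by
  set φt : ℝ × ℝ → ℝ := fun p => fderiv ℝ φ p (0, 1) with hφt
  set φx : ℝ × ℝ → ℝ := fun p => fderiv ℝ φ p (1, 0) with hφx
  set φxx : ℝ × ℝ → ℝ := fun p => fderiv ℝ φx p (1, 0) with hφxx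
  have hφx' : ContDiff ℝ (⊤ : ℕ∞) φx := (h.fderiv_right (m := (⊤ : ℕ∞)) (by norm_num)).clm_apply contDiff_const
  have hφt' : ContDiff ℝ (⊤ : ℕ∞) φt := (h.fderiv_right (m := (⊤ : ℕ∞)) (by norm_num)).clm_apply contDiff_const
  have hφxx' : ContDiff ℝ (⊤ : ℕ∞) φxx := (hφx'.fderiv_right (m := (⊤ : ℕ∞)) (by norm_num)).clm_apply contDiff_const
  have st : tsupport φt ⊆ tsupport φ := tsupport_fderiv_apply_subset ℝ (0, 1)
  have sx : tsupport φx ⊆ tsupport φ := tsupport_fderiv_apply_subset ℝ (1, 0)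
  have sxx : tsupport φxx ⊆ tsupport φ := (tsupport_fderiv_apply_subset ℝ (1, 0)).trans sx
  have ct := hc.fderiv_apply (𝕜 := ℝ) (0, 1)
  have cx := hc.fderiv_apply (𝕜 := ℝ) (1, 0)
  have cxx := cx.fderiv_apply (𝕜 := ℝ) (1, 0)
  obtain ⟨K0, k0⟩ := hc.exists_bound_of_continuous h.continuous
  obtain ⟨Kt, kt⟩ := ct.exists_bound_of_continuous hφt'.continuous
  obtain ⟨Kx, kx⟩ := cx.exists_bound_of_continuous hφx'.continuous
  obtain ⟨Kxx, kxx⟩ := cxx.exists_bound_of_continuous hφxx'.continuous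
  obtain ⟨R, hR⟩ := hc.isBounded.subset_closedBall 0
  refine ⟨φt, φx, φxx, max (max K0 Kt) (max Kx Kxx), R, h.continuous, hφt'.continuous, hφx'.continuous,
    hφxx'.continuous, fun p => (k0 p).trans (by simp), fun p => (kt p).trans (by simp),
    fun p => (kx p).trans (by simp), fun p => (kxx p).trans (by simp), ?_, ?_, ?_, ?_⟩
  · intro p hp
    have hn : p ∉ tsupport φ := by
      intro hm
      rcases hp with hp | hp
      · have h1 := hR hm
        rw [mem_closedBall_zero_iff] at h1
        exact hp ⟨abs_le.1 ((norm_fst_le p).trans h1), abs_le.1 ((norm_snd_le p).trans h1)⟩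
      · exact absurd (hT hm) (by simpa using hp)
    exact ⟨image_eq_zero_of_notMem_tsupport hn, image_eq_zero_of_notMem_tsupport fun hh => hn (st hh),
      image_eq_zero_of_notMem_tsupport fun hh => hn (sx hh), image_eq_zero_of_notMem_tsupport fun hh => hn (sxx hh)⟩
  · intro x t
    exact ((h.differentiable (by simp)) (x, t)).hasFDerivAt.comp_hasDerivAt t
      ((hasDerivAt_const t x).prodMk (hasDerivAt_id t))
  · intro x t
    exact HasFDerivAt.comp_hasDerivAt (f := fun y : ℝ => (y, t)) x ((h.differentiable (by simp)) (x, t)).hasFDerivAt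
      ((hasDerivAt_id x).prodMk (hasDerivAt_const x t))
  · intro x t
    exact HasFDerivAt.comp_hasDerivAt (f := fun y : ℝ => (y, t)) x ((hφx'.differentiable (by simp)) (x, t)).hasFDerivAt
      ((hasDerivAt_id x).prodMk (hasDerivAt_const x t))

lemma mvt1 {g g' : ℝ → ℝ} (h : ∀ x, HasDerivAt g (g' x) x) (x : ℝ) {d : ℝ} (hd : 0 < d) :
    ∃ ξ ∈ Icc x (x + d), (g (x + d) - g x) / d = g' ξ := by
  obtain ⟨c, hc, h1⟩ := exists_hasDerivAt_eq_slope g g' (show x < x + d by linarith)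
    (fun y _ => (h y).continuousAt.continuousWithinAt) (fun y _ => h y)
  refine ⟨c, ⟨hc.1.le, hc.2.le⟩, ?_⟩
  rw [h1]; simp

lemma mvt2 {g g' g'' : ℝ → ℝ} (h : ∀ x, HasDerivAt g (g' x) x) (h' : ∀ x, HasDerivAt g' (g'' x) x) (x : ℝ) {d : ℝ}
    (hd : 0 < d) : ∃ ξ ∈ Icc (x - d) (x + d), (g (x + d) - 2 * g x + g (x - d)) / d ^ 2 = g'' ξ := by
  obtain ⟨c, hc, h1⟩ := mvt1 (g := fun y => g (y + d) - g y) (g' := fun y => g' (y + d) - g' y)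
    (fun y => ((h (y + d)).comp_add_const y d).sub (h y)) (x - d) hd
  obtain ⟨ξ, hξ, h2⟩ := mvt1 h' c hd
  refine ⟨ξ, ⟨by linarith [hc.1, hξ.1], by linarith [hc.2, hξ.2]⟩, ?_⟩
  rw [← h2, ← h1, sub_add_cancel]
  field_simp
  ring

lemma samp_le {D : ℝ} (hD : 0 < D) (x : ℝ) : D * ⌊x / D⌋ ≤ x ∧ x < D * ⌊x / D⌋ + D := by
  have h1 := Int.floor_le (x / D)
  have h2 := Int.lt_floor_add_one (x / D)
  rw [le_div_iff₀ hD] at h1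
  rw [div_lt_iff₀ hD] at h2
  constructor <;> nlinarith

/-- sampled test function -/
noncomputable def GG (φ : ℝ × ℝ → ℝ) (D τ : ℝ) (p : ℝ × ℝ) : ℝ :=
  if p.2 < 0 then 0 else φ (D * ⌊p.1 / D⌋, τ * ⌊p.2 / τ⌋)

lemma GG_meas {φ : ℝ × ℝ → ℝ} (h : Continuous φ) (D τ : ℝ) : Measurable (GG φ D τ) := by
  unfold GG
  refine Measurable.ite (measurableSet_lt measurable_snd measurable_const) measurable_const (h.measurable.comp ?_)
  refine Measurable.prodMk ?_ ?_
  · exact measurable_const.mul ((measurable_of_countable (fun n : ℤ => (n:ℝ))).comp ((measurable_floor_div D).comp measurable_fst))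
  · exact measurable_const.mul ((measurable_of_countable (fun n : ℤ => (n:ℝ))).comp ((measurable_floor_div τ).comp measurable_snd))

lemma coef_of {ψ : ℝ × ℝ → ℝ} {K R : ℝ} (hψ : Continuous ψ) (hK : ∀ p, |ψ p| ≤ K)
    (hs : ∀ p, p ∉ Bx R → ψ p = 0) {D τ : ℕ → ℝ} (hD : Tendsto D atTop (𝓝 0)) (hτ : Tendsto τ atTop (𝓝 0))
    (hD1 : ∀ j, D j ≤ 1) (hτ1 : ∀ j, τ j ≤ 1)
    {α : ℕ → ℝ × ℝ → ℝ} {β : ℝ × ℝ → ℝ} (hm : ∀ j, Measurable (α j))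
    (h1 : ∀ j p, α j p = 0 ∨ ∃ q : ℝ × ℝ, |q.1 - p.1| ≤ 2 * D j ∧ |q.2 - p.2| ≤ 2 * τ j ∧ α j p = ψ q)
    (h2 : ∀ p, (β p = 0 ∧ ∀ j, α j p = 0) ∨ (β p = ψ p ∧ ∀ᶠ j in atTop,
      ∃ q : ℝ × ℝ, |q.1 - p.1| ≤ 2 * D j ∧ |q.2 - p.2| ≤ 2 * τ j ∧ α j p = ψ q)) :
    Coef α β K (R + 2) := by
  have K0 : 0 ≤ K := (abs_nonneg _).trans (hK 0)
  refine ⟨fun j => ⟨hm j, fun p => ?_, fun p hp => ?_⟩, fun p => ?_⟩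
  · rcases h1 j p with h | ⟨q, _, _, h⟩
    · rw [h]; simpa
    · rw [h]; exact hK q
  · rcases h1 j p with h | ⟨q, a1, a2, h⟩
    · exact h
    · rw [h]
      refine hs q fun hq => hp ?_
      have := hD1 j
      have := hτ1 j
      obtain ⟨⟨b1, b2⟩, ⟨b3, b4⟩⟩ := hq
      rw [abs_le] at a1 a2
      exact ⟨⟨by linarith, by linarith⟩, ⟨by linarith, by linarith⟩⟩
  · rcases h2 p with ⟨hb, h⟩ | ⟨hb, h⟩
    · simp [hb, h]
    · rw [hb, Metric.tendsto_nhds]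
      intro e he
      obtain ⟨d, hd, hc⟩ := Metric.continuous_iff.1 hψ p e he
      have e1 : ∀ᶠ j in atTop, 2 * D j < d := by
        have : Tendsto (fun j => 2 * D j) atTop (𝓝 0) := by simpa using hD.const_mul 2
        exact this.eventually_lt_const hd
      have e2 : ∀ᶠ j in atTop, 2 * τ j < d := by
        have : Tendsto (fun j => 2 * τ j) atTop (𝓝 0) := by simpa using hτ.const_mul 2
        exact this.eventually_lt_const hd
      filter_upwards [h, e1, e2] with j hj h1 h2
      obtain ⟨q, a1, a2, h⟩ := hj
      rw [h]
      refine hc q ?_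
      rw [Prod.dist_eq, Real.dist_eq, Real.dist_eq]
      exact max_lt (a1.trans_lt h1) (a2.trans_lt h2)

variable {φ φt φx φxx : ℝ × ℝ → ℝ} {K R T : ℝ}

lemma GG_x (D τ : ℝ) (hD : 0 < D) (x t : ℝ) (ht : 0 ≤ t) :
    GG φ D τ ((x, t) + (D, 0)) = φ (D * ⌊x / D⌋ + D, τ * ⌊t / τ⌋) := by
  unfold GG
  simp only [Prod.mk_add_mk, add_zero, not_lt.2 ht, if_false]
  rw [add_div, div_self hD.ne', Int.floor_add_one]
  push_cast
  congr 2; ring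

lemma GG_x' (D τ : ℝ) (hD : 0 < D) (x t : ℝ) (ht : 0 ≤ t) :
    GG φ D τ ((x, t) - (D, 0)) = φ (D * ⌊x / D⌋ - D, τ * ⌊t / τ⌋) := by
  unfold GG
  simp only [Prod.mk_sub_mk, sub_zero, not_lt.2 ht, if_false]
  rw [sub_div, div_self hD.ne', Int.floor_sub_one]
  push_cast
  congr 2; ring

lemma GG_t (D τ : ℝ) (hτ : 0 < τ) (x t : ℝ) (ht : τ ≤ t) :
    GG φ D τ ((x, t) - (0, τ)) = φ (D * ⌊x / D⌋, τ * ⌊t / τ⌋ - τ) := by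
  unfold GG
  simp only [Prod.mk_sub_mk, sub_zero, not_lt.2 (sub_nonneg.2 ht), if_false]
  rw [sub_div, div_self hτ.ne', Int.floor_sub_one]
  push_cast
  congr 2; ring

lemma TF.coefs (h : TF φ φt φx φxx K R T) {D τ : ℕ → ℝ} (hD0 : ∀ j, 0 < D j) (hτ0 : ∀ j, 0 < τ j)
    (hD : Tendsto D atTop (𝓝 0)) (hτ : Tendsto τ atTop (𝓝 0))
    (hD1 : ∀ j, D j ≤ 1) (hτ1 : ∀ j, τ j ≤ 1) :
    Coef (fun j p => if p.2 < τ j then 0 else (GG φ (D j) (τ j) p - GG φ (D j) (τ j) (p - (0, τ j))) / τ j)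
      (fun p => if p.2 ≤ 0 then 0 else φt p) K (R + 2) ∧
    Coef (fun j p => (GG φ (D j) (τ j) (p + (D j, 0)) - GG φ (D j) (τ j) p) / D j)
      (fun p => if p.2 < 0 then 0 else φx p) K (R + 2) ∧
    Coef (fun j p => (GG φ (D j) (τ j) (p + (D j, 0)) - 2 * GG φ (D j) (τ j) p + GG φ (D j) (τ j) (p - (D j, 0))) / D j ^ 2)
      (fun p => if p.2 < 0 then 0 else φxx p) K (R + 2) ∧
    Coef (fun j => GG φ (D j) (τ j)) (fun p => if p.2 < 0 then 0 else φ p) K (R + 2) := by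
  have mG := fun j => GG_meas h.c0 (D j) (τ j)
  have mGe := fun j (e : ℝ × ℝ) => (mG j).comp (f := fun p : ℝ × ℝ => p + e) (by fun_prop)
  have mGe' := fun j (e : ℝ × ℝ) => (mG j).comp (f := fun p : ℝ × ℝ => p - e) (by fun_prop)
  have near : ∀ j t, |τ j * ⌊t / τ j⌋ - t| ≤ 2 * τ j := fun j t => by
    have := samp_le (hτ0 j) t
    have := hτ0 j
    rw [abs_le]; constructor <;> linarith
  have nearx : ∀ j x, |D j * ⌊x / D j⌋ - x| ≤ 2 * D j := fun j t => by
    have := samp_le (hD0 j) t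
    have := hD0 j
    rw [abs_le]; constructor <;> linarith
  have neg0 : ∀ j x t, t < 0 → ∀ y, GG φ (D j) (τ j) (x + y, t) = 0 := fun j x t ht y => by
    simp [GG, ht]
  refine ⟨?_, ?_, ?_, ?_⟩
  · have key : ∀ j p, ¬ p.2 < τ j → ∃ q : ℝ × ℝ, |q.1 - p.1| ≤ 2 * D j ∧ |q.2 - p.2| ≤ 2 * τ j ∧
        (GG φ (D j) (τ j) p - GG φ (D j) (τ j) (p - (0, τ j))) / τ j = φt q := by
      rintro j ⟨x, t⟩ ht
      rw [not_lt] at ht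
      simp only at ht
      obtain ⟨ξ, hξ, e⟩ := mvt1 (h.dt (D j * ⌊x / D j⌋)) (τ j * ⌊t / τ j⌋ - τ j) (hτ0 j)
      refine ⟨(D j * ⌊x / D j⌋, ξ), nearx j x, ?_, ?_⟩
      · have := samp_le (hτ0 j) t
        have := hτ0 j
        obtain ⟨q1, q2⟩ := hξ
        simp only
        rw [abs_le]; constructor <;> linarith
      · rw [GG_t _ _ (hτ0 j) x t ht, ← e, sub_add_cancel]
        simp [GG, not_lt.2 ((hτ0 j).le.trans ht)]
    refine coef_of h.ct h.bt (fun p hp => (h.s p (Or.inl hp)).2.1) hD hτ hD1 hτ1 (fun j => ?_) (fun j p => ?_) (fun p => ?_)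
    · exact Measurable.ite (measurableSet_lt measurable_snd measurable_const) measurable_const
        (((mG j).sub (mGe' j _)).div_const _)
    · by_cases hp : p.2 < τ j
      · left; simp [hp]
      · right; simpa only [hp, if_false] using key j p hp
    · by_cases hp : p.2 ≤ 0
      · left
        simp only [hp, if_true, true_and]
        intro j
        simp [hp.trans_lt (hτ0 j)]
      · right
        simp only [hp, if_false, true_and]
        rw [not_le] at hp
        filter_upwards [hτ.eventually_lt_const hp] with j hj
        simpa only [not_lt.2 hj.le, if_false] using key j p (not_lt.2 hj.le)
  · have key : ∀ j p, ¬ p.2 < 0 → ∃ q : ℝ × ℝ, |q.1 - p.1| ≤ 2 * D j ∧ |q.2 - p.2| ≤ 2 * τ j ∧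
        (GG φ (D j) (τ j) (p + (D j, 0)) - GG φ (D j) (τ j) p) / D j = φx q := by
      rintro j ⟨x, t⟩ ht
      rw [not_lt] at ht
      simp only at ht
      obtain ⟨ξ, hξ, e⟩ := mvt1 (fun y => h.dx y (τ j * ⌊t / τ j⌋)) (D j * ⌊x / D j⌋) (hD0 j)
      refine ⟨(ξ, τ j * ⌊t / τ j⌋), ?_, near j t, ?_⟩
      · have := samp_le (hD0 j) x
        have := hD0 j
        obtain ⟨q1, q2⟩ := hξ
        simp only
        rw [abs_le]; constructor <;> linarith
      · rw [GG_x _ _ (hD0 j) x t ht, ← e]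
        simp [GG, not_lt.2 ht]
    have z : ∀ j (p : ℝ × ℝ), p.2 < 0 → (GG φ (D j) (τ j) (p + (D j, 0)) - GG φ (D j) (τ j) p) / D j = 0 := fun j p hp => by
      simp [GG, hp]
    refine coef_of h.cx h.bx (fun p hp => (h.s p (Or.inl hp)).2.2.1) hD hτ hD1 hτ1 (fun j => ?_) (fun j p => ?_) (fun p => ?_)
    · exact ((mGe j _).sub (mG j)).div_const _
    · by_cases hp : p.2 < 0
      · left; exact z j p hp
      · right; exact key j p hp
    · by_cases hp : p.2 < 0
      · left; exact ⟨by simp [hp], fun j => z j p hp⟩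
      · right; exact ⟨by simp [hp], Eventually.of_forall fun j => key j p hp⟩
  · have key : ∀ j p, ¬ p.2 < 0 → ∃ q : ℝ × ℝ, |q.1 - p.1| ≤ 2 * D j ∧ |q.2 - p.2| ≤ 2 * τ j ∧
        (GG φ (D j) (τ j) (p + (D j, 0)) - 2 * GG φ (D j) (τ j) p + GG φ (D j) (τ j) (p - (D j, 0))) / D j ^ 2 = φxx q := by
      rintro j ⟨x, t⟩ ht
      rw [not_lt] at ht
      simp only at ht
      obtain ⟨ξ, hξ, e⟩ := mvt2 (fun y => h.dx y (τ j * ⌊t / τ j⌋)) (fun y => h.dxx y (τ j * ⌊t / τ j⌋))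
        (D j * ⌊x / D j⌋) (hD0 j)
      refine ⟨(ξ, τ j * ⌊t / τ j⌋), ?_, near j t, ?_⟩
      · have := samp_le (hD0 j) x
        have := hD0 j
        obtain ⟨q1, q2⟩ := hξ
        simp only
        rw [abs_le]; constructor <;> linarith
      · rw [GG_x _ _ (hD0 j) x t ht, GG_x' _ _ (hD0 j) x t ht, ← e]
        simp [GG, not_lt.2 ht]
    have z : ∀ j (p : ℝ × ℝ), p.2 < 0 → (GG φ (D j) (τ j) (p + (D j, 0)) - 2 * GG φ (D j) (τ j) p
        + GG φ (D j) (τ j) (p - (D j, 0))) / D j ^ 2 = 0 := fun j p hp => by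
      simp [GG, hp]
    refine coef_of h.cxx h.bxx (fun p hp => (h.s p (Or.inl hp)).2.2.2) hD hτ hD1 hτ1 (fun j => ?_) (fun j p => ?_) (fun p => ?_)
    · exact (((mGe j _).sub ((mG j).const_mul 2)).add (mGe' j _)).div_const _
    · by_cases hp : p.2 < 0
      · left; exact z j p hp
      · right; exact key j p hp
    · by_cases hp : p.2 < 0
      · left; exact ⟨by simp [hp], fun j => z j p hp⟩
      · right; exact ⟨by simp [hp], Eventually.of_forall fun j => key j p hp⟩
  · have key : ∀ j p, ¬ p.2 < 0 → ∃ q : ℝ × ℝ, |q.1 - p.1| ≤ 2 * D j ∧ |q.2 - p.2| ≤ 2 * τ j ∧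
        GG φ (D j) (τ j) p = φ q := by
      rintro j ⟨x, t⟩ ht
      exact ⟨(D j * ⌊x / D j⌋, τ j * ⌊t / τ j⌋), nearx j x, near j t, by simp only at ht; simp [GG, ht]⟩
    have z : ∀ j (p : ℝ × ℝ), p.2 < 0 → GG φ (D j) (τ j) p = 0 := fun j p hp => by
      simp [GG, hp]
    refine coef_of h.c0 h.b0 (fun p hp => (h.s p (Or.inl hp)).1) hD hτ hD1 hτ1 (fun j => mG j) (fun j p => ?_) (fun p => ?_)
    · by_cases hp : p.2 < 0
      · left; exact z j p hp
      · right; exact key j p hp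
    · by_cases hp : p.2 < 0
      · left; exact ⟨by simp [hp], fun j => z j p hp⟩
      · right; exact ⟨by simp [hp], Eventually.of_forall fun j => key j p hp⟩

end DDG

namespace DDG
open MeasureTheory Filter Set
open scoped ENNReal Topology

variable {φ φt φx φxx : ℝ × ℝ → ℝ} {K R T : ℝ}

lemma time_split {D τ : ℝ} (hτ : 0 < τ) {v : ℝ → ℝ → ℝ} (hv : Measurable fun p : ℝ × ℝ => v p.1 p.2)
    {C : ℝ} (hb : ∀ x t, |v x t| ≤ C) (h0 : ∀ x t, 0 ≤ t → t < τ → v x t = v x 0) (κ : ℝ)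
    (hG : BS (GG φ D τ) K R)
    (hα : BS (fun p => if p.2 < τ then 0 else (GG φ D τ p - GG φ D τ (p - (0, τ))) / τ) K R) :
    (∫ p, (GG φ D τ p - GG φ D τ (p - (0, τ))) / τ * |v p.1 p.2 - κ|) =
      (∫ p, (if p.2 < τ then 0 else (GG φ D τ p - GG φ D τ (p - (0, τ))) / τ) * |v p.1 p.2 - κ|)
      + ∫ x, GG φ D τ (x, 0) * |v x 0 - κ| := by
  have mF : Measurable fun p : ℝ × ℝ => |v p.1 p.2 - κ| := (hv.sub_const κ).abs
  have bF : ∀ p : ℝ × ℝ, |(|v p.1 p.2 - κ|)| ≤ C + |κ| := fun p => by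
    rw [abs_abs]
    exact (abs_sub _ _).trans (by linarith [hb p.1 p.2])
  set ind : ℝ → ℝ := (Ico 0 τ).indicator fun _ => 1 / τ with hind
  have mi : Measurable ind := measurable_const.indicator measurableSet_Ico
  have bi : ∀ t, |ind t| ≤ 1 / τ := fun t => by
    rw [hind, indicator]
    split_ifs
    · rw [abs_of_pos (by positivity)]
    · simp [hτ.le]
  have I1 := hα.int mF bF
  have I2 : Integrable fun p : ℝ × ℝ => GG φ D τ p * (|v p.1 p.2 - κ| * ind p.2) := by
    refine hG.int (K' := (C + |κ|) * (1 / τ)) (mF.mul (mi.comp measurable_snd)) fun p => ?_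
    rw [abs_mul]
    exact mul_le_mul (bF p) (bi _) (abs_nonneg _) ((abs_nonneg _).trans (bF p))
  have e1 : ∀ p : ℝ × ℝ, GG φ D τ p * (|v p.1 p.2 - κ| * ind p.2) = (GG φ D τ (p.1, 0) * |v p.1 0 - κ|) * ind p.2 := by
    rintro ⟨x, t⟩
    by_cases ht : t ∈ Ico 0 τ
    · have hf : ⌊t / τ⌋ = 0 := by
        rw [Int.floor_eq_zero_iff]
        exact ⟨div_nonneg ht.1 hτ.le, (div_lt_one hτ).2 ht.2⟩
      simp only [h0 x t ht.1 ht.2]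
      have : GG φ D τ (x, t) = GG φ D τ (x, 0) := by
        simp [GG, hf, not_lt.2 ht.1]
      rw [this]; ring
    · simp [hind, ht]
  have e2 : (∫ p : ℝ × ℝ, GG φ D τ p * (|v p.1 p.2 - κ| * ind p.2)) = ∫ x, GG φ D τ (x, 0) * |v x 0 - κ| := by
    simp_rw [e1]
    rw [Measure.volume_eq_prod, integral_prod_mul (fun x => GG φ D τ (x, 0) * |v x 0 - κ|) ind]
    have : ∫ t, ind t = 1 := by
      rw [hind, integral_indicator measurableSet_Ico]
      simp [hτ.le, hτ.ne']
    rw [this, mul_one]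
  rw [← e2, ← integral_add I1 I2]
  congr 1
  ext ⟨x, t⟩
  by_cases h1 : t < 0
  · simp [GG, h1, h1.trans hτ, (sub_neg.2 (h1.trans hτ))]
  · by_cases h2 : t < τ
    · have hi : ind t = 1 / τ := by simp [hind, h2, not_lt.1 h1]
      have : GG φ D τ ((x, t) - (0, τ)) = 0 := by simp [GG, h2]
      simp only [h2, if_true, hi, this]
      ring
    · have hi : ind t = 0 := by simp [hind, h2]
      simp only [h2, if_false, hi]
      ring

lemma init_lim {α : ℕ → ℝ × ℝ → ℝ} {β : ℝ × ℝ → ℝ} (h4 : Coef α β K R) {v : ℕ → ℝ → ℝ} {u₀ : ℝ → ℝ} (hbv : eVariationOn u₀ univ ≠ ⊤)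
    (hm : ∀ j, Measurable (v j)) {C : ℝ} (hb : ∀ j x, |v j x| ≤ C) {D : ℕ → ℝ} (hD : Tendsto D atTop (𝓝 0))
    (hp : ∀ j x, ∃ y, |y - x| ≤ D j ∧ v j x = u₀ y) (κ : ℝ) :
    Tendsto (fun j => ∫ x, α j (x, 0) * |v j x - κ|) atTop (𝓝 (∫ x, β (x, 0) * |u₀ x - κ|)) := by
  have K0 : 0 ≤ K := (h4.bs 0).K0
  refine tendsto_integral_of_dominated_convergence ((Icc (-R) R).indicator fun _ => K * (C + |κ|)) (fun j => ?_) ?_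
    (fun j => Eventually.of_forall fun x => ?_) ?_
  · exact ((((h4.bs j).meas).comp (f := fun x : ℝ => (x, (0:ℝ))) (by fun_prop)).mul ((hm j).sub_const κ).abs).aestronglyMeasurable
  · rw [integrable_indicator_iff measurableSet_Icc]
    exact integrableOn_const (by simp)
  · by_cases hx : x ∈ Icc (-R) R
    · rw [indicator_of_mem hx, norm_mul]
      refine mul_le_mul ((h4.bs j).bd _) ?_ (norm_nonneg _) K0
      rw [Real.norm_eq_abs, abs_abs]
      exact (abs_sub _ _).trans (by linarith [hb j x])
    · rw [indicator_of_notMem hx, (h4.bs j).supp (x, 0) (fun h => hx h.1)]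
      simp
  · filter_upwards [bv_ae_continuousAt hbv] with x hx
    refine (h4.lim _).mul (Tendsto.abs (Tendsto.sub_const ?_ κ))
    choose y hy1 hy2 using fun j => hp j x
    refine Tendsto.congr (fun j => (hy2 j).symm) (hx.tendsto.comp ?_)
    rw [tendsto_iff_dist_tendsto_zero]
    exact squeeze_zero (fun _ => dist_nonneg) (fun j => hy1 j) hD

lemma gamma_cont {g : ℝ → ℝ} (hg : Integrable g) {u₀ : ℝ → ℝ} (hm : Measurable u₀) {B : ℝ} (hB : ∀ x, |u₀ x| ≤ B) :
    Continuous fun κ => ∫ x, g x * |u₀ x - κ| := by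
  have I : ∀ κ, Integrable fun x => g x * |u₀ x - κ| := fun κ => by
    refine hg.mul_bdd (c := B + |κ|) (hm.sub_const κ).abs.aestronglyMeasurable (Eventually.of_forall fun x => ?_)
    rw [Real.norm_eq_abs, abs_abs]
    exact (abs_sub _ _).trans (by linarith [hB x])
  refine (LipschitzWith.of_dist_le_mul (K := (∫ x, |g x|).toNNReal) fun κ κ' => ?_).continuous
  rw [Real.dist_eq, ← integral_sub (I κ) (I κ'), Real.coe_toNNReal _ (integral_nonneg fun x => abs_nonneg _),
    ← integral_mul_const]
  rw [← Real.norm_eq_abs]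
  refine norm_integral_le_of_norm_le (hg.abs.mul_const (dist κ κ')) (Eventually.of_forall fun x => ?_)
  rw [← mul_sub, norm_mul]
  refine mul_le_mul_of_nonneg_left ?_ (abs_nonneg _)
  refine (abs_abs_sub_abs_le _ _).trans ?_
  rw [Real.dist_eq, abs_sub_comm κ κ']
  exact le_of_eq (by congr 1; ring)

lemma Qf_diag {f a : ℝ → ℝ} {fh : ℝ → ℝ → ℝ} (data : SchemeData f a fh) (κ u : ℝ) :
    Qf fh κ u u = Real.sign (u - κ) * (f u - f κ) := by
  unfold Qf
  rw [data.hconsistent, data.hconsistent]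
  rcases lt_trichotomy u κ with h | h | h
  · rw [max_eq_right h.le, min_eq_left h.le, Real.sign_of_neg (by linarith)]; ring
  · simp [h]
  · rw [max_eq_left h.le, min_eq_right h.le, Real.sign_of_pos (by linarith)]; ring

lemma ent_final {c l b C : ℝ} {f a : ℝ → ℝ} {fh : ℝ → ℝ → ℝ} {u₀ : ℝ → ℝ} (hl : l ∈ Ioo (0:ℝ) 1) (data : SchemeData f a fh)
    (hbv : eVariationOn u₀ univ ≠ ⊤) {ε D τ : ℕ → ℝ} {V : ℕ → ℤ → ℝ} {C0 : ℝ}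
    (H : ∀ j, Hyp c l (D j) (τ j) b f a fh)
    (hV : ∀ j, InitOK c l (D j) (τ j) b a fh u₀ C0 (V j))
    (hD : Tendsto D atTop (𝓝 0)) (hτ : Tendsto τ atTop (𝓝 0)) (hD1 : ∀ j, D j ≤ 1) (hτ1 : ∀ j, τ j ≤ 1)
    (hs : CompSeq (Aint a) C ε (fun j => vW (D j) (τ j) (itr c l (D j) (τ j) b fh a (V j))))
    {u : ℝ → ℝ → ℝ}
    (hu : CompLim (Aint a) C (fun j => vW (D j) (τ j) (itr c l (D j) (τ j) b fh a (V j))) u)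
    (κ : ℝ) (φ : ℝ → ℝ → ℝ)
    (hφ : ContDiff ℝ (⊤ : ℕ∞) (fun p : ℝ × ℝ => φ p.1 p.2)) (hφc : HasCompactSupport (fun p : ℝ × ℝ => φ p.1 p.2))
    (hφ0 : ∀ x t : ℝ, 0 ≤ φ x t)
    (hφT : tsupport (fun p : ℝ × ℝ => φ p.1 p.2) ⊆ {p : ℝ × ℝ | p.2 < T}) :
    0 ≤ (∫ p in (Set.univ ×ˢ Set.Ioo (0 : ℝ) T : Set (ℝ × ℝ)),
          (|u p.1 p.2 - κ| * deriv (fun s => φ p.1 s) p.2 +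
           Real.sign (u p.1 p.2 - κ) * (f (u p.1 p.2) - f κ) * deriv (fun y => φ y p.2) p.1 +
           |Aint a (u p.1 p.2) - Aint a κ| * iteratedDeriv 2 (fun y => φ y p.2) p.1 +
           b * Real.sign (u p.1 p.2 - κ) * fracLap c l (fun y => u y p.2) p.1 * φ p.1 p.2)) +
      ∫ x : ℝ, |u₀ x - κ| * φ x 0 := by
  obtain ⟨φt, φx, φxx, K, R, hTF⟩ := TF.ext hφ hφc hφT
  set Φ : ℝ × ℝ → ℝ := fun p => φ p.1 p.2 with hΦ
  have hD0 := fun j => (H j).hD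
  have hτ0 := fun j => (H j).hτ
  obtain ⟨k1, k2, k3, k4⟩ := hTF.coefs hD0 hτ0 hD hτ hD1 hτ1
  obtain ⟨Ma, hMa0, hMa⟩ := a_bdd data
  obtain ⟨K1, hK10, hK1⟩ := fh_lip data
  obtain ⟨B, hB⟩ := bv_bdd hbv
  have hfh : Continuous fun p : ℝ × ℝ => fh p.1 p.2 := by
    obtain ⟨L, hL⟩ := data.hfhatLip
    exact hL.continuous
  have hA : ∀ x y, |Aint a x - Aint a y| ≤ Ma * |x - y| := fun x y => A_lip data hMa _ _
  have hcs : Integrable fun x : ℝ => Φ (x, 0) := by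
    have h1 : Integrable ((Icc (-R) R).indicator fun x => Φ (x, 0)) := by
      rw [integrable_indicator_iff measurableSet_Icc]
      exact (hTF.c0.comp (by fun_prop)).continuousOn.integrableOn_compact isCompact_Icc
    convert h1 using 1
    ext x
    by_cases hx : x ∈ Icc (-R) R
    · rw [indicator_of_mem hx]
    · rw [indicator_of_notMem hx]
      exact (hTF.s (x, 0) (Or.inl fun h => hx h.1)).1
  have hall := ent_all (b := b) (c := c) (l := l) (fh := fh) hl hfh hK10 hK1 hMa0 hA hs.Ac hu k1.bs0 k2.bs0 k3.bs0 k4.bs0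
    (gamma_cont hcs (bv_measurable hbv) hB) (fun κ hκ => by
      have hil := init_lim k4 hbv
        (v := fun j x => vW (D j) (τ j) (itr c l (D j) (τ j) b fh a (V j)) x 0)
        (fun j => (hs.meas j).comp (f := fun x : ℝ => (x, (0:ℝ))) (by fun_prop)) (fun j x => hs.bd j x 0) hD
        (fun j x => by
          obtain ⟨y, h1, h2⟩ := (hV j).pt x
          refine ⟨y, h1, ?_⟩
          rw [← h2]
          simp [vW, pc, itr]) κ
      simp only [lt_irrefl, if_false] at hil
      refine ent_limit hl hfh hK10 hK1 hMa0 hA hs hu hD hτ k1 k2 k3 k4 hil hκ fun j => ?_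
      rw [← time_split (hτ0 j) (hs.meas j) (hs.bd j) (fun x t h1 h2 => by
        have hf : ⌊t / τ j⌋ = 0 := by
          rw [Int.floor_eq_zero_iff]
          exact ⟨div_nonneg h1 (hτ0 j).le, (div_lt_one (hτ0 j)).2 h2⟩
        simp [vW, hf]) κ (k4.bs j) (k1.bs j)]
      refine disc_entropy (C := C) (e := ε j) (H j) (fun n => (H j).itr_summable (hV j).sm n) (fun n => rfl)
        ⟨hs.meas j, hs.l1 j, hs.tv j, hs.bd j, hs.time j, hs.lip j⟩ (hD1 j) (hτ1 j) κ (k4.bs j) (fun p => ?_) (fun p hp => ?_)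
        (k := fun i t => if t < 0 then 0 else Φ (D j * i, τ j * ⌊t / τ j⌋)) (fun p => rfl)
      · unfold GG
        split_ifs
        · exact le_rfl
        · exact hφ0 _ _
      · simp [GG, hp]) κ
  have mu := hu.meas
  have ms : Measurable fun p : ℝ × ℝ => Real.sign (u p.1 p.2 - κ) := sign_measurable.comp (mu.sub_const κ)
  have bu : ∀ p : ℝ × ℝ, |u p.1 p.2 - κ| ≤ C + |κ| := fun p => (abs_sub _ _).trans (by linarith [hu.bd p.1 p.2])
  have i1 := k1.bs0.int (mu.sub_const κ).abs (K' := C + |κ|) (fun p => by rw [abs_abs]; exact bu p)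
  have i2 : Integrable fun p : ℝ × ℝ => (if p.2 < 0 then 0 else φx p) * Qf fh κ (u p.1 p.2) (u p.1 p.2) := by
    refine k2.bs0.int (F := fun p => Qf fh κ (u p.1 p.2) (u p.1 p.2)) (K' := K1 * ((C + |κ|) + (C + |κ|))) ?_ (fun p => ?_)
    · unfold Qf
      exact (hfh.measurable.comp ((mu.max measurable_const).prodMk (mu.max measurable_const))).sub
        (hfh.measurable.comp ((mu.min measurable_const).prodMk (mu.min measurable_const)))
    · refine (Qf_bd hK1 κ _ _).trans ?_
      exact mul_le_mul_of_nonneg_left (add_le_add (bu p) (bu p)) hK10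
  have i3 := k3.bs0.int (F := fun p => |Aint a (u p.1 p.2) - Aint a κ|) ((hs.Ac.measurable.comp mu).sub_const _).abs
    (K' := Ma * (C + |κ|)) (fun p => by
      rw [abs_abs]; exact (hA _ _).trans (mul_le_mul_of_nonneg_left (bu p) hMa0))
  have i4 : Integrable fun p : ℝ × ℝ => (if p.2 < 0 then 0 else Φ p) * (Real.sign (u p.1 p.2 - κ) * fracLap c l (fun y => u y p.2) p.1) := by
    have := (k4.bs0.mul ms (fun p => abs_sign_le _)).int1 (fl_measurable2 hu.meas c l)
      (B := ‖c‖ₑ * (2 * ENNReal.ofReal C * HK l))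
      (ENNReal.mul_ne_top (by simp) (ENNReal.mul_ne_top (ENNReal.mul_ne_top (by simp) (by simp)) (HK_lt_top hl).ne))
      (fun t => (hu.nice t).fl_l1 c l)
    simpa only [mul_assoc] using this
  have mS : MeasurableSet (Set.univ ×ˢ Set.Ioo (0 : ℝ) T : Set (ℝ × ℝ)) := MeasurableSet.univ.prod measurableSet_Ioo
  have ht0 : ∀ᵐ p : ℝ × ℝ, p.2 ≠ 0 := by
    rw [Measure.volume_eq_prod]
    exact Measure.quasiMeasurePreserving_snd.ae (Measure.ae_ne volume (0:ℝ))
  rw [← integral_indicator mS]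
  have key : (∫ p : ℝ × ℝ, (Set.univ ×ˢ Set.Ioo (0 : ℝ) T : Set (ℝ × ℝ)).indicator (fun p => (|u p.1 p.2 - κ| * deriv (fun s => φ p.1 s) p.2 +
           Real.sign (u p.1 p.2 - κ) * (f (u p.1 p.2) - f κ) * deriv (fun y => φ y p.2) p.1 +
           |Aint a (u p.1 p.2) - Aint a κ| * iteratedDeriv 2 (fun y => φ y p.2) p.1 +
           b * Real.sign (u p.1 p.2 - κ) * fracLap c l (fun y => u y p.2) p.1 * φ p.1 p.2)) p) =
      ∫ p : ℝ × ℝ, ((((if p.2 ≤ 0 then 0 else φt p) * |u p.1 p.2 - κ| +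
        (if p.2 < 0 then 0 else φx p) * Qf fh κ (u p.1 p.2) (u p.1 p.2)) +
        (if p.2 < 0 then 0 else φxx p) * |Aint a (u p.1 p.2) - Aint a κ|) +
        b * ((if p.2 < 0 then 0 else Φ p) * (Real.sign (u p.1 p.2 - κ) * fracLap c l (fun y => u y p.2) p.1))) := by
    refine integral_congr_ae ?_
    filter_upwards [ht0] with p hp
    by_cases hm : p.2 ∈ Ioo 0 T
    · rw [indicator_of_mem (show p ∈ (Set.univ ×ˢ Set.Ioo (0 : ℝ) T : Set (ℝ × ℝ)) from ⟨mem_univ _, hm⟩)]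
      have d1 : deriv (fun s => φ p.1 s) p.2 = φt p := (hTF.dt p.1 p.2).deriv
      have d2 : ∀ x, deriv (fun y => φ y p.2) x = φx (x, p.2) := fun x => (hTF.dx x p.2).deriv
      have d3 : iteratedDeriv 2 (fun y => φ y p.2) p.1 = φxx p := by
        rw [iteratedDeriv_succ, iteratedDeriv_one, funext d2]
        exact (hTF.dxx p.1 p.2).deriv
      rw [d1, d2, d3, Qf_diag data, if_neg (not_le.2 hm.1), if_neg (not_lt.2 hm.1.le), if_neg (not_lt.2 hm.1.le),
        if_neg (not_lt.2 hm.1.le)]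
      simp only [hΦ, Prod.mk.eta]
      ring
    · rw [indicator_of_notMem (fun h => hm h.2)]
      rcases lt_or_ge p.2 0 with h | h
      · simp [h, h.le]
      · have hT' : T ≤ p.2 := by
          by_contra hc
          exact hm ⟨lt_of_le_of_ne h (Ne.symm hp), not_le.1 hc⟩
        obtain ⟨z1, z2, z3, z4⟩ := hTF.s p (Or.inr hT')
        simp [z1, z2, z3, z4]
  rw [key, integral_add (by exact (i1.add i2).add i3) (i4.const_mul b), integral_add (by exact i1.add i2) i3,
    integral_add i1 i2, integral_const_mul]
  have e0 : ∫ x : ℝ, |u₀ x - κ| * φ x 0 = ∫ x, Φ (x, 0) * |u₀ x - κ| := by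
    congr 1; ext x; simp only [hΦ]; ring
  rw [e0]
  linarith

end DDG

namespace DDG
open MeasureTheory Filter Set
open scoped ENNReal Topology

lemma conv_bd {θ s a00 a01 a10 a11 b00 b01 b10 b11 : ℝ} (h1 : 0 ≤ θ) (h2 : θ ≤ 1) (h3 : 0 ≤ s) (h4 : s ≤ 1) :
    |(a00 + (a01 - a00) * θ + (a10 - a00) * s + (a11 - a10 - a01 + a00) * θ * s) - b00| ≤
      ((((|a00 - b00| + |a01 - b01|) + |a10 - b10|) + |a11 - b11|) + (|b01 - b00| + |b01 - b00|))
        + (|b10 - b00| + |b11 - b01|) := by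
  have e : (a00 + (a01 - a00) * θ + (a10 - a00) * s + (a11 - a10 - a01 + a00) * θ * s) - b00 =
      ((1 - θ) * (1 - s)) * (a00 - b00) + (θ * (1 - s)) * ((a01 - b01) + (b01 - b00)) +
      ((1 - θ) * s) * ((a10 - b10) + (b10 - b00)) + (θ * s) * ((a11 - b11) + (b11 - b01) + (b01 - b00)) := by ring
  rw [e]
  have m : ∀ c x y : ℝ, 0 ≤ c → c ≤ 1 → |x| ≤ y → |c * x| ≤ y := fun c x y hc hc1 hx => by
    rw [abs_mul, abs_of_nonneg hc]
    have := abs_nonneg x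
    nlinarith
  have t1 := m ((1 - θ) * (1 - s)) (a00 - b00) _ (by nlinarith) (by nlinarith) le_rfl
  have t2 := m (θ * (1 - s)) ((a01 - b01) + (b01 - b00)) _ (by nlinarith) (by nlinarith) (abs_add_le _ _)
  have t3 := m ((1 - θ) * s) ((a10 - b10) + (b10 - b00)) _ (by nlinarith) (by nlinarith) (abs_add_le _ _)
  have t4 := m (θ * s) ((a11 - b11) + (b11 - b01) + (b01 - b00)) _ (by nlinarith) (by nlinarith) (abs_add_three _ _ _)
  refine (abs_add_le _ _).trans ((add_le_add_left (abs_add_three _ _ _) _).trans ?_)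
  linarith

/-- bound function for the interpolation error -/
noncomputable def Fb (U V : ℕ → ℤ → ℝ) (n : ℕ) (i : ℤ) : ℝ≥0∞ :=
  ((((‖U n i - V n i‖ₑ + ‖U n (i + 1) - V n (i + 1)‖ₑ) + ‖U (n + 1) i - V (n + 1) i‖ₑ)
    + ‖U (n + 1) (i + 1) - V (n + 1) (i + 1)‖ₑ) + (edist (V n (i + 1)) (V n i) + edist (V n (i + 1)) (V n i)))
    + (‖V (n + 1) i - V n i‖ₑ + ‖V (n + 1) (i + 1) - V n (i + 1)‖ₑ)

lemma interp_le (U V : ℕ → ℤ → ℝ) {D τ : ℝ} (hτ : 0 < τ) (x t : ℝ) (ht : 0 ≤ t) :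
    ‖interpBL D τ U x t - vW D τ V x t‖ₑ ≤ Fb U V ⌊t / τ⌋.toNat ⌊x / D⌋ := by
  have hn : ((⌊t / τ⌋.toNat : ℕ) : ℝ) = ⌊t / τ⌋ := by
    have : ((⌊t / τ⌋.toNat : ℕ) : ℤ) = ⌊t / τ⌋ := Int.toNat_of_nonneg (Int.floor_nonneg.2 (div_nonneg ht hτ.le))
    exact_mod_cast congrArg (fun z : ℤ => (z : ℝ)) this
  unfold interpBL vW Fb
  simp only
  simp only [edist_dist, Real.dist_eq, ← ofReal_norm, Real.norm_eq_abs]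
  rw [← ENNReal.ofReal_add (by positivity) (by positivity), ← ENNReal.ofReal_add (by positivity) (by positivity),
    ← ENNReal.ofReal_add (by positivity) (by positivity), ← ENNReal.ofReal_add (by positivity) (by positivity),
    ← ENNReal.ofReal_add (by positivity) (by positivity), ← ENNReal.ofReal_add (by positivity) (by positivity),
    ← ENNReal.ofReal_add (by positivity) (by positivity)]
  refine ENNReal.ofReal_le_ofReal (conv_bd ?_ ?_ ?_ ?_)
  · linarith [Int.floor_le (x / D)]
  · linarith [Int.lt_floor_add_one (x / D)]
  · rw [hn]; linarith [Int.floor_le (t / τ)]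
  · rw [hn]; linarith [Int.lt_floor_add_one (t / τ)]

lemma Fb_sum {c l D τ b C : ℝ} {f a : ℝ → ℝ} {fh : ℝ → ℝ → ℝ} {u₀ : ℝ → ℝ} {V : ℤ → ℝ} (hC : 0 ≤ C)
    (H : Hyp c l D τ b f a fh) (I : InitOK c l D τ b a fh u₀ C V) (n : ℕ) :
    ENNReal.ofReal D * ∑' i, Fb (Uiter c l D τ b fh a u₀) (itr c l D τ b fh a V) n i
      ≤ ENNReal.ofReal (6 * C * D + 2 * C * τ) := by
  have hU : Summable (Uiter c l D τ b fh a u₀ 0) := by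
    have : Summable fun i => Uiter c l D τ b fh a u₀ 0 i - V i :=
      enorm_summable (I.cl.trans_lt ENNReal.ofReal_lt_top).ne
    simpa using this.add I.sm
  have d : ∀ n, ∑' i, ‖Uiter c l D τ b fh a u₀ n i - itr c l D τ b fh a V n i‖ₑ ≤ ENNReal.ofReal C := fun n => by
    rw [Uiter_eq]
    exact (H.itr_contr hU I.sm n).trans I.cl
  have d' : ∀ n, ∑' i, ‖Uiter c l D τ b fh a u₀ n (i + 1) - itr c l D τ b fh a V n (i + 1)‖ₑ ≤ ENNReal.ofReal C := fun n => by
    rw [tsum_shift_int (fun i => ‖Uiter c l D τ b fh a u₀ n i - itr c l D τ b fh a V n i‖ₑ) 1]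
    exact d n
  have e := (H.itr_tv I.sm n).trans I.tv
  have g : ENNReal.ofReal D * ∑' i, ‖itr c l D τ b fh a V (n + 1) i - itr c l D τ b fh a V n i‖ₑ ≤ ENNReal.ofReal (C * τ) :=
    (mul_le_mul_right (H.itr_time I.sm n) _).trans I.tm
  have g' : ENNReal.ofReal D * ∑' i, ‖itr c l D τ b fh a V (n + 1) (i + 1) - itr c l D τ b fh a V n (i + 1)‖ₑ ≤ ENNReal.ofReal (C * τ) := by
    rw [tsum_shift_int (fun i => ‖itr c l D τ b fh a V (n + 1) i - itr c l D τ b fh a V n i‖ₑ) 1]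
    exact g
  unfold Fb
  simp only [ENNReal.tsum_add]
  rw [mul_add, mul_add (ENNReal.ofReal D) (∑' i, _) (∑' i, ‖itr c l D τ b fh a V (n + 1) (i + 1) - _‖ₑ)]
  refine (add_le_add (mul_le_mul_right (add_le_add (add_le_add (add_le_add (add_le_add (d n) (d' n)) (d (n + 1))) (d' (n + 1)))
    (add_le_add e e)) _) (add_le_add g g')).trans ?_
  have hD := H.hD.le
  have hτ := H.hτ.le
  rw [← ENNReal.ofReal_add (by positivity) (by positivity), ← ENNReal.ofReal_add (by positivity) (by positivity),
    ← ENNReal.ofReal_add (by positivity) (by positivity), ← ENNReal.ofReal_add (by positivity) (by positivity),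
    ← ENNReal.ofReal_add (by positivity) (by positivity), ← ENNReal.ofReal_mul hD,
    ← ENNReal.ofReal_add (by positivity) (by positivity)]
  exact ENNReal.ofReal_le_ofReal (by nlinarith)

lemma vF_meas (D τ : ℝ) (F : ℕ → ℤ → ℝ≥0∞) : Measurable fun p : ℝ × ℝ => F ⌊p.2 / τ⌋.toNat ⌊p.1 / D⌋ := by
  have h1 : Measurable fun q : ℤ × ℤ => F q.2.toNat q.1 := Measurable.of_discrete
  exact h1.comp (((measurable_floor_div D).comp measurable_fst).prodMk ((measurable_floor_div τ).comp measurable_snd))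

lemma interp_box {c l D τ b C : ℝ} {f a : ℝ → ℝ} {fh : ℝ → ℝ → ℝ} {u₀ : ℝ → ℝ} {V : ℤ → ℝ} (hC : 0 ≤ C)
    (H : Hyp c l D τ b f a fh) (I : InitOK c l D τ b a fh u₀ C V) {S : Set (ℝ × ℝ)} {R T : ℝ} (hSm : MeasurableSet S)
    (hS : S ⊆ Set.univ ×ˢ Set.Ioo (0 : ℝ) T) (hSR : S ⊆ Bx R) :
    ∫⁻ p in S, ‖interpBL D τ (Uiter c l D τ b fh a u₀) p.1 p.2 - vW D τ (itr c l D τ b fh a V) p.1 p.2‖ₑ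
      ≤ ENNReal.ofReal (6 * C * D + 2 * C * τ) * volume (Icc (-R) R) := by
  set U := Uiter c l D τ b fh a u₀
  set W := itr c l D τ b fh a V
  have mF : Measurable fun p : ℝ × ℝ => Fb U W ⌊p.2 / τ⌋.toNat ⌊p.1 / D⌋ := by
    exact vF_meas D τ (Fb U W)
  calc _ ≤ ∫⁻ p in S, Fb U W ⌊p.2 / τ⌋.toNat ⌊p.1 / D⌋ := by
        refine setLIntegral_mono' hSm fun p hp => ?_
        exact interp_le U W H.hτ p.1 p.2 (hS hp).2.1.le
    _ ≤ ∫⁻ p in Bx R, Fb U W ⌊p.2 / τ⌋.toNat ⌊p.1 / D⌋ := lintegral_mono_set hSR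
    _ = ∫⁻ t in Icc (-R) R, ∫⁻ x in Icc (-R) R, Fb U W ⌊t / τ⌋.toNat ⌊x / D⌋ := lintegral_Bx mF R
    _ ≤ ∫⁻ t in Icc (-R) R, ENNReal.ofReal (6 * C * D + 2 * C * τ) := by
        refine lintegral_mono fun t => ?_
        refine (setLIntegral_le_lintegral _ _).trans ?_
        rw [lintegral_floor H.hD (fun i => Fb U W ⌊t / τ⌋.toNat i)]
        exact Fb_sum hC H I _
    _ = _ := by simp

/-- The full conclusion for a family of grids with both mesh sizes tending to zero. -/
lemma core {c l b T : ℝ} {f a : ℝ → ℝ} {fh : ℝ → ℝ → ℝ} {u₀ : ℝ → ℝ} (hl : l ∈ Ioo (0:ℝ) 1) (data : SchemeData f a fh)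
    (hi : Integrable u₀) (hbv : eVariationOn u₀ univ ≠ ⊤)
    (hcompat : ∃ h : ℝ → ℝ, eVariationOn h Set.univ ≠ ⊤ ∧
      ∀ x : ℝ, Aint a (u₀ x) = Aint a (u₀ 0) +
        ∫ y in (0:ℝ)..x,
          (f (u₀ y) - b * (∫ s in (0:ℝ)..y, fracLap c l u₀ s) - h y)) (hT : 0 < T)
    {D τ : ℕ → ℝ} (H : ∀ j, Hyp c l (D j) (τ j) b f a fh)
    (hD : Tendsto D atTop (𝓝 0)) (hτ : Tendsto τ atTop (𝓝 0)) :
    ∃ ψ : ℕ → ℕ, StrictMono ψ ∧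
      ∃ u : ℝ → ℝ → ℝ,
        IntegrableOn (fun p : ℝ × ℝ => u p.1 p.2) (Set.univ ×ˢ Set.Ioo (0 : ℝ) T) ∧
        BoundedVarQT T u ∧
        (∀ K : Set (ℝ × ℝ), K ⊆ Set.univ ×ˢ Set.Ioo (0 : ℝ) T → IsCompact K →
          Filter.Tendsto
            (fun j : ℕ => ∫ p in K,
              |interpBL (D (ψ j)) (τ (ψ j)) (Uiter c l (D (ψ j)) (τ (ψ j)) b fh a u₀) p.1 p.2 - u p.1 p.2|)
            Filter.atTop (nhds 0)) ∧
        BVEntropySol l c b T f a u₀ u := by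
  obtain ⟨C0, hC0, hinit⟩ := init_data (c := c) (b := b) hl data hi hbv hcompat 1
  obtain ⟨C, hCC, hdb⟩ := disc_bounds (c := c) (b := b) (u₀ := u₀) hl data hC0
  have hC : 0 ≤ C := hC0.trans hCC
  obtain ⟨J, hJ⟩ : ∃ J, ∀ j ≥ J, D j ≤ 1 ∧ τ j ≤ 1 := by
    have := (hD.eventually_lt_const one_pos).and (hτ.eventually_lt_const one_pos)
    obtain ⟨J, hJ⟩ := eventually_atTop.1 this
    exact ⟨J, fun j hj => ⟨(hJ j hj).1.le, (hJ j hj).2.le⟩⟩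
  have hJ1 : ∀ j, D (j + J) ≤ 1 := fun j => (hJ _ (by omega)).1
  have hJ2 : ∀ j, τ (j + J) ≤ 1 := fun j => (hJ _ (by omega)).2
  choose V hV using fun j => hinit (D (j + J)) (τ (j + J)) (hJ1 j) (H _)
  have db := fun j => hdb _ _ _ (H (j + J)) (hV j)
  obtain ⟨Ma, hMa0, hMa⟩ := a_bdd data
  have hA : ∀ x y, |Aint a x - Aint a y| ≤ Ma * |x - y| := fun x y => A_lip data hMa _ _
  have hAc : Continuous (Aint a) := by
    refine (LipschitzWith.of_dist_le_mul (K := Ma.toNNReal) fun x y => ?_).continuous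
    rw [Real.coe_toNNReal _ hMa0]
    exact hA x y
  have hDJ : Tendsto (fun j => D (j + J)) atTop (𝓝 0) := hD.comp (tendsto_add_atTop_nat J)
  have hτJ : Tendsto (fun j => τ (j + J)) atTop (𝓝 0) := hτ.comp (tendsto_add_atTop_nat J)
  have hs : CompSeq (Aint a) C (fun j => D (j + J) + τ (j + J))
      (fun j => vW (D (j + J)) (τ (j + J)) (itr c l (D (j + J)) (τ (j + J)) b fh a (V j))) :=
    ⟨hC, hAc, by simpa using hDJ.add hτJ, fun j => add_nonneg (H _).hD.le (H _).hτ.le, fun j => (db j).meas,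
      fun j => (db j).l1, fun j => (db j).tv, fun j => (db j).bd, fun j => (db j).time, fun j => (db j).lip⟩
  obtain ⟨ψ, hψ, u, hu⟩ := hs.compact
  have hψt := hψ.tendsto_atTop
  have hs' : CompSeq (Aint a) C (fun j => D (ψ j + J) + τ (ψ j + J))
      (fun j => vW (D (ψ j + J)) (τ (ψ j + J)) (itr c l (D (ψ j + J)) (τ (ψ j + J)) b fh a (V (ψ j)))) :=
    ⟨hC, hAc, hs.eps.comp hψt, fun j => hs.eps0 _, fun j => hs.meas _,
      fun j => hs.l1 _, fun j => hs.tv _, fun j => hs.bd _, fun j => hs.time _, fun j => hs.lip _⟩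
  have hbvQ := hu.bvQT hC hT
  refine ⟨fun j => ψ j + J, hψ.add_const J, u, hu.int T, hbvQ, ?_, hu.int T, ⟨C, Eventually.of_forall fun p => hu.bd _ _⟩,
    hbvQ, ?_, Eventually.of_forall fun t => ⟨hu.intx t, hu.tv' t⟩, hu.fl_int c hl T, ?_⟩
  · intro S hS hSc
    obtain ⟨R, hR⟩ := hSc.isBounded.subset_closedBall 0
    have hSR : S ⊆ Bx R := fun p hp => by
      have h1 := hR hp
      rw [mem_closedBall_zero_iff] at h1
      exact ⟨abs_le.1 ((norm_fst_le p).trans h1), abs_le.1 ((norm_snd_le p).trans h1)⟩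
    have hSm : MeasurableSet S := hSc.measurableSet
    have L1 := box_v hs' hu R
    have L2 : Tendsto (fun j => ENNReal.ofReal (6 * C0 * D (ψ j + J) + 2 * C0 * τ (ψ j + J)) * volume (Icc (-R) R)) atTop (𝓝 0) := by
      have q1 : Tendsto (fun j => 6 * C0 * D (ψ j + J) + 2 * C0 * τ (ψ j + J)) atTop (𝓝 0) := by
        have := ((hDJ.comp hψt).const_mul (6 * C0)).add ((hτJ.comp hψt).const_mul (2 * C0))
        simpa using this
      have q2 := ENNReal.tendsto_ofReal q1
      rw [ENNReal.ofReal_zero] at q2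
      have := ENNReal.Tendsto.mul_const (b := volume (Icc (-R) R)) q2 (Or.inr (by simp))
      simpa using this
    have L := L2.add L1
    rw [add_zero] at L
    rw [tendsto_zero_iff_enorm_tendsto_zero]
    refine tendsto_of_tendsto_of_tendsto_of_le_of_le tendsto_const_nhds L (fun j => zero_le) fun j => ?_
    refine (enorm_integral_le_lintegral_enorm _).trans ?_
    have hm : Measurable fun p : ℝ × ℝ => ‖vW (D (ψ j + J)) (τ (ψ j + J)) (itr c l (D (ψ j + J)) (τ (ψ j + J)) b fh a (V (ψ j))) p.1 p.2
        - u p.1 p.2‖ₑ := ((hs'.meas j).sub hu.meas).enorm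
    calc _ ≤ ∫⁻ p in S, (‖interpBL (D (ψ j + J)) (τ (ψ j + J)) (Uiter c l (D (ψ j + J)) (τ (ψ j + J)) b fh a u₀) p.1 p.2
            - vW (D (ψ j + J)) (τ (ψ j + J)) (itr c l (D (ψ j + J)) (τ (ψ j + J)) b fh a (V (ψ j))) p.1 p.2‖ₑ +
            ‖vW (D (ψ j + J)) (τ (ψ j + J)) (itr c l (D (ψ j + J)) (τ (ψ j + J)) b fh a (V (ψ j))) p.1 p.2 - u p.1 p.2‖ₑ) := by
          refine lintegral_mono fun p => ?_
          rw [← Real.norm_eq_abs, enorm_norm]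
          refine le_trans (le_of_eq ?_) (enorm_add_le _ _)
          congr 1; ring
      _ = _ := lintegral_add_right _ hm
      _ ≤ _ := add_le_add (interp_box hC0 (H _) (hV _) hSm hS hSR) (lintegral_mono_set hSR)
  · obtain ⟨cA, h⟩ := hu.holder hC hMa0 hA
    exact ⟨cA, Eventually.of_forall fun q => h _ _ _ _⟩
  · intro κ φ h1 h2 h3 h4
    exact ent_final hl data hbv (fun j => H (ψ j + J)) (fun j => hV (ψ j)) (hDJ.comp hψt) (hτJ.comp hψt)
      (fun j => hJ1 _) (fun j => hJ2 _) hs' hu κ φ h1 h2 h3 h4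

end DDG

namespace DDG
open MeasureTheory Filter Set
open scoped ENNReal Topology

/-- Degenerate data: no evolution at all. -/
def Degen (a : ℝ → ℝ) (b : ℝ) (fh : ℝ → ℝ → ℝ) : Prop :=
  (∀ u v, deriv (fun s => fh s v) u = 0) ∧ (∀ u v, deriv (fun s => fh u s) v = 0) ∧ (∀ s, a s = 0) ∧ b = 0

lemma small_step {c l b : ℝ} {f a : ℝ → ℝ} {fh : ℝ → ℝ → ℝ} {D τ : ℕ → ℝ} (H : ∀ j, Hyp c l (D j) (τ j) b f a fh)
    (hD : Tendsto D atTop (𝓝 0)) (hn : ¬ Degen a b fh) : Tendsto τ atTop (𝓝 0) := by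
  -- the individual terms of the CFL sum
  have t : ∀ j, (∀ u v, τ j / D j * |deriv (fun s => fh s v) u| ≤ 1) ∧ (∀ u v, τ j / D j * |deriv (fun s => fh u s) v| ≤ 1) ∧
      (∀ s, 2 * τ j / D j ^ 2 * |a s| ≤ 1) ∧ b * dlam c l * τ j / D j ^ l ≤ 1 := by
    intro j
    obtain ⟨-, M1, M2, Ma, h1, h2, h3, h4⟩ := (H j).cfl
    have hD := (H j).hD
    have hτ := (H j).hτ
    have M10 : 0 ≤ M1 := (abs_nonneg _).trans (h1 0 0)
    have M20 : 0 ≤ M2 := (abs_nonneg _).trans (h2 0 0)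
    have Ma0 : 0 ≤ Ma := (abs_nonneg _).trans (h3 0)
    have r : 0 ≤ τ j / D j := by positivity
    have r2 : 0 ≤ 2 * τ j / D j ^ 2 := by positivity
    have p1 := mul_nonneg r M10
    have p2 := mul_nonneg r M20
    have p3 := mul_nonneg r2 Ma0
    have p4 : 0 ≤ b * dlam c l * τ j / D j ^ l :=
      div_nonneg (mul_nonneg (mul_nonneg (H j).hb (dlam_pos (H j).hc (H j).hl).le) hτ.le) (Real.rpow_nonneg hD.le _)
    rw [mul_add] at h4
    refine ⟨fun u v => ?_, fun u v => ?_, fun s => ?_, by linarith⟩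
    · linarith [mul_le_mul_of_nonneg_left (h1 u v) r]
    · linarith [mul_le_mul_of_nonneg_left (h2 u v) r]
    · linarith [mul_le_mul_of_nonneg_left (h3 s) r2]
  have sq : ∀ g : ℕ → ℝ, Tendsto g atTop (𝓝 0) → (∀ j, τ j ≤ g j) → Tendsto τ atTop (𝓝 0) := fun g hg h =>
    squeeze_zero (fun j => (H j).hτ.le) h hg
  have lin : ∀ d : ℝ, d ≠ 0 → (∀ j, τ j / D j * |d| ≤ 1) → Tendsto τ atTop (𝓝 0) := by
    intro d hd h
    have hd' : 0 < |d| := abs_pos.2 hd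
    refine sq (fun j => D j / |d|) (by simpa using hD.div_const |d|) fun j => ?_
    have := h j
    rw [div_mul_eq_mul_div, div_le_one (H j).hD] at this
    rwa [le_div_iff₀ hd']
  by_cases h1 : ∃ u v, deriv (fun s => fh s v) u ≠ 0
  · obtain ⟨u, v, h⟩ := h1
    exact lin _ h fun j => (t j).1 u v
  by_cases h2 : ∃ u v, deriv (fun s => fh u s) v ≠ 0
  · obtain ⟨u, v, h⟩ := h2
    exact lin _ h fun j => (t j).2.1 u v
  by_cases h3 : ∃ s, a s ≠ 0
  · obtain ⟨s, h⟩ := h3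
    have hd' : 0 < |a s| := abs_pos.2 h
    refine sq (fun j => D j ^ 2 / (2 * |a s|)) (by simpa using (hD.pow 2).div_const (2 * |a s|)) fun j => ?_
    have := (t j).2.2.1 s
    rw [div_mul_eq_mul_div, div_le_one (pow_pos (H j).hD 2)] at this
    rw [le_div_iff₀ (by positivity)]
    linarith
  by_cases h4 : b = 0
  · push Not at h1 h2 h3
    exact absurd ⟨h1, h2, h3, h4⟩ hn
  · have hb : 0 < b := lt_of_le_of_ne (H 0).hb (Ne.symm h4)
    have hd := dlam_pos (H 0).hc (H 0).hl
    have hl0 := (H 0).hl.1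
    have hp : Tendsto (fun j => D j ^ l) atTop (𝓝 0) := by
      have := hD.rpow_const (p := l) (Or.inr hl0.le)
      rwa [Real.zero_rpow hl0.ne'] at this
    refine sq (fun j => D j ^ l / (b * dlam c l)) (by simpa using hp.div_const (b * dlam c l)) fun j => ?_
    have := (t j).2.2.2
    rw [div_le_one (Real.rpow_pos_of_pos (H j).hD _)] at this
    rw [le_div_iff₀ (by positivity)]
    linarith

lemma degen_fh {a : ℝ → ℝ} {b : ℝ} {fh : ℝ → ℝ → ℝ} (h : Degen a b fh)
    (hC : ContDiff ℝ 1 (fun p : ℝ × ℝ => fh p.1 p.2)) (u v u' v' : ℝ) : fh u v = fh u' v' := by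
  have d := hC.differentiable one_ne_zero
  have h1 : fh u v = fh u' v := by
    refine is_const_of_deriv_eq_zero (f := fun s => fh s v) ?_ (fun s => h.1 s v) u u'
    exact d.comp (f := fun s : ℝ => (s, v)) (by fun_prop)
  have h2 : fh u' v = fh u' v' := by
    refine is_const_of_deriv_eq_zero (f := fun s => fh u' s) ?_ (fun s => h.2.1 u' s) v v'
    exact d.comp (f := fun s : ℝ => (u', s)) (by fun_prop)
  rw [h1, h2]

lemma degen_iter {a : ℝ → ℝ} {b : ℝ} {fh : ℝ → ℝ → ℝ} (h : Degen a b fh)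
    (hC : ContDiff ℝ 1 (fun p : ℝ × ℝ => fh p.1 p.2)) (c l D τ : ℝ) (u₀ : ℝ → ℝ) (n : ℕ) :
    Uiter c l D τ b fh a u₀ n = fun i : ℤ => (1 / D) * ∫ x in Set.Ioo ((i : ℝ) * D) (((i : ℝ) + 1) * D), u₀ x := by
  have hA : ∀ x, Aint a x = 0 := fun x => by simp [Aint, h.2.2.1]
  induction n with
  | zero => rfl
  | succ n ih =>
    rw [← ih]
    ext i
    rw [Uiter]
    unfold schemeStep
    set U := Uiter c l D τ b fh a u₀ n
    rw [degen_fh h hC (U i) (U (i + 1)) (U (i - 1)) (U i), h.2.2.2]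
    simp [hA]

lemma degen_interp {a : ℝ → ℝ} {b : ℝ} {fh : ℝ → ℝ → ℝ} (h : Degen a b fh)
    (hC : ContDiff ℝ 1 (fun p : ℝ × ℝ => fh p.1 p.2)) (c l D τ τ' : ℝ) (u₀ : ℝ → ℝ) (x t : ℝ) :
    interpBL D τ (Uiter c l D τ b fh a u₀) x t = interpBL D τ' (Uiter c l D τ' b fh a u₀) x t := by
  unfold interpBL
  simp only [degen_iter h hC]
  generalize ⌊x / D⌋ = k
  ring

end DDG

/-- Convergence of the explicit DDG scheme (piecewise constant elements) to a BV entropy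
solution of `u_t + f(u)_x = (a(u)u_x)_x + b L[u]`: along any sequence of grids with
`Δx_j → 0` and `Δt_j = T/N_j` satisfying the CFL condition, a subsequence of the bilinear
interpolants converges in `L¹_loc(Q_T)` to a BV entropy solution. -/
theorem DDG_convergence_entropy (lam : ℝ) (hlam : lam ∈ Set.Ioo (0 : ℝ) 1)
    (clam : ℝ) (hclam : 0 < clam) (b : ℝ) (hb : 0 ≤ b)
    (f a : ℝ → ℝ) (fhat : ℝ → ℝ → ℝ)
    (hdata : SchemeData f a fhat) (hfC1 : ContDiff ℝ 1 f)
    (u₀ : ℝ → ℝ) (hu₀1 : Integrable u₀) (hu₀bv : eVariationOn u₀ Set.univ ≠ ⊤)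
    (hcompat : ∃ h : ℝ → ℝ, eVariationOn h Set.univ ≠ ⊤ ∧
      ∀ x : ℝ, Aint a (u₀ x) = Aint a (u₀ 0) +
        ∫ y in (0:ℝ)..x,
          (f (u₀ y) - b * (∫ s in (0:ℝ)..y, fracLap clam lam u₀ s) - h y))
    (T : ℝ) (hT : 0 < T)
    (Δxs : ℕ → ℝ) (hΔxs : ∀ j : ℕ, 0 < Δxs j)
    (hΔxs0 : Filter.Tendsto Δxs Filter.atTop (nhds 0))
    (Ns : ℕ → ℕ) (hNs : ∀ j : ℕ, 0 < Ns j)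
    (hcfl : ∀ j : ℕ, CFL clam lam (Δxs j) (T / (Ns j : ℝ)) b fhat a) :
    ∃ ψ : ℕ → ℕ, StrictMono ψ ∧
      ∃ u : ℝ → ℝ → ℝ,
        IntegrableOn (fun p : ℝ × ℝ => u p.1 p.2) (Set.univ ×ˢ Set.Ioo (0 : ℝ) T) ∧
        BoundedVarQT T u ∧
        (∀ K : Set (ℝ × ℝ), K ⊆ Set.univ ×ˢ Set.Ioo (0 : ℝ) T → IsCompact K →
          Filter.Tendsto
            (fun j : ℕ => ∫ p in K,
              |interpBL (Δxs (ψ j)) (T / (Ns (ψ j) : ℝ))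
                  (Uiter clam lam (Δxs (ψ j)) (T / (Ns (ψ j) : ℝ)) b fhat a u₀) p.1 p.2 -
                u p.1 p.2|)
            Filter.atTop (nhds 0)) ∧
        BVEntropySol lam clam b T f a u₀ u := by
  by_cases hdeg : DDG.Degen a b fhat
  · have hC1 := (hcfl 0).1
    have hH : ∀ j, DDG.Hyp clam lam (Δxs j) (T / ((Ns j : ℝ) * (j + 1))) b f a fhat := fun j => by
      refine ⟨hlam, hclam, hb, hΔxs j, ?_, hdata, hC1, 0, 0, 0, ?_, ?_, ?_, ?_⟩
      · have := hNs j
        positivity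
      · intro u v; simp [hdeg.1 u v]
      · intro u v; simp [hdeg.2.1 u v]
      · intro s; simp [hdeg.2.2.1 s]
      · simp [hdeg.2.2.2]
    have hτ : Tendsto (fun j : ℕ => T / ((Ns j : ℝ) * (j + 1))) atTop (nhds 0) := by
      refine squeeze_zero (fun j => (hH j).hτ.le) (fun j => ?_) (g := fun j : ℕ => T * (1 / ((j : ℝ) + 1)))
        (by simpa using (tendsto_one_div_add_atTop_nhds_zero_nat (𝕜 := ℝ)).const_mul T)
      rw [mul_one_div]
      have h1 : (1 : ℝ) ≤ Ns j := by exact_mod_cast hNs j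
      refine div_le_div_of_nonneg_left hT.le (by positivity) ?_
      have : (0 : ℝ) ≤ (j : ℝ) + 1 := by positivity
      nlinarith
    obtain ⟨ψ, hψ, u, h1, h2, h3, h4⟩ := DDG.core (D := Δxs) (τ := fun j : ℕ => T / ((Ns j : ℝ) * (j + 1))) hlam hdata hu₀1 hu₀bv hcompat hT hH hΔxs0 hτ
    refine ⟨ψ, hψ, u, h1, h2, fun K hK hKc => ?_, h4⟩
    have e : ∀ j (p : ℝ × ℝ), interpBL (Δxs (ψ j)) (T / (Ns (ψ j) : ℝ))
        (Uiter clam lam (Δxs (ψ j)) (T / (Ns (ψ j) : ℝ)) b fhat a u₀) p.1 p.2 =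
        interpBL (Δxs (ψ j)) (T / ((Ns (ψ j) : ℝ) * ((ψ j : ℕ) + 1)))
        (Uiter clam lam (Δxs (ψ j)) (T / ((Ns (ψ j) : ℝ) * ((ψ j : ℕ) + 1))) b fhat a u₀) p.1 p.2 :=
      fun j p => DDG.degen_interp hdeg hC1 _ _ _ _ _ _ _ _
    simp only [e]
    exact h3 K hK hKc
  · have hH : ∀ j, DDG.Hyp clam lam (Δxs j) (T / (Ns j : ℝ)) b f a fhat := fun j =>
      ⟨hlam, hclam, hb, hΔxs j, div_pos hT (by exact_mod_cast hNs j), hdata, hcfl j⟩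
    have hτ := DDG.small_step (D := Δxs) (τ := fun j => T / (Ns j : ℝ)) hH hΔxs0 hdeg
    exact DDG.core (D := Δxs) (τ := fun j => T / (Ns j : ℝ)) hlam hdata hu₀1 hu₀bv hcompat hT hH hΔxs0 hτ
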